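/- There exist positive constants c_star, C, c_a, c_b with the following property. Let A₀ ∈ ℝ^{n×n} be invertible with condition number κ(A₀), let θ ∈ (0, 1/2), 0 < μ < c_a · min{θ n^{-1}, n^{-5/4}}, let X₀ ∈ ℝ^{n×p} have i.i.d. BG(θ) entries, set Y = A₀X₀, and suppose p ≥ (C/(c_star² θ²)) · max{n⁴/μ⁴, n⁵/μ²} · κ(A₀)⁸ · log⁴(κ(A₀) n/(μθ)). Let Ȳ = √(pθ) (YYᵀ)^{−1/2} Y and let A₀ = UΣVᵀ be a singular value decomposition of A₀. Then with probability at least 1 − c_b p^{-6}, all of the following hold simultaneously: (i) ∇²g(w; VUᵀȲ) ⪰ (c_star θ/(2μ)) I for all w with ‖w‖ ≤ μ/(4√2); (ii) wᵀ∇g(w; VUᵀȲ)/‖w‖ ≥ (1/2) c_star θ for all w with μ/(4√2) ≤ ‖w‖ ≤ 1/(20√5); (iii) wᵀ∇²g(w; VUᵀȲ)w/‖w‖² ≤ −(1/2) c_star θ for all w with 1/(20√5) ≤ ‖w‖ ≤ √((4n−1)/(4n)); and (iv) the function w ↦ g(w; VUᵀȲ) has exactly one local minimizer w_star over the open set Γ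 = {w : ‖w‖ < √((4n−1)/(4n))}, and this minimizer satisfies ‖w_star‖ ≤ μ/7. -/

import Mathlib

open MeasureTheory ProbabilityTheory Real Matrix
open scoped RealInnerProductSpace ENNReal NNReal

noncomputable section

/-- The Bernoulli–Gaussian law `BG(θ)`: with probability `θ` a standard Gaussian,
with probability `1-θ` a point mass at `0`. -/
def bg (θ : ℝ) : Measure ℝ :=
  θ.toNNReal • gaussianReal 0 1 + (1 - θ).toNNReal • Measure.dirac 0

instance bg.instIsFiniteMeasure (θ : ℝ) : IsFiniteMeasure (bg θ) := by
  unfold bg; infer_instance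

/-- Law of an `n × p` matrix with i.i.d. `BG(θ)` entries. -/
def bgMatrix (θ : ℝ) (n p : ℕ) : Measure (Fin n → Fin p → ℝ) :=
  Measure.pi fun _ => Measure.pi fun _ => bg θ

/-- Law of a vector in `ℝ^n` with i.i.d. `BG(θ)` entries. -/
def bgVec (θ : ℝ) (n : ℕ) : Measure (Fin n → ℝ) :=
  Measure.pi fun _ => bg θ

/-- The smooth sparsity surrogate `h_μ(z) = μ log cosh (z/μ)`. -/
def hmu (μ z : ℝ) : ℝ := μ * Real.log (Real.cosh (z / μ))

/-- Reparametrization `q(w) = (w, √(1-‖w‖²))` with `w` in the unit ball of `ℝ^{n-1}`. -/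
def qmap (n : ℕ) (w : EuclideanSpace ℝ (Fin (n - 1))) : Fin n → ℝ :=
  fun i => if h : (i : ℕ) < n - 1 then w ⟨i, h⟩ else Real.sqrt (1 - ‖w‖ ^ 2)

/-- `f(q; Y) = (1/p) ∑ₖ h_μ(qᵀ yₖ)`. -/
def ffun (n p : ℕ) (μ : ℝ) (Y : Matrix (Fin n) (Fin p) ℝ)
    (q : EuclideanSpace ℝ (Fin n)) : ℝ :=
  (p : ℝ)⁻¹ * ∑ k : Fin p, hmu μ (∑ i : Fin n, q i * Y i k)

/-- `g(w; Y) = f(q(w); Y)`. -/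
def gfun (n p : ℕ) (μ : ℝ) (Y : Matrix (Fin n) (Fin p) ℝ)
    (w : EuclideanSpace ℝ (Fin (n - 1))) : ℝ :=
  (p : ℝ)⁻¹ * ∑ k : Fin p, hmu μ (∑ i : Fin n, qmap n w i * Y i k)

/-- Gradient `∇g(w; Y)` in `w`. -/
def gradg (n p : ℕ) (μ : ℝ) (Y : Matrix (Fin n) (Fin p) ℝ)
    (w : EuclideanSpace ℝ (Fin (n - 1))) : EuclideanSpace ℝ (Fin (n - 1)) :=
  gradient (gfun n p μ Y) w

/-- Hessian `∇²g(w; Y)` in `w`, as a continuous linear map. -/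
def hessg (n p : ℕ) (μ : ℝ) (Y : Matrix (Fin n) (Fin p) ℝ)
    (w : EuclideanSpace ℝ (Fin (n - 1))) :
    EuclideanSpace ℝ (Fin (n - 1)) →L[ℝ] EuclideanSpace ℝ (Fin (n - 1)) :=
  fderiv ℝ (gradg n p μ Y) w

/-- The set `Γ = {w : ‖w‖ < √((4n-1)/(4n))}`. -/
def GammaSet (n : ℕ) : Set (EuclideanSpace ℝ (Fin (n - 1))) :=
  {w | ‖w‖ < Real.sqrt ((4 * (n : ℝ) - 1) / (4 * n))}

/-- Spectral (`ℓ²→ℓ²` operator) norm of а matrix. -/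
def specNorm {m k : ℕ} (M : Matrix (Fin m) (Fin k) ℝ) : ℝ :=
  ‖LinearMap.toContinuousLinearMap (Matrix.toEuclideanLin M)‖

/-- Largest magnitude of an entry of a matrix. -/
def Minf {m k : ℕ} (M : Matrix (Fin m) (Fin k) ℝ) : ℝ := ⨆ i, ⨆ j, |M i j|

/-- Condition number: ratio of largest to smallest singular value. -/
def kappa {n : ℕ} (s : Fin n → ℝ) : ℝ := (⨆ i, s i) / (⨅ i, s i)

/-- Signed standard basis vectors `{± e_i}` of `ℝ^n`. -/
def SignedBasis (n : ℕ) : Set (EuclideanSpace ℝ (Fin n)) :=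
  {b | ∃ i : Fin n, b = EuclideanSpace.single i (1 : ℝ) ∨ b = -EuclideanSpace.single i (1 : ℝ)}

/-- Set of local minimizers of `f(·; Y)` over the unit sphere `S^{n-1}`. -/
def LocalMins (n p : ℕ) (μ : ℝ) (Y : Matrix (Fin n) (Fin p) ℝ) :
    Set (EuclideanSpace ℝ (Fin n)) :=
  {q | q ∈ Metric.sphere (0 : EuclideanSpace ℝ (Fin n)) 1 ∧
       IsLocalMinOn (ffun n p μ Y) (Metric.sphere (0 : EuclideanSpace ℝ (Fin n)) 1) q}

/-- Expected objective `E_x[h_μ(q(w)ᵀ x)]` for `x` with i.i.d. `BG(θ)` entries. -/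
def Gexp (n : ℕ) (θ μ : ℝ) (w : EuclideanSpace ℝ (Fin (n - 1))) : ℝ :=
  ∫ x, hmu μ (∑ i : Fin n, qmap n w i * x i) ∂(bgVec θ n)

/-! ### The scalar function `h_μ` and its derivatives -/

lemma hasDerivAt_tanh (r : ℝ) : HasDerivAt Real.tanh (1 / Real.cosh r ^ 2) r := by
  have h := (Real.hasDerivAt_sinh r).div (Real.hasDerivAt_cosh r) (Real.cosh_pos r).ne'
  have e : Real.tanh = fun x => Real.sinh x / Real.cosh x := by
    ext x; exact Real.tanh_eq_sinh_div_cosh x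
  rw [e]
  refine h.congr_deriv ?_
  have := Real.cosh_sq r
  congr 1
  nlinarith

lemma one_div_cosh_sq (r : ℝ) : 1 / Real.cosh r ^ 2 = 1 - Real.tanh r ^ 2 := by
  have h := (Real.cosh_pos r).ne'
  rw [Real.tanh_eq_sinh_div_cosh]
  field_simp
  have := Real.cosh_sq r
  linarith

lemma monotone_tanh : Monotone Real.tanh := by
  refine monotone_of_deriv_nonneg (fun r => (hasDerivAt_tanh r).differentiableAt) fun r => ?_
  rw [(hasDerivAt_tanh r).deriv]
  positivity

lemma tanh_nonneg {r : ℝ} (hr : 0 ≤ r) : 0 ≤ Real.tanh r := by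
  simpa using monotone_tanh hr

lemma tanh_le_self {r : ℝ} (hr : 0 ≤ r) : Real.tanh r ≤ r := by
  have hm : Monotone fun x : ℝ => x - Real.tanh x := by
    refine monotone_of_deriv_nonneg (fun r => ?_) fun r => ?_
    · exact ((hasDerivAt_id r).sub (hasDerivAt_tanh r)).differentiableAt
    · have hd : HasDerivAt (fun x : ℝ => x - Real.tanh x) (1 - 1 / Real.cosh r ^ 2) r :=
        (hasDerivAt_id' r).sub (hasDerivAt_tanh r)
      rw [hd.deriv, one_div_cosh_sq]
      nlinarith [sq_nonneg (Real.tanh r)]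
  have := hm hr
  simp at this
  exact this

lemma tanh_sq_le_sq (r : ℝ) : Real.tanh r ^ 2 ≤ r ^ 2 := by
  rcases le_total 0 r with h | h
  · have h1 := tanh_le_self h
    have h2 := tanh_nonneg h
    nlinarith
  · have h' : 0 ≤ -r := by linarith
    have h1 := tanh_le_self h'
    have h2 := tanh_nonneg h'
    rw [Real.tanh_neg] at h1 h2
    nlinarith

lemma sub_cube_le_tanh {r : ℝ} (hr : 0 ≤ r) : r - r ^ 3 / 3 ≤ Real.tanh r := by
  have hm : Monotone fun x : ℝ => Real.tanh x - (x - x ^ 3 / 3) := by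
    have hd : ∀ r : ℝ, HasDerivAt (fun x : ℝ => Real.tanh x - (x - x ^ 3 / 3))
        (1 / Real.cosh r ^ 2 - (1 - r ^ 2)) r := by
      intro r
      have h3 : HasDerivAt (fun x : ℝ => x ^ 3 / 3) (r ^ 2) r := by
        refine ((hasDerivAt_pow 3 r).div_const 3).congr_deriv ?_
        norm_num
      exact (hasDerivAt_tanh r).sub ((hasDerivAt_id' r).sub h3)
    refine monotone_of_deriv_nonneg (fun r => (hd r).differentiableAt) fun r => ?_
    rw [(hd r).deriv, one_div_cosh_sq]
    have := tanh_sq_le_sq r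
    linarith
  have := hm hr
  simp at this
  linarith

lemma sq_sub_le_tanh_mul (r : ℝ) : r ^ 2 - r ^ 4 / 3 ≤ Real.tanh r * r := by
  rcases le_total 0 r with h | h
  · have h1 := sub_cube_le_tanh h
    nlinarith
  · have h' : 0 ≤ -r := by linarith
    have h1 := sub_cube_le_tanh h'
    rw [Real.tanh_neg] at h1
    nlinarith

lemma self_mul_one_sub_tanh_le (r : ℝ) : r * (1 - Real.tanh r) ≤ 1 := by
  have h1 : 1 - Real.tanh r = Real.exp (-r) / Real.cosh r := by
    have h := (Real.cosh_pos r).ne'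
    rw [Real.tanh_eq_sinh_div_cosh]
    field_simp
    rw [Real.cosh_sub_sinh]
  have h2 := Real.one_le_cosh r
  have h3 : r * Real.exp (-r) ≤ 1 := by
    rw [Real.exp_neg, ← div_eq_mul_inv, div_le_one (Real.exp_pos r)]
    linarith [Real.add_one_le_exp r]
  rw [h1, ← mul_div_assoc, div_le_one (by linarith)]
  linarith

/-- First derivative of `h_μ`. -/
def hmuDeriv (μ z : ℝ) : ℝ := Real.tanh (z / μ)

/-- Second derivative of `h_μ`. -/
def hmuDeriv2 (μ z : ℝ) : ℝ := μ⁻¹ * (1 / Real.cosh (z / μ) ^ 2)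

lemma hasDerivAt_hmu {μ : ℝ} (hμ : 0 < μ) (z : ℝ) : HasDerivAt (hmu μ) (hmuDeriv μ z) z := by
  have h1 : HasDerivAt (fun z : ℝ => z / μ) (1 / μ) z := (hasDerivAt_id' z).div_const μ
  have h2 : HasDerivAt (fun z : ℝ => Real.cosh (z / μ)) (Real.sinh (z / μ) * (1 / μ)) z :=
    h1.cosh
  have h3 := (h2.log (Real.cosh_pos _).ne').const_mul μ
  refine h3.congr_deriv ?_
  rw [hmuDeriv, Real.tanh_eq_sinh_div_cosh]
  have := (Real.cosh_pos (z / μ)).ne'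
  field_simp

lemma hasDerivAt_hmuDeriv (μ z : ℝ) :
    HasDerivAt (hmuDeriv μ) (hmuDeriv2 μ z) z := by
  have h1 : HasDerivAt (fun z : ℝ => z / μ) (1 / μ) z := (hasDerivAt_id' z).div_const μ
  refine ((hasDerivAt_tanh (z / μ)).comp z h1).congr_deriv ?_
  rw [hmuDeriv2, one_div μ, mul_comm]

lemma continuous_hmuDeriv (μ : ℝ) : Continuous (hmuDeriv μ) :=
  continuous_iff_continuousAt.2 fun z => (hasDerivAt_hmuDeriv μ z).continuousAt

lemma continuous_hmuDeriv2 (μ : ℝ) : Continuous (hmuDeriv2 μ) := by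
  unfold hmuDeriv2
  refine continuous_const.mul (continuous_const.div ?_ fun z => ?_)
  · exact (Real.continuous_cosh.comp (continuous_id.div_const μ)).pow 2
  · have := Real.cosh_pos (z / μ); positivity

lemma abs_hmuDeriv_le (μ z : ℝ) : |hmuDeriv μ z| ≤ 1 := (Real.abs_tanh_lt_one _).le

lemma hmuDeriv2_nonneg {μ : ℝ} (hμ : 0 < μ) (z : ℝ) : 0 ≤ hmuDeriv2 μ z := by
  unfold hmuDeriv2; positivity

lemma hmuDeriv2_le {μ : ℝ} (hμ : 0 < μ) (z : ℝ) : hmuDeriv2 μ z ≤ μ⁻¹ := by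
  unfold hmuDeriv2
  rw [one_div_cosh_sq]
  have : 0 < μ⁻¹ := by positivity
  nlinarith [sq_nonneg (Real.tanh (z / μ))]

lemma le_hmuDeriv2 {μ : ℝ} (hμ : 0 < μ) (z : ℝ) : μ⁻¹ * (1 - (z / μ) ^ 2) ≤ hmuDeriv2 μ z := by
  unfold hmuDeriv2
  rw [one_div_cosh_sq]
  have : 0 < μ⁻¹ := by positivity
  have := tanh_sq_le_sq (z / μ)
  gcongr

lemma hmuDeriv2_mul_sq_le {μ : ℝ} (hμ : 0 < μ) (z : ℝ) : hmuDeriv2 μ z * z ^ 2 ≤ μ := by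
  have h1 : (z / μ) ^ 2 ≤ Real.cosh (z / μ) ^ 2 := by
    have := Real.cosh_sq (z / μ)
    rw [this]
    have h2 : (z / μ) ^ 2 ≤ Real.sinh (z / μ) ^ 2 := by
      rw [sq_le_sq]
      rcases le_total 0 (z / μ) with h | h
      · rw [abs_of_nonneg h, abs_of_nonneg (Real.sinh_nonneg_iff.2 h)]
        exact Real.self_le_sinh_iff.2 h
      · rw [abs_of_nonpos h, abs_of_nonpos (Real.sinh_nonpos_iff.2 h)]
        linarith [Real.sinh_le_self_iff.2 h]
    linarith
  have hc : 0 < Real.cosh (z / μ) ^ 2 := by have := Real.cosh_pos (z / μ); positivity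
  have e : hmuDeriv2 μ z * z ^ 2 = μ * ((z / μ) ^ 2 / Real.cosh (z / μ) ^ 2) := by
    unfold hmuDeriv2
    field_simp
  rw [e]
  have := (div_le_one hc).2 h1
  nlinarith

lemma abs_sub_le_hmuDeriv_mul {μ : ℝ} (hμ : 0 < μ) (z : ℝ) : |z| - μ ≤ hmuDeriv μ z * z := by
  have key : ∀ z : ℝ, 0 ≤ z → z - μ ≤ hmuDeriv μ z * z := by
    intro z hz
    have h := self_mul_one_sub_tanh_le (z / μ)
    have h2 := mul_le_mul_of_nonneg_left h hμ.le
    have e : μ * (z / μ * (1 - Real.tanh (z / μ))) = z - Real.tanh (z / μ) * z := by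
      field_simp
    rw [e] at h2
    unfold hmuDeriv
    linarith
  rcases le_total 0 z with h | h
  · rw [abs_of_nonneg h]; exact key z h
  · rw [abs_of_nonpos h]
    have := key (-z) (by linarith)
    simpa [hmuDeriv, neg_div] using this

lemma abs_hmuDeriv_sub_le {μ : ℝ} (hμ : 0 < μ) (z z' : ℝ) :
    |hmuDeriv μ z - hmuDeriv μ z'| ≤ μ⁻¹ * |z - z'| := by
  have := Convex.norm_image_sub_le_of_norm_hasDerivWithin_le (f := hmuDeriv μ)
    (f' := hmuDeriv2 μ) (s := Set.univ) (x := z') (y := z) (C := μ⁻¹)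
    (fun x _ => (hasDerivAt_hmuDeriv μ x).hasDerivWithinAt)
    (fun x _ => by
      rw [Real.norm_eq_abs, abs_of_nonneg (hmuDeriv2_nonneg hμ x)]
      exact hmuDeriv2_le hμ x) convex_univ trivial trivial
  simpa using this

lemma abs_hmuDeriv2_sub_le {μ : ℝ} (hμ : 0 < μ) (z z' : ℝ) :
    |hmuDeriv2 μ z - hmuDeriv2 μ z'| ≤ 2 * μ⁻¹ ^ 2 * |z - z'| := by
  have e : ∀ z, hmuDeriv2 μ z = μ⁻¹ * (1 - hmuDeriv μ z ^ 2) := fun z => by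
    rw [hmuDeriv2, one_div_cosh_sq, hmuDeriv]
  have h1 := abs_hmuDeriv_sub_le hμ z z'
  have h2 := abs_hmuDeriv_le μ z
  have h3 := abs_hmuDeriv_le μ z'
  have h4 : |hmuDeriv μ z' + hmuDeriv μ z| ≤ 2 := (abs_add_le _ _).trans (by linarith)
  have e2 : hmuDeriv2 μ z - hmuDeriv2 μ z' =
      -(μ⁻¹ * ((hmuDeriv μ z - hmuDeriv μ z') * (hmuDeriv μ z' + hmuDeriv μ z))) := by
    rw [e, e]; ring
  have hi : 0 < μ⁻¹ := by positivity
  rw [e2, abs_neg, abs_mul, abs_mul, abs_of_pos hi]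
  calc μ⁻¹ * (|hmuDeriv μ z - hmuDeriv μ z'| * |hmuDeriv μ z' + hmuDeriv μ z|)
      ≤ μ⁻¹ * ((μ⁻¹ * |z - z'|) * 2) := by gcongr
    _ = _ := by ring

/-! ### The Bernoulli–Gaussian law -/

lemma isProbabilityMeasure_bg {θ : ℝ} (h0 : 0 ≤ θ) (h1 : θ ≤ 1) : IsProbabilityMeasure (bg θ) := by
  constructor
  have : θ.toNNReal + (1 - θ).toNNReal = 1 := by
    rw [← Real.toNNReal_add h0 (by linarith)]; simp
  simp only [bg, Measure.add_apply, Measure.smul_apply, measure_univ]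
  simp only [ENNReal.smul_def, smul_eq_mul, mul_one]
  exact_mod_cast this

instance isFiniteMeasure_bgVec (θ : ℝ) (n : ℕ) : IsFiniteMeasure (bgVec θ n) := by
  unfold bgVec; infer_instance

/-- The columns of a random matrix with i.i.d. `BG(θ)` entries are i.i.d. random vectors. -/
lemma bgMatrix_map_transpose (θ : ℝ) (n p : ℕ) :
    (bgMatrix θ n p).map (fun X k i => X i k) = Measure.pi fun _ : Fin p => bgVec θ n := by
  symm
  refine Measure.pi_eq_generateFrom (C := fun _ => Set.univ.pi '' Set.univ.pi
    fun _ : Fin n => {s : Set ℝ | MeasurableSet s}) (fun _ => generateFrom_pi)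
    (fun _ => isPiSystem_pi) (fun _ => ⟨fun _ => Set.univ, ?_, ?_, ?_⟩) ?_
  · intro _
    exact ⟨fun _ => Set.univ, by simp, by simp⟩
  · intro _; exact measure_lt_top _ _
  · exact Set.iUnion_const _
  · intro s hs
    choose t ht hst using hs
    have hm : ∀ k i, MeasurableSet (t k i) := fun k i => ht k i trivial
    have hT : Measurable fun (X : Fin n → Fin p → ℝ) k i => X i k := by fun_prop
    rw [Measure.map_apply hT]
    · have e : (fun (X : Fin n → Fin p → ℝ) k i => X i k) ⁻¹' Set.univ.pi s =
          Set.univ.pi fun i => Set.univ.pi fun k => t k i := by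
        ext X
        simp only [Set.mem_preimage, Set.mem_pi, Set.mem_univ, true_implies, ← hst]
        exact ⟨fun h i k => h k i, fun h k i => h i k⟩
      rw [e, bgMatrix, Measure.pi_pi]
      simp_rw [Measure.pi_pi, ← hst, bgVec, Measure.pi_pi]
      exact Finset.prod_comm
    · refine MeasurableSet.univ_pi fun k => ?_
      rw [← hst]
      exact MeasurableSet.univ_pi (hm k)

/-- The Bernoulli law on `{0, 1} ⊆ ℝ`. -/
def bern (θ : ℝ) : Measure ℝ :=
  θ.toNNReal • Measure.dirac 1 + (1 - θ).toNNReal • Measure.dirac 0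

instance isFiniteMeasure_bern (θ : ℝ) : IsFiniteMeasure (bern θ) := by
  unfold bern; infer_instance

lemma isProbabilityMeasure_bern {θ : ℝ} (h0 : 0 ≤ θ) (h1 : θ ≤ 1) :
    IsProbabilityMeasure (bern θ) := by
  constructor
  have : θ.toNNReal + (1 - θ).toNNReal = 1 := by
    rw [← Real.toNNReal_add h0 (by linarith)]; simp
  simp only [bern, Measure.add_apply, Measure.smul_apply, measure_univ]
  simp only [ENNReal.smul_def, smul_eq_mul, mul_one]
  exact_mod_cast this

lemma ae_bern (θ : ℝ) : ∀ᵐ b ∂(bern θ), b = 0 ∨ b = 1 := by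
  rw [bern, ae_add_measure_iff]
  constructor
  · refine (Measure.smul_absolutelyContinuous (c := (θ.toNNReal : ℝ≥0∞))).ae_le ?_
    rw [ae_dirac_eq]; simp
  · refine (Measure.smul_absolutelyContinuous (c := ((1 - θ).toNNReal : ℝ≥0∞))).ae_le ?_
    rw [ae_dirac_eq]; simp

lemma integral_bern {θ : ℝ} (h0 : 0 ≤ θ) (h1 : θ ≤ 1) (f : ℝ → ℝ) :
    ∫ b, f b ∂(bern θ) = θ * f 1 + (1 - θ) * f 0 := by
  rw [bern, integral_add_measure, integral_smul_nnreal_measure, integral_smul_nnreal_measure,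
    integral_dirac, integral_dirac]
  · simp [NNReal.smul_def, h0, h1]
  · exact (integrable_dirac (by simp)).smul_measure (c := (θ.toNNReal : ℝ≥0∞)) (by simp)
  · exact (integrable_dirac (by simp)).smul_measure (c := ((1 - θ).toNNReal : ℝ≥0∞)) (by simp)

lemma bg_eq_map (θ : ℝ) :
    bg θ = ((bern θ).prod (gaussianReal 0 1)).map fun z => z.1 * z.2 := by
  ext s hs
  have hm : Measurable fun z : ℝ × ℝ => z.1 * z.2 := by fun_prop
  rw [Measure.map_apply hm hs, bern, Measure.add_prod]
  have key : ∀ (c : ℝ≥0) (b : ℝ), ((c • Measure.dirac b).prod (gaussianReal 0 1))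
      ((fun z : ℝ × ℝ => z.1 * z.2) ⁻¹' s) = c * gaussianReal 0 1 ((fun v => b * v) ⁻¹' s) := by
    intro c b
    rw [Measure.prod_apply (hm hs)]
    change ∫⁻ x, _ ∂((c : ℝ≥0∞) • Measure.dirac b) = _
    rw [lintegral_smul_measure, lintegral_dirac' _ (measurable_measure_prodMk_left (hm hs))]
    rfl
  rw [Measure.add_apply, key, key, bg]
  simp only [Measure.add_apply, one_mul, zero_mul, Set.preimage_id']
  have : gaussianReal 0 1 ((fun _ => (0 : ℝ)) ⁻¹' s) = Measure.dirac (0 : ℝ) s := by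
    by_cases h : (0 : ℝ) ∈ s
    · simp [h]
    · simp [h]
  rw [this]
  rfl

/-- A Bernoulli–Gaussian vector is a Gaussian vector masked by independent Bernoulli variables. -/
lemma bgVec_eq_map (θ : ℝ) (n : ℕ) :
    bgVec θ n = ((Measure.pi fun _ : Fin n => bern θ).prod
      (stdGaussian (EuclideanSpace ℝ (Fin n)))).map fun z i => z.1 i * z.2 i := by
  have h1 : bgVec θ n = (Measure.pi fun _ : Fin n => (bern θ).prod (gaussianReal 0 1)).map
      fun x i => (x i).1 * (x i).2 := by
    have : ∀ i : Fin n, SigmaFinite (((bern θ).prod (gaussianReal 0 1)).map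
      fun z : ℝ × ℝ => z.1 * z.2) := fun _ => by infer_instance
    rw [Measure.pi_map_pi (μ := fun _ : Fin n => (bern θ).prod (gaussianReal 0 1))
      (f := fun _ (z : ℝ × ℝ) => z.1 * z.2) (fun _ => by fun_prop)]
    rw [bgVec, bg_eq_map]
  have h2 := (measurePreserving_arrowProdEquivProdArrow ℝ ℝ (Fin n) (fun _ => bern θ)
    (fun _ => gaussianReal 0 1)).map_eq
  rw [h1, ← map_pi_eq_stdGaussian]
  have h3 : (Measure.pi fun _ : Fin n => bern θ).prod ((Measure.pi fun _ : Fin n =>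
      gaussianReal 0 1).map (WithLp.toLp 2)) = ((Measure.pi fun _ : Fin n => bern θ).prod
      (Measure.pi fun _ : Fin n => gaussianReal 0 1)).map (Prod.map id (WithLp.toLp 2)) := by
    rw [← Measure.map_prod_map _ _ measurable_id (by fun_prop), Measure.map_id]
  rw [h3, ← h2, Measure.map_map, Measure.map_map]
  · rfl
  · fun_prop
  · exact MeasurableEquiv.measurable _
  · refine measurable_pi_lambda _ fun i => ?_
    fun_prop
  · fun_prop

/-! ### Gaussian integrals -/

lemma integrable_of_le_norm_pow_four {E : Type*} [NormedAddCommGroup E] [InnerProductSpace ℝ E]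
    [FiniteDimensional ℝ E] [MeasurableSpace E] [BorelSpace E]
    (ν : Measure E) [IsGaussian ν] {F : E → ℝ} (hF : Continuous F) {C : ℝ}
    (h : ∀ x, |F x| ≤ C * (1 + ‖x‖ ^ 4)) : Integrable F ν := by
  have h4 : Integrable (fun x : E => ‖x‖ ^ 4) ν := by
    have := (IsGaussian.memLp_id ν (4 : ℕ) (by simp)).integrable_norm_pow (by norm_num)
    simpa using this
  refine (((integrable_const (1 : ℝ)).add h4).const_mul C).mono'
    hF.aestronglyMeasurable (Filter.Eventually.of_forall fun x => ?_)
  simpa using h x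

/-- Gaussian integration by parts. -/
lemma gaussian_integration_by_parts {f f' : ℝ → ℝ} (hf : ∀ x, HasDerivAt f (f' x) x)
    (h0 : Integrable f (gaussianReal 0 1)) (h1 : Integrable f' (gaussianReal 0 1))
    (h2 : Integrable (fun x => f x * x) (gaussianReal 0 1)) :
    ∫ x, f x * x ∂(gaussianReal 0 1) = ∫ x, f' x ∂(gaussianReal 0 1) := by
  have hI : ∀ g : ℝ → ℝ, Integrable g (gaussianReal 0 1) →
      Integrable (fun x => g x * gaussianPDFReal 0 1 x) := by
    intro g hg
    rw [gaussianReal_of_var_ne_zero 0 one_ne_zero,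
      integrable_withDensity_iff_integrable_smul' (measurable_gaussianPDF 0 1)
        (Filter.Eventually.of_forall fun x => by simp [gaussianPDF])] at hg
    refine hg.congr (Filter.Eventually.of_forall fun x => ?_)
    simp [toReal_gaussianPDF, mul_comm]
  have hd : ∀ x : ℝ, HasDerivAt (gaussianPDFReal 0 1) (-(x * gaussianPDFReal 0 1 x)) x := by
    intro x
    rw [gaussianPDFReal_def]
    have h : HasDerivAt (fun x : ℝ => -(x - 0) ^ 2 / (2 * ((1 : ℝ≥0) : ℝ))) (-x) x := by
      have := ((((hasDerivAt_id' x).sub_const 0).pow 2).neg.div_const (2 * ((1 : ℝ≥0) : ℝ)))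
      refine this.congr_deriv ?_
      simp
      ring
    refine (h.exp.const_mul _).congr_deriv ?_
    ring
  have key := integral_mul_deriv_eq_deriv_mul_of_integrable (u := f) (u' := f')
    (v := gaussianPDFReal 0 1) (v' := fun x => -(x * gaussianPDFReal 0 1 x))
    (fun x _ => hf x) (fun x _ => hd x)
    (by
      refine (hI _ h2).neg.congr (Filter.Eventually.of_forall fun x => ?_)
      simp; ring) (hI _ h1) (hI _ h0)
  rw [integral_gaussianReal_eq_integral_smul one_ne_zero,
    integral_gaussianReal_eq_integral_smul one_ne_zero]
  have e1 : ∫ x, gaussianPDFReal 0 1 x • (f x * x) =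
      - ∫ x, f x * -(x * gaussianPDFReal 0 1 x) := by
    rw [← integral_neg]
    congr 1; ext x; simp; ring
  have e2 : ∫ x, gaussianPDFReal 0 1 x • f' x = ∫ x, f' x * gaussianPDFReal 0 1 x := by
    congr 1; ext x; simp; ring
  rw [e1, e2, key, neg_neg]

lemma integrable_gaussianReal_of_le {F : ℝ → ℝ} (hF : Continuous F) {C : ℝ}
    (h : ∀ x, |F x| ≤ C * (1 + x ^ 4)) : Integrable F (gaussianReal 0 1) := by
  refine integrable_of_le_norm_pow_four (C := C) _ hF fun x => ?_
  have : ‖x‖ ^ 4 = x ^ 4 := by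
    rw [Real.norm_eq_abs]; exact Even.pow_abs (by decide) x
  rw [this]; exact h x

lemma integral_sq_gaussianReal : ∫ x, x ^ 2 ∂(gaussianReal 0 1) = 1 := by
  have := gaussian_integration_by_parts (f := fun x => x) (f' := fun _ => 1)
    (fun x => hasDerivAt_id' x)
    (integrable_gaussianReal_of_le (C := 1) (by fun_prop) fun x => by
      rw [abs_le]; constructor <;> nlinarith [sq_nonneg (x ^ 2 - 1/2),
        sq_nonneg (x - 1/2), sq_nonneg (x + 1/2)])
    (integrable_const _)
    (integrable_gaussianReal_of_le (C := 1) (by fun_prop) fun x => by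
      rw [abs_le]; constructor <;> nlinarith [sq_nonneg (x ^ 2 - 1/2)])
  simpa [pow_two] using this

lemma integral_pow_four_gaussianReal : ∫ x, x ^ 4 ∂(gaussianReal 0 1) = 3 := by
  have := gaussian_integration_by_parts (f := fun x => x ^ 3) (f' := fun x => 3 * x ^ 2)
    (fun x => by simpa using hasDerivAt_pow 3 x)
    (integrable_gaussianReal_of_le (C := 1) (by fun_prop) fun x => by
      rw [abs_le]; constructor <;> nlinarith [sq_nonneg (x ^ 2 - x/2),
        sq_nonneg (x ^ 2 + x/2), sq_nonneg (x ^ 2 - 1/2),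
        sq_nonneg (x - 1/2), sq_nonneg (x + 1/2)])
    (integrable_gaussianReal_of_le (C := 3) (by fun_prop) fun x => by
      rw [abs_le]; constructor <;> nlinarith [sq_nonneg (x ^ 2 - 1/2)])
    (integrable_gaussianReal_of_le (C := 1) (by fun_prop) fun x => by
      rw [abs_le]; constructor <;> nlinarith [sq_nonneg (x ^ 2)])
  rw [integral_const_mul, integral_sq_gaussianReal] at this
  rw [← mul_one (3 : ℝ), ← this]
  congr 1

lemma lintegral_exp_sq_gaussianReal :
    ∫⁻ x, ENNReal.ofReal (Real.exp (x ^ 2 / 4)) ∂(gaussianReal 0 1) ≤ 2 := by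
  rw [gaussianReal_of_var_ne_zero 0 one_ne_zero,
    lintegral_withDensity_eq_lintegral_mul _ (measurable_gaussianPDF 0 1)
      (by fun_prop)]
  have e : ∀ x : ℝ, (gaussianPDF 0 1 * fun x : ℝ => ENNReal.ofReal (Real.exp (x ^ 2 / 4))) x =
      ENNReal.ofReal ((√(2 * π))⁻¹ * Real.exp (-(1/4) * x ^ 2)) := by
    intro x
    simp only [Pi.mul_apply, gaussianPDF, gaussianPDFReal_def]
    rw [← ENNReal.ofReal_mul (by positivity), mul_assoc, ← Real.exp_add]
    congr 3
    · simp
    · simp; ring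
  rw [lintegral_congr e, ← ofReal_integral_eq_lintegral_ofReal, integral_const_mul,
    integral_gaussian]
  · rw [show (2 : ℝ≥0∞) = ENNReal.ofReal 2 by simp]
    refine ENNReal.ofReal_le_ofReal ?_
    rw [inv_mul_le_iff₀ (by positivity)]
    rw [Real.sqrt_le_left (by positivity), mul_pow, Real.sq_sqrt (by positivity)]
    nlinarith [Real.pi_pos]
  · exact (integrable_exp_neg_mul_sq (by norm_num)).const_mul _
  · exact Filter.Eventually.of_forall fun x => by positivity

section std

variable {n : ℕ}

lemma map_inner_stdGaussian (c : EuclideanSpace ℝ (Fin n)) :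
    (stdGaussian (EuclideanSpace ℝ (Fin n))).map (fun v => ⟪c, v⟫) =
      (gaussianReal 0 1).map (fun x => ‖c‖ * x) := by
  have h := IsGaussian.map_eq_gaussianReal (μ := stdGaussian (EuclideanSpace ℝ (Fin n)))
    (innerSL ℝ c)
  rw [integral_strongDual_stdGaussian, variance_dual_stdGaussian, innerSL_apply_norm] at h
  rw [gaussianReal_map_const_mul]
  refine (show _ = _ from h).trans ?_
  congr 1
  · simp
  · ext; simp

lemma integral_comp_inner_stdGaussian (c : EuclideanSpace ℝ (Fin n)) {f : ℝ → ℝ}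
    (hf : Continuous f) :
    ∫ v, f ⟪c, v⟫ ∂(stdGaussian (EuclideanSpace ℝ (Fin n))) =
      ∫ x, f (‖c‖ * x) ∂(gaussianReal 0 1) := by
  rw [← integral_map (φ := fun v => ⟪c, v⟫) (by fun_prop) hf.aestronglyMeasurable,
    map_inner_stdGaussian, integral_map (by fun_prop) hf.aestronglyMeasurable]

lemma indepFun_inner_stdGaussian {c r : EuclideanSpace ℝ (Fin n)} (h : ⟪c, r⟫ = 0) :
    IndepFun (fun v => ⟪c, v⟫) (fun v => ⟪r, v⟫) (stdGaussian (EuclideanSpace ℝ (Fin n))) := by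
  refine HasGaussianLaw.indepFun_of_covariance_eq_zero ?_ ?_
  · exact (IsGaussian.hasGaussianLaw_id (μ := stdGaussian (EuclideanSpace ℝ (Fin n)))).map_fun
      ((innerSL ℝ c).prod (innerSL ℝ r))
  · rw [← covarianceBilin_apply_eq_cov IsGaussian.memLp_two_id, covarianceBilin_stdGaussian]
    exact h

lemma integral_inner_sq_stdGaussian (c : EuclideanSpace ℝ (Fin n)) :
    ∫ v, ⟪c, v⟫ ^ 2 ∂(stdGaussian (EuclideanSpace ℝ (Fin n))) = ‖c‖ ^ 2 := by
  rw [integral_comp_inner_stdGaussian c (f := fun x => x ^ 2) (by fun_prop)]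
  simp_rw [mul_pow]
  rw [integral_const_mul, integral_sq_gaussianReal, mul_one]

lemma integral_inner_pow_four_stdGaussian (c : EuclideanSpace ℝ (Fin n)) :
    ∫ v, ⟪c, v⟫ ^ 4 ∂(stdGaussian (EuclideanSpace ℝ (Fin n))) = 3 * ‖c‖ ^ 4 := by
  rw [integral_comp_inner_stdGaussian c (f := fun x => x ^ 4) (by fun_prop)]
  simp_rw [mul_pow]
  rw [integral_const_mul, integral_pow_four_gaussianReal, mul_comm]

lemma abs_inner_pow_four_le (c v : EuclideanSpace ℝ (Fin n)) :
    |⟪c, v⟫| ^ 4 ≤ ‖c‖ ^ 4 * (1 + ‖v‖ ^ 4) := by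
  have h := abs_real_inner_le_norm c v
  calc |⟪c, v⟫| ^ 4 ≤ (‖c‖ * ‖v‖) ^ 4 := by gcongr
    _ = ‖c‖ ^ 4 * ‖v‖ ^ 4 := by ring
    _ ≤ _ := by gcongr; linarith

/-- Functions of polynomial growth in two inner products are Gaussian integrable. -/
lemma integrable_stdGaussian_of_le {F : EuclideanSpace ℝ (Fin n) → ℝ} (hF : Continuous F)
    (c d : EuclideanSpace ℝ (Fin n)) {C : ℝ}
    (h : ∀ v, |F v| ≤ C * (1 + |⟪c, v⟫| ^ 4 + |⟪d, v⟫| ^ 4)) :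
    Integrable F (stdGaussian (EuclideanSpace ℝ (Fin n))) := by
  refine integrable_of_le_norm_pow_four (C := |C| * (1 + ‖c‖ ^ 4 + ‖d‖ ^ 4)) _ hF fun v => ?_
  have h1 := abs_inner_pow_four_le c v
  have h2 := abs_inner_pow_four_le d v
  calc |F v| ≤ |C| * (1 + |⟪c, v⟫| ^ 4 + |⟪d, v⟫| ^ 4) :=
        (h v).trans (by gcongr; exact le_abs_self C)
    _ ≤ |C| * ((1 + ‖v‖ ^ 4) + ‖c‖ ^ 4 * (1 + ‖v‖ ^ 4) + ‖d‖ ^ 4 * (1 + ‖v‖ ^ 4)) := by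
        gcongr
        nlinarith [pow_nonneg (norm_nonneg v) 4]
    _ = _ := by ring

end std

/-! ### Bernoulli–Gaussian expectations -/

section pairing

variable {n : ℕ}

/-- The linear form `x ↦ cᵀ x`. -/
def pairing (c : EuclideanSpace ℝ (Fin n)) (x : Fin n → ℝ) : ℝ := ∑ i, c i * x i

/-- Coordinatewise product of a vector with a mask. -/
def mask (β : Fin n → ℝ) (c : EuclideanSpace ℝ (Fin n)) : EuclideanSpace ℝ (Fin n) :=
  WithLp.toLp 2 fun i => β i * c i

lemma pairing_eq_inner (c : EuclideanSpace ℝ (Fin n)) (x : Fin n → ℝ) :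
    pairing c x = ⟪c, WithLp.toLp 2 x⟫ := by
  simp [pairing, PiLp.inner_apply, mul_comm]

lemma pairing_mul (c v : EuclideanSpace ℝ (Fin n)) (β : Fin n → ℝ) :
    pairing c (fun i => β i * v i) = ⟪mask β c, v⟫ := by
  simp only [pairing, mask, PiLp.inner_apply, RCLike.inner_apply, conj_trivial]
  exact Finset.sum_congr rfl fun i _ => by ring

@[fun_prop]
lemma continuous_pairing (c : EuclideanSpace ℝ (Fin n)) : Continuous (pairing c) := by
  unfold pairing; fun_prop

lemma pairing_add_left (c d : EuclideanSpace ℝ (Fin n)) (x : Fin n → ℝ) :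
    pairing (c + d) x = pairing c x + pairing d x := by
  simp only [pairing_eq_inner, inner_add_left]

lemma pairing_sub_left (c d : EuclideanSpace ℝ (Fin n)) (x : Fin n → ℝ) :
    pairing (c - d) x = pairing c x - pairing d x := by
  simp only [pairing_eq_inner, inner_sub_left]

lemma pairing_smul_left (r : ℝ) (c : EuclideanSpace ℝ (Fin n)) (x : Fin n → ℝ) :
    pairing (r • c) x = r * pairing c x := by
  simp only [pairing_eq_inner, real_inner_smul_left]

lemma pairing_zero_left (x : Fin n → ℝ) : pairing (0 : EuclideanSpace ℝ (Fin n)) x = 0 := by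
  simp [pairing]

lemma norm_mask_sq (β : Fin n → ℝ) (hβ : ∀ i, β i = 0 ∨ β i = 1)
    (c : EuclideanSpace ℝ (Fin n)) : ‖mask β c‖ ^ 2 = ∑ i, c i ^ 2 * β i := by
  rw [EuclideanSpace.real_norm_sq_eq]
  refine Finset.sum_congr rfl fun i _ => ?_
  rcases hβ i with h | h <;> simp [mask, h]

lemma inner_mask (β : Fin n → ℝ) (hβ : ∀ i, β i = 0 ∨ β i = 1)
    (c d : EuclideanSpace ℝ (Fin n)) : ⟪mask β c, mask β d⟫ = ∑ i, c i * d i * β i := by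
  simp only [mask, PiLp.inner_apply, RCLike.inner_apply, conj_trivial]
  refine Finset.sum_congr rfl fun i _ => ?_
  rcases hβ i with h | h <;> simp [h, mul_comm]

lemma norm_mask_le (β : Fin n → ℝ) (hβ : ∀ i, β i = 0 ∨ β i = 1)
    (c : EuclideanSpace ℝ (Fin n)) : ‖mask β c‖ ≤ ‖c‖ := by
  refine le_of_sq_le_sq ?_ (norm_nonneg c)
  rw [norm_mask_sq β hβ, EuclideanSpace.real_norm_sq_eq]
  refine Finset.sum_le_sum fun i _ => ?_
  rcases hβ i with h | h <;> simp [h, sq_nonneg]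

end pairing

section bernoulli

variable {n : ℕ} {θ : ℝ}

lemma ae_pi_bern (n : ℕ) (θ : ℝ) :
    ∀ᵐ β ∂(Measure.pi fun _ : Fin n => bern θ), ∀ i, β i = 0 ∨ β i = 1 := by
  rw [Filter.eventually_all]
  intro i
  exact (Measure.tendsto_eval_ae_ae (μ := fun _ : Fin n => bern θ) (i := i)).eventually
    (ae_bern θ)

lemma integrable_pi_bern_of_le {F : (Fin n → ℝ) → ℝ} (hF : Continuous F) {C : ℝ}
    (h : ∀ β : Fin n → ℝ, (∀ i, β i = 0 ∨ β i = 1) → |F β| ≤ C) :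
    Integrable F (Measure.pi fun _ : Fin n => bern θ) := by
  refine (integrable_const C).mono' hF.aestronglyMeasurable ?_
  filter_upwards [ae_pi_bern n θ] with β hβ using h β hβ

lemma integral_bern_eval (h0 : 0 ≤ θ) (h1 : θ ≤ 1) (i : Fin n) :
    ∫ β, β i ∂(Measure.pi fun _ : Fin n => bern θ) = θ := by
  have := isProbabilityMeasure_bern h0 h1
  rw [integral_comp_eval (μ := fun _ : Fin n => bern θ) (i := i) (f := fun b => b)
    (by fun_prop), integral_bern h0 h1]
  simp

lemma integral_bern_eval_mul_eval (h0 : 0 ≤ θ) (h1 : θ ≤ 1) {i j : Fin n} (hij : i ≠ j) :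
    ∫ β, β i * β j ∂(Measure.pi fun _ : Fin n => bern θ) = θ ^ 2 := by
  have := isProbabilityMeasure_bern h0 h1
  have hI := (iIndepFun_pi (μ := fun _ : Fin n => bern θ) (X := fun _ b => b)
    (fun _ => by fun_prop)).indepFun hij
  rw [hI.integral_fun_mul_eq_mul_integral
    (measurable_pi_apply i).aestronglyMeasurable (measurable_pi_apply j).aestronglyMeasurable,
    integral_bern_eval h0 h1, integral_bern_eval h0 h1, pow_two]

end bernoulli

section bgVec

variable {n : ℕ} {θ : ℝ}

lemma integrable_prod_of_le {F : (Fin n → ℝ) → ℝ} (hF : Continuous F)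
    (c d : EuclideanSpace ℝ (Fin n)) {C : ℝ}
    (h : ∀ x, |F x| ≤ C * (1 + |pairing c x| ^ 4 + |pairing d x| ^ 4)) :
    Integrable (fun z : (Fin n → ℝ) × EuclideanSpace ℝ (Fin n) => F fun i => z.1 i * z.2 i)
      ((Measure.pi fun _ : Fin n => bern θ).prod (stdGaussian (EuclideanSpace ℝ (Fin n)))) := by
  have hN : Integrable (fun v : EuclideanSpace ℝ (Fin n) =>
      (|C| * (1 + ‖c‖ ^ 4 + ‖d‖ ^ 4)) * (1 + ‖v‖ ^ 4)) (stdGaussian _) := by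
    refine integrable_of_le_norm_pow_four (C := |C| * (1 + ‖c‖ ^ 4 + ‖d‖ ^ 4)) _ (by fun_prop)
      fun v => ?_
    rw [abs_of_nonneg (by positivity)]
  refine (hN.comp_snd (Measure.pi fun _ : Fin n => bern θ)).mono'
    (Continuous.aestronglyMeasurable (by fun_prop)) ?_
  have hae := (Measure.quasiMeasurePreserving_fst (μ := Measure.pi fun _ : Fin n => bern θ)
    (ν := stdGaussian (EuclideanSpace ℝ (Fin n)))).ae (ae_pi_bern n θ)
  filter_upwards [hae] with z hz
  have hz : ∀ i, z.1 i = 0 ∨ z.1 i = 1 := hz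
  have h3 := h fun i => z.1 i * z.2 i
  rw [pairing_mul, pairing_mul] at h3
  have h1 := abs_inner_pow_four_le (mask z.1 c) z.2
  have h2 := abs_inner_pow_four_le (mask z.1 d) z.2
  have h4 := norm_mask_le z.1 hz c
  have h5 := norm_mask_le z.1 hz d
  rw [Real.norm_eq_abs]
  calc |F fun i => z.1 i * z.2 i|
      ≤ |C| * (1 + |⟪mask z.1 c, z.2⟫| ^ 4 + |⟪mask z.1 d, z.2⟫| ^ 4) :=
        h3.trans (by gcongr; exact le_abs_self C)
    _ ≤ |C| * ((1 + ‖z.2‖ ^ 4) + ‖mask z.1 c‖ ^ 4 * (1 + ‖z.2‖ ^ 4)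
          + ‖mask z.1 d‖ ^ 4 * (1 + ‖z.2‖ ^ 4)) := by
        gcongr
        nlinarith [pow_nonneg (norm_nonneg z.2) 4]
    _ ≤ |C| * ((1 + ‖z.2‖ ^ 4) + ‖c‖ ^ 4 * (1 + ‖z.2‖ ^ 4)
          + ‖d‖ ^ 4 * (1 + ‖z.2‖ ^ 4)) := by gcongr
    _ = _ := by ring

lemma integrable_bgVec_of_le {F : (Fin n → ℝ) → ℝ} (hF : Continuous F)
    (c d : EuclideanSpace ℝ (Fin n)) {C : ℝ}
    (h : ∀ x, |F x| ≤ C * (1 + |pairing c x| ^ 4 + |pairing d x| ^ 4)) :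
    Integrable F (bgVec θ n) := by
  rw [bgVec_eq_map, integrable_map_measure hF.aestronglyMeasurable (by fun_prop)]
  exact integrable_prod_of_le hF c d h

/-- Bernoulli–Gaussian expectations as iterated expectations over the mask and the Gaussian. -/
lemma integral_bgVec {F : (Fin n → ℝ) → ℝ} (hF : Continuous F)
    (c d : EuclideanSpace ℝ (Fin n)) {C : ℝ}
    (h : ∀ x, |F x| ≤ C * (1 + |pairing c x| ^ 4 + |pairing d x| ^ 4)) :
    ∫ x, F x ∂(bgVec θ n) = ∫ β, ∫ v, F (fun i => β i * v i)
      ∂(stdGaussian (EuclideanSpace ℝ (Fin n))) ∂(Measure.pi fun _ : Fin n => bern θ) := by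
  rw [bgVec_eq_map, integral_map (by fun_prop) hF.aestronglyMeasurable, integral_prod]
  exact integrable_prod_of_le hF c d h

lemma integrable_integral_of_le {F : (Fin n → ℝ) → ℝ} (hF : Continuous F)
    (c d : EuclideanSpace ℝ (Fin n)) {C : ℝ}
    (h : ∀ x, |F x| ≤ C * (1 + |pairing c x| ^ 4 + |pairing d x| ^ 4)) :
    Integrable (fun β : Fin n → ℝ => ∫ v, F (fun i => β i * v i)
      ∂(stdGaussian (EuclideanSpace ℝ (Fin n)))) (Measure.pi fun _ : Fin n => bern θ) :=
  (integrable_prod_of_le hF c d h).integral_prod_left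

lemma integral_sum_mul_bern (h0 : 0 ≤ θ) (h1 : θ ≤ 1) (c : Fin n → ℝ) :
    ∫ β, ∑ i, c i * β i ∂(Measure.pi fun _ : Fin n => bern θ) = θ * ∑ i, c i := by
  rw [integral_finsetSum]
  · simp_rw [integral_const_mul, integral_bern_eval h0 h1]
    rw [← Finset.sum_mul, mul_comm]
  · intro i _
    refine (integrable_pi_bern_of_le (C := 1) (by fun_prop) fun β hβ => ?_).const_mul _
    rcases hβ i with h | h <;> simp [h]

lemma le_one_add_pow_four (r : ℝ) : r ^ 2 ≤ 1 + |r| ^ 4 := by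
  rw [Even.pow_abs (by decide)]
  nlinarith [sq_nonneg (r ^ 2 - 1/2)]

lemma abs_le_one_add_pow_four (r : ℝ) : |r| ≤ 1 + |r| ^ 4 := by
  nlinarith [sq_nonneg (|r| ^ 2 - 1/2), sq_nonneg (|r| - 1/2)]

lemma integral_pairing_sq (h0 : 0 ≤ θ) (h1 : θ ≤ 1) (c : EuclideanSpace ℝ (Fin n)) :
    ∫ x, pairing c x ^ 2 ∂(bgVec θ n) = θ * ‖c‖ ^ 2 := by
  rw [integral_bgVec (C := 1) (by fun_prop) c 0 fun x => ?_]
  · simp_rw [pairing_mul, integral_inner_sq_stdGaussian]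
    rw [EuclideanSpace.real_norm_sq_eq, ← integral_sum_mul_bern h0 h1]
    refine integral_congr_ae ?_
    filter_upwards [ae_pi_bern n θ] with β hβ using norm_mask_sq β hβ c
  · rw [abs_of_nonneg (sq_nonneg _)]
    have := le_one_add_pow_four (pairing c x)
    have h2 : (0 : ℝ) ≤ |pairing 0 x| ^ 4 := by positivity
    linarith

lemma integral_abs_pairing_single_le (h0 : 0 ≤ θ) (h1 : θ ≤ 1) (i : Fin n) :
    ∫ x, |pairing (EuclideanSpace.single i 1) x| ∂(bgVec θ n) ≤ θ := by
  have hb : ∀ x : Fin n → ℝ, |(|pairing (EuclideanSpace.single i 1) x|)| ≤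
      1 * (1 + |pairing (EuclideanSpace.single i 1) x| ^ 4 + |pairing 0 x| ^ 4) := fun x => by
    rw [abs_abs]
    have := abs_le_one_add_pow_four (pairing (EuclideanSpace.single i 1) x)
    have h2 : (0 : ℝ) ≤ |pairing 0 x| ^ 4 := by positivity
    linarith
  rw [integral_bgVec (by fun_prop) _ _ hb]
  refine le_of_le_of_eq ?_ (integral_bern_eval h0 h1 i)
  refine integral_mono_ae (integrable_integral_of_le (by fun_prop) _ _ hb) ?_ ?_
  · refine integrable_pi_bern_of_le (C := 1) (by fun_prop) fun β hβ => ?_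
    rcases hβ i with h | h <;> simp [h]
  · filter_upwards [ae_pi_bern n θ] with β hβ
    simp_rw [pairing_mul]
    rw [integral_comp_inner_stdGaussian _ (f := fun x => |x|) (by fun_prop)]
    simp_rw [abs_mul, abs_norm]
    rw [integral_const_mul]
    have hN : ∫ x, |x| ∂(gaussianReal 0 1) ≤ 1 := by
      calc _ ≤ ∫ x, (1 + x ^ 2) / 2 ∂(gaussianReal 0 1) := by
            refine integral_mono ?_ ?_ fun x => ?_
            · refine integrable_gaussianReal_of_le (C := 1) (by fun_prop) fun x => ?_
              rw [abs_abs, ← Even.pow_abs (by decide : Even 4) x]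
              linarith [abs_le_one_add_pow_four x]
            · refine integrable_gaussianReal_of_le (C := 1) (by fun_prop) fun x => ?_
              rw [abs_of_nonneg (by positivity)]
              nlinarith [sq_nonneg (x ^ 2 - 1/2)]
            · have := sq_abs x
              simp only
              nlinarith [sq_nonneg (|x| - 1)]
        _ = 1 := by
            rw [integral_div, integral_add (integrable_const _), integral_sq_gaussianReal]
            · simp
            · refine integrable_gaussianReal_of_le (C := 1) (by fun_prop) fun x => ?_
              rw [abs_of_nonneg (by positivity)]
              nlinarith [sq_nonneg (x ^ 2 - 1/2)]
    have hm : ‖mask β (EuclideanSpace.single i (1 : ℝ))‖ = β i := by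
      have h2 : ‖mask β (EuclideanSpace.single i (1 : ℝ))‖ ^ 2 = β i := by
        rw [norm_mask_sq β hβ]; simp
      rcases hβ i with h | h
      · rw [h] at h2 ⊢; simpa using h2
      · rw [h] at h2 ⊢; nlinarith [norm_nonneg (mask β (EuclideanSpace.single i (1 : ℝ)))]
    rw [hm]
    have : 0 ≤ β i := by rcases hβ i with h | h <;> simp [h]
    nlinarith

/-- Square-exponential moments of linear forms. -/
lemma lintegral_exp_pairing_sq_le (h0 : 0 ≤ θ) (h1 : θ ≤ 1) {c : EuclideanSpace ℝ (Fin n)}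
    (hc : ‖c‖ ≤ 1) :
    ∫⁻ x, ENNReal.ofReal (Real.exp (pairing c x ^ 2 / 4)) ∂(bgVec θ n) ≤ 2 := by
  have := isProbabilityMeasure_bern h0 h1
  rw [bgVec_eq_map, lintegral_map (by fun_prop) (by fun_prop), lintegral_prod _ (by fun_prop)]
  calc _ ≤ ∫⁻ β, (2 : ℝ≥0∞) ∂(Measure.pi fun _ : Fin n => bern θ) := by
        refine lintegral_mono_ae ?_
        filter_upwards [ae_pi_bern n θ] with β hβ
        simp_rw [pairing_mul]
        have hm : Measurable fun y : ℝ => ENNReal.ofReal (Real.exp (y ^ 2 / 4)) := by fun_prop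
        rw [← lintegral_map (f := fun y : ℝ => ENNReal.ofReal (Real.exp (y ^ 2 / 4)))
          (g := fun v : EuclideanSpace ℝ (Fin n) => ⟪mask β c, v⟫) hm (by fun_prop),
          map_inner_stdGaussian, lintegral_map hm (by fun_prop)]
        refine le_trans (lintegral_mono fun x => ENNReal.ofReal_le_ofReal ?_)
          lintegral_exp_sq_gaussianReal
        refine Real.exp_le_exp.2 ?_
        have h2 := (norm_mask_le β hβ c).trans hc
        rw [mul_pow]
        have : ‖mask β c‖ ^ 2 ≤ 1 := pow_le_one₀ (norm_nonneg _) h2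
        nlinarith [sq_nonneg x]
    _ ≤ 2 := by simp

lemma integrable_exp_pairing_sq (h0 : 0 ≤ θ) (h1 : θ ≤ 1) {c : EuclideanSpace ℝ (Fin n)}
    (hc : ‖c‖ ≤ 1) : Integrable (fun x => Real.exp (pairing c x ^ 2 / 4)) (bgVec θ n) := by
  refine ⟨Continuous.aestronglyMeasurable (by fun_prop), ?_⟩
  rw [hasFiniteIntegral_iff_ofReal (Filter.Eventually.of_forall fun x => (Real.exp_pos _).le)]
  exact (lintegral_exp_pairing_sq_le h0 h1 hc).trans_lt (by simp)

lemma integral_exp_pairing_sq_le (h0 : 0 ≤ θ) (h1 : θ ≤ 1) {c : EuclideanSpace ℝ (Fin n)}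
    (hc : ‖c‖ ≤ 1) : ∫ x, Real.exp (pairing c x ^ 2 / 4) ∂(bgVec θ n) ≤ 2 := by
  rw [integral_eq_lintegral_of_nonneg_ae (Filter.Eventually.of_forall fun x => (Real.exp_pos _).le)
    (Continuous.aestronglyMeasurable (by fun_prop))]
  have := ENNReal.toReal_mono (by simp) (lintegral_exp_pairing_sq_le h0 h1 hc)
  simpa using this

end bgVec

/-! ### Gaussian regression formulas -/

section regression

variable {n : ℕ} {μ : ℝ}

lemma abs_hmuDeriv2_le (hμ : 0 < μ) (z : ℝ) : |hmuDeriv2 μ z| ≤ μ⁻¹ := by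
  rw [abs_of_nonneg (hmuDeriv2_nonneg hμ z)]; exact hmuDeriv2_le hμ z

@[fun_prop]
lemma continuous_hmuDeriv_comp {X : Type*} [TopologicalSpace X] {f : X → ℝ} (hf : Continuous f) :
    Continuous fun x => hmuDeriv μ (f x) := (continuous_hmuDeriv μ).comp hf

@[fun_prop]
lemma continuous_hmuDeriv2_comp {X : Type*} [TopologicalSpace X] {f : X → ℝ} (hf : Continuous f) :
    Continuous fun x => hmuDeriv2 μ (f x) := (continuous_hmuDeriv2 μ).comp hf

lemma hmuDeriv_mul_self_nonneg (hμ : 0 < μ) (z : ℝ) : 0 ≤ hmuDeriv μ z * z := by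
  rcases le_total 0 z with h | h
  · exact mul_nonneg (tanh_nonneg (by positivity)) h
  · have h2 : 0 ≤ Real.tanh (-(z / μ)) := tanh_nonneg (by
      have : z / μ ≤ 0 := div_nonpos_of_nonpos_of_nonneg h hμ.le
      linarith)
    rw [Real.tanh_neg] at h2
    exact mul_nonneg_of_nonpos_of_nonpos (by unfold hmuDeriv; linarith) h

/-- `E[h'(Z) (Z + W)]`-type decomposition: the part orthogonal to `c` does not contribute. -/
lemma integral_hmuDeriv_mul_inner {c : EuclideanSpace ℝ (Fin n)} (hc : c ≠ 0)
    (d : EuclideanSpace ℝ (Fin n)) :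
    ∫ v, hmuDeriv μ ⟪c, v⟫ * ⟪d, v⟫ ∂(stdGaussian (EuclideanSpace ℝ (Fin n))) =
      ⟪c, d⟫ / ‖c‖ ^ 2 * ∫ v, hmuDeriv μ ⟪c, v⟫ * ⟪c, v⟫
        ∂(stdGaussian (EuclideanSpace ℝ (Fin n))) := by
  have hc' : ‖c‖ ^ 2 ≠ 0 := by simpa using hc
  set α := ⟪c, d⟫ / ‖c‖ ^ 2 with hα
  set r := d - α • c with hr
  have hor : ⟪c, r⟫ = 0 := by
    rw [hr, inner_sub_right, real_inner_smul_right, real_inner_self_eq_norm_sq, hα]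
    field_simp; ring
  have hd : ∀ v, ⟪d, v⟫ = α * ⟪c, v⟫ + ⟪r, v⟫ := fun v => by
    rw [hr, inner_sub_left, real_inner_smul_left]; ring
  have hb : ∀ (e v : EuclideanSpace ℝ (Fin n)), |hmuDeriv μ ⟪c, v⟫ * ⟪e, v⟫| ≤
      1 * (1 + |⟪e, v⟫| ^ 4 + |⟪(0 : EuclideanSpace ℝ (Fin n)), v⟫| ^ 4) := fun e v => by
    rw [abs_mul]
    have h1 := abs_hmuDeriv_le μ ⟪c, v⟫
    have h2 := abs_le_one_add_pow_four ⟪e, v⟫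
    have h3 : (0 : ℝ) ≤ |⟪(0 : EuclideanSpace ℝ (Fin n)), v⟫| ^ 4 := by positivity
    nlinarith [abs_nonneg ⟪e, v⟫]
  have hi : ∀ e : EuclideanSpace ℝ (Fin n), Integrable (fun v => hmuDeriv μ ⟪c, v⟫ * ⟪e, v⟫)
      (stdGaussian (EuclideanSpace ℝ (Fin n))) := fun e =>
    integrable_stdGaussian_of_le (by fun_prop) e 0 (hb e)
  have h0 : ∫ v, hmuDeriv μ ⟪c, v⟫ * ⟪r, v⟫ ∂(stdGaussian (EuclideanSpace ℝ (Fin n))) = 0 := by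
    rw [(indepFun_inner_stdGaussian hor).integral_fun_comp_mul_comp (f := hmuDeriv μ)
      (g := fun x => x) (by fun_prop) (by fun_prop) (continuous_hmuDeriv μ).aestronglyMeasurable
      (by fun_prop), integral_comp_inner_stdGaussian r (f := fun x => x) (by fun_prop),
      integral_const_mul, integral_id_gaussianReal]
    simp
  calc _ = ∫ v, (α * (hmuDeriv μ ⟪c, v⟫ * ⟪c, v⟫) + hmuDeriv μ ⟪c, v⟫ * ⟪r, v⟫)
        ∂(stdGaussian (EuclideanSpace ℝ (Fin n))) := by
        congr 1; ext v; rw [hd v]; ring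
    _ = _ := by
        rw [integral_add ((hi c).const_mul α) (hi r), h0, integral_const_mul, add_zero]

lemma integral_hmuDeriv2_inner (hμ : 0 < μ) (c : EuclideanSpace ℝ (Fin n)) :
    ‖c‖ ^ 2 * ∫ v, hmuDeriv2 μ ⟪c, v⟫ ∂(stdGaussian (EuclideanSpace ℝ (Fin n))) =
      ∫ v, hmuDeriv μ ⟪c, v⟫ * ⟪c, v⟫ ∂(stdGaussian (EuclideanSpace ℝ (Fin n))) := by
  rw [integral_comp_inner_stdGaussian c (f := hmuDeriv2 μ) (continuous_hmuDeriv2 μ),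
    integral_comp_inner_stdGaussian c (f := fun z => hmuDeriv μ z * z) (by fun_prop)]
  have hd : ∀ x, HasDerivAt (fun x => hmuDeriv μ (‖c‖ * x)) (hmuDeriv2 μ (‖c‖ * x) * ‖c‖) x := by
    intro x
    have h1 : HasDerivAt (fun x => ‖c‖ * x) ‖c‖ x := by
      simpa using (hasDerivAt_id' x).const_mul ‖c‖
    exact (hasDerivAt_hmuDeriv μ (‖c‖ * x)).comp x h1
  have := gaussian_integration_by_parts hd
    (integrable_gaussianReal_of_le (C := 1) (by fun_prop) fun x => by
      have := abs_hmuDeriv_le μ (‖c‖ * x)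
      have : 0 ≤ x ^ 4 := by positivity
      linarith)
    (integrable_gaussianReal_of_le (C := μ⁻¹ * ‖c‖) (by fun_prop) fun x => by
      rw [abs_mul, abs_norm]
      have h1 := abs_hmuDeriv2_le hμ (‖c‖ * x)
      have h2 : 0 ≤ x ^ 4 := by positivity
      have h3 : 0 ≤ μ⁻¹ * ‖c‖ := by positivity
      calc |hmuDeriv2 μ (‖c‖ * x)| * ‖c‖ ≤ μ⁻¹ * ‖c‖ := by gcongr
        _ ≤ _ := by nlinarith)
    (integrable_gaussianReal_of_le (C := 1) (by fun_prop) fun x => by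
      rw [abs_mul]
      have h1 := abs_hmuDeriv_le μ (‖c‖ * x)
      have h2 := abs_le_one_add_pow_four x
      rw [Even.pow_abs (by decide)] at h2
      nlinarith [abs_nonneg x])
  rw [integral_mul_const] at this
  calc _ = ‖c‖ * ((∫ x, hmuDeriv2 μ (‖c‖ * x) ∂(gaussianReal 0 1)) * ‖c‖) := by ring
    _ = _ := by
      rw [← this, ← integral_const_mul]
      congr 1; ext x; ring

lemma integral_hmuDeriv2_mul_inner_sq (hμ : 0 < μ) {c : EuclideanSpace ℝ (Fin n)} (hc : c ≠ 0)
    (d : EuclideanSpace ℝ (Fin n)) :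
    ∫ v, hmuDeriv2 μ ⟪c, v⟫ * ⟪d, v⟫ ^ 2 ∂(stdGaussian (EuclideanSpace ℝ (Fin n))) =
      (⟪c, d⟫ / ‖c‖ ^ 2) ^ 2 * (∫ v, hmuDeriv2 μ ⟪c, v⟫ * ⟪c, v⟫ ^ 2
        ∂(stdGaussian (EuclideanSpace ℝ (Fin n)))) +
      (‖d‖ ^ 2 - (⟪c, d⟫ / ‖c‖ ^ 2) ^ 2 * ‖c‖ ^ 2) / ‖c‖ ^ 2 *
        ∫ v, hmuDeriv μ ⟪c, v⟫ * ⟪c, v⟫ ∂(stdGaussian (EuclideanSpace ℝ (Fin n))) := by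
  have hc' : ‖c‖ ^ 2 ≠ 0 := by simpa using hc
  set α := ⟪c, d⟫ / ‖c‖ ^ 2 with hα
  have hcd : ⟪c, d⟫ = α * ‖c‖ ^ 2 := by rw [hα]; field_simp
  set r := d - α • c with hr
  have hor : ⟪c, r⟫ = 0 := by
    rw [hr, inner_sub_right, real_inner_smul_right, real_inner_self_eq_norm_sq, hcd]
    ring
  have hrn : ‖r‖ ^ 2 = ‖d‖ ^ 2 - α ^ 2 * ‖c‖ ^ 2 := by
    rw [hr, norm_sub_sq_real, real_inner_smul_right, real_inner_comm, hcd, norm_smul,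
      mul_pow, Real.norm_eq_abs, sq_abs]
    ring
  have hd : ∀ v, ⟪d, v⟫ = α * ⟪c, v⟫ + ⟪r, v⟫ := fun v => by
    rw [hr, inner_sub_left, real_inner_smul_left]; ring
  have hb : ∀ v : EuclideanSpace ℝ (Fin n), ∀ y : ℝ, |y| ≤ |⟪c, v⟫| ^ 2 + |⟪r, v⟫| ^ 2 →
      |hmuDeriv2 μ ⟪c, v⟫ * y| ≤ (2 * μ⁻¹) * (1 + |⟪c, v⟫| ^ 4 + |⟪r, v⟫| ^ 4) := by
    intro v y hy
    have h1 := abs_hmuDeriv2_le hμ ⟪c, v⟫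
    have h2 : |y| ≤ 2 * (1 + |⟪c, v⟫| ^ 4 + |⟪r, v⟫| ^ 4) := by
      have := le_one_add_pow_four ⟪c, v⟫
      have := le_one_add_pow_four ⟪r, v⟫
      have : 0 ≤ |⟪c, v⟫| ^ 4 := by positivity
      have : 0 ≤ |⟪r, v⟫| ^ 4 := by positivity
      rw [sq_abs, sq_abs] at hy
      linarith
    have h3 : 0 < μ⁻¹ := by positivity
    rw [abs_mul]
    calc |hmuDeriv2 μ ⟪c, v⟫| * |y| ≤ μ⁻¹ * (2 * (1 + |⟪c, v⟫| ^ 4 + |⟪r, v⟫| ^ 4)) := by gcongr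
      _ = _ := by ring
  have hicc : Integrable (fun v => hmuDeriv2 μ ⟪c, v⟫ * ⟪c, v⟫ ^ 2)
      (stdGaussian (EuclideanSpace ℝ (Fin n))) :=
    integrable_stdGaussian_of_le (by fun_prop) c r fun v => hb v _ (by
      rw [abs_pow]; nlinarith [sq_nonneg |⟪r, v⟫|])
  have hirr : Integrable (fun v => hmuDeriv2 μ ⟪c, v⟫ * ⟪r, v⟫ ^ 2)
      (stdGaussian (EuclideanSpace ℝ (Fin n))) :=
    integrable_stdGaussian_of_le (by fun_prop) c r fun v => hb v _ (by
      rw [abs_pow]; nlinarith [sq_nonneg |⟪c, v⟫|])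
  have hicr : Integrable (fun v => hmuDeriv2 μ ⟪c, v⟫ * (⟪c, v⟫ * ⟪r, v⟫))
      (stdGaussian (EuclideanSpace ℝ (Fin n))) :=
    integrable_stdGaussian_of_le (by fun_prop) c r fun v => hb v _ (by
      rw [abs_mul]
      nlinarith [sq_nonneg (|⟪c, v⟫| - |⟪r, v⟫|), sq_nonneg |⟪c, v⟫|, sq_nonneg |⟪r, v⟫|])
  have hI := indepFun_inner_stdGaussian hor
  have h0 : ∫ v, hmuDeriv2 μ ⟪c, v⟫ * (⟪c, v⟫ * ⟪r, v⟫)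
      ∂(stdGaussian (EuclideanSpace ℝ (Fin n))) = 0 := by
    simp_rw [← mul_assoc]
    rw [hI.integral_fun_comp_mul_comp (f := fun z => hmuDeriv2 μ z * z)
      (g := fun x => x) (by fun_prop) (by fun_prop) (Continuous.aestronglyMeasurable (by fun_prop))
      (by fun_prop), integral_comp_inner_stdGaussian r (f := fun x => x) (by fun_prop),
      integral_const_mul, integral_id_gaussianReal]
    simp
  have h1 : ∫ v, hmuDeriv2 μ ⟪c, v⟫ * ⟪r, v⟫ ^ 2
      ∂(stdGaussian (EuclideanSpace ℝ (Fin n))) =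
      (∫ v, hmuDeriv2 μ ⟪c, v⟫ ∂(stdGaussian (EuclideanSpace ℝ (Fin n)))) * ‖r‖ ^ 2 := by
    rw [hI.integral_fun_comp_mul_comp (f := hmuDeriv2 μ)
      (g := fun x => x ^ 2) (by fun_prop) (by fun_prop)
      (Continuous.aestronglyMeasurable (by fun_prop)) (by fun_prop), integral_inner_sq_stdGaussian]
  have hsum : Integrable (fun v => α ^ 2 * (hmuDeriv2 μ ⟪c, v⟫ * ⟪c, v⟫ ^ 2) +
      (2 * α) * (hmuDeriv2 μ ⟪c, v⟫ * (⟪c, v⟫ * ⟪r, v⟫)))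
      (stdGaussian (EuclideanSpace ℝ (Fin n))) := (hicc.const_mul _).add (hicr.const_mul _)
  calc _ = ∫ v, (α ^ 2 * (hmuDeriv2 μ ⟪c, v⟫ * ⟪c, v⟫ ^ 2) +
          (2 * α) * (hmuDeriv2 μ ⟪c, v⟫ * (⟪c, v⟫ * ⟪r, v⟫)) + hmuDeriv2 μ ⟪c, v⟫ * ⟪r, v⟫ ^ 2)
        ∂(stdGaussian (EuclideanSpace ℝ (Fin n))) := by
        congr 1; ext v; rw [hd v]; ring
    _ = _ := by
        rw [integral_add hsum hirr,
          integral_add (hicc.const_mul _) (hicr.const_mul _), h1, integral_const_mul,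
          integral_const_mul, h0, ← integral_hmuDeriv2_inner hμ c, hrn]
        field_simp
        ring

lemma integral_hmuDeriv2_mul_self_sq_le (hμ : 0 < μ) (c : EuclideanSpace ℝ (Fin n)) :
    ∫ v, hmuDeriv2 μ ⟪c, v⟫ * ⟪c, v⟫ ^ 2 ∂(stdGaussian (EuclideanSpace ℝ (Fin n))) ≤ μ := by
  calc _ ≤ ∫ _, μ ∂(stdGaussian (EuclideanSpace ℝ (Fin n))) := by
        refine integral_mono_of_nonneg (Filter.Eventually.of_forall fun v => ?_)
          (integrable_const _) (Filter.Eventually.of_forall fun v => hmuDeriv2_mul_sq_le hμ _)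
        exact mul_nonneg (hmuDeriv2_nonneg hμ _) (sq_nonneg _)
    _ = μ := by simp

lemma abs_lower_bound (y : ℝ) : 6 / 7 * y ^ 2 - 32 / 343 * y ^ 4 ≤ |y| := by
  have h : 0 ≤ 32 / 343 * |y| * ((|y| - 7 / 4) ^ 2 * (|y| + 7 / 2)) := by positivity
  rw [← sq_abs y, ← Even.pow_abs (by decide : Even 4) y]
  nlinarith

lemma integrable_pow_le_four {k : ℕ} (hk : k ≤ 4) :
    Integrable (fun x : ℝ => x ^ k) (gaussianReal 0 1) := by
  refine integrable_gaussianReal_of_le (C := 1) (by fun_prop) fun x => ?_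
  rw [abs_pow, ← Even.pow_abs (by decide : Even 4) x]
  rcases le_total |x| 1 with h | h
  · have h1 : |x| ^ k ≤ 1 := pow_le_one₀ (abs_nonneg x) h
    have h2 : 0 ≤ |x| ^ 4 := by positivity
    linarith
  · have := pow_le_pow_right₀ h hk
    linarith

lemma integral_hmuDeriv_mul_self_ge (hμ : 0 < μ) (c : EuclideanSpace ℝ (Fin n)) :
    198 / 343 * ‖c‖ - μ ≤
      ∫ v, hmuDeriv μ ⟪c, v⟫ * ⟪c, v⟫ ∂(stdGaussian (EuclideanSpace ℝ (Fin n))) := by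
  rw [integral_comp_inner_stdGaussian c (f := fun z => hmuDeriv μ z * z) (by fun_prop)]
  have h2 := integrable_pow_le_four (k := 2) (by norm_num)
  have h4 := integrable_pow_le_four (k := 4) le_rfl
  have hsub : Integrable (fun x : ℝ => ‖c‖ * (6 / 7 * x ^ 2 - 32 / 343 * x ^ 4))
      (gaussianReal 0 1) := ((h2.const_mul _).sub (h4.const_mul _)).const_mul _
  calc _ = ∫ x, (‖c‖ * (6 / 7 * x ^ 2 - 32 / 343 * x ^ 4) - μ) ∂(gaussianReal 0 1) := by
        rw [integral_sub hsub (integrable_const _),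
          integral_const_mul, integral_sub (h2.const_mul _) (h4.const_mul _), integral_const_mul,
          integral_const_mul, integral_sq_gaussianReal, integral_pow_four_gaussianReal]
        simp; ring
    _ ≤ _ := by
        refine integral_mono (hsub.sub (integrable_const _)) ?_ fun x => ?_
        · refine integrable_gaussianReal_of_le (C := ‖c‖) (by fun_prop) fun x => ?_
          rw [abs_mul, abs_mul, abs_norm]
          have h1 := abs_hmuDeriv_le μ (‖c‖ * x)
          have h3 := abs_le_one_add_pow_four x
          rw [Even.pow_abs (by decide)] at h3
          calc |hmuDeriv μ (‖c‖ * x)| * (‖c‖ * |x|) ≤ 1 * (‖c‖ * (1 + x ^ 4)) := by gcongr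
            _ = _ := by ring
        · have h1 := abs_sub_le_hmuDeriv_mul hμ (‖c‖ * x)
          rw [abs_mul, abs_norm] at h1
          have h3 := abs_lower_bound x
          simp only
          nlinarith [norm_nonneg c]

end regression

section curvature

variable {n : ℕ} {θ μ : ℝ}

/-- The second-order form `h₂(qᵀx) (aᵀx)² + h₁(qᵀx) (bᵀx)`, with `h₁`, `h₂` the derivatives
of `h_μ`, produced by differentiating `h_μ(q(s)ᵀx)` twice along a curve with velocity
`a` and acceleration `b`. -/
def curv (μ : ℝ) (q a b : EuclideanSpace ℝ (Fin n)) (x : Fin n → ℝ) : ℝ :=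
  hmuDeriv2 μ (pairing q x) * pairing a x ^ 2 + hmuDeriv μ (pairing q x) * pairing b x

@[fun_prop]
lemma continuous_curv (q a b : EuclideanSpace ℝ (Fin n)) : Continuous (curv μ q a b) := by
  unfold curv; fun_prop

lemma abs_curv_le (hμ : 0 < μ) (q a b : EuclideanSpace ℝ (Fin n)) (x : Fin n → ℝ) :
    |curv μ q a b x| ≤ μ⁻¹ * pairing a x ^ 2 + |pairing b x| := by
  unfold curv
  refine (abs_add_le _ _).trans ?_
  rw [abs_mul, abs_mul, abs_pow, sq_abs]
  have h1 := abs_hmuDeriv2_le hμ (pairing q x)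
  have h2 := abs_hmuDeriv_le μ (pairing q x)
  gcongr
  exact mul_le_of_le_one_left (abs_nonneg _) h2

lemma abs_curv_le_pow_four (hμ : 0 < μ) (q a b : EuclideanSpace ℝ (Fin n)) (x : Fin n → ℝ) :
    |curv μ q a b x| ≤ (μ⁻¹ + 1) * (1 + |pairing a x| ^ 4 + |pairing b x| ^ 4) := by
  refine (abs_curv_le hμ q a b x).trans ?_
  have h1 := le_one_add_pow_four (pairing a x)
  have h2 := abs_le_one_add_pow_four (pairing b x)
  have h3 : 0 < μ⁻¹ := by positivity
  have h4 : 0 ≤ |pairing a x| ^ 4 := by positivity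
  have h5 : 0 ≤ |pairing b x| ^ 4 := by positivity
  nlinarith [mul_le_mul_of_nonneg_left h1 h3.le, mul_nonneg h3.le h5]

lemma integrable_curv (hμ : 0 < μ) (q a b : EuclideanSpace ℝ (Fin n)) :
    Integrable (curv μ q a b) (bgVec θ n) :=
  integrable_bgVec_of_le (by fun_prop) a b (abs_curv_le_pow_four hμ q a b)

lemma curv_mask (q a b v : EuclideanSpace ℝ (Fin n)) (β : Fin n → ℝ) :
    curv μ q a b (fun i => β i * v i) =
      hmuDeriv2 μ ⟪mask β q, v⟫ * ⟪mask β a, v⟫ ^ 2 + hmuDeriv μ ⟪mask β q, v⟫ * ⟪mask β b, v⟫ := by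
  simp only [curv, pairing_mul]

lemma mask_add (β : Fin n → ℝ) (c d : EuclideanSpace ℝ (Fin n)) :
    mask β (c + d) = mask β c + mask β d := by
  ext i; simp [mask, mul_add]

lemma mask_smul (β : Fin n → ℝ) (r : ℝ) (c : EuclideanSpace ℝ (Fin n)) :
    mask β (r • c) = r • mask β c := by
  ext i; simp [mask, mul_left_comm]

lemma mask_single (β : Fin n → ℝ) (j : Fin n) :
    mask β (EuclideanSpace.single j 1) = β j • EuclideanSpace.single j 1 := by
  ext i
  by_cases h : i = j
  · subst h; simp [mask]
  · simp [mask, h]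

lemma mask_zero (β : Fin n → ℝ) : mask β (0 : EuclideanSpace ℝ (Fin n)) = 0 := by
  ext i; simp [mask]

lemma integral_bern_mul_sum (h0 : 0 ≤ θ) (h1 : θ ≤ 1) {j : Fin n}
    {u : EuclideanSpace ℝ (Fin n)} (hu : u j = 0) :
    ∫ β, β j * ∑ i, u i ^ 2 * β i ∂(Measure.pi fun _ : Fin n => bern θ) = θ ^ 2 * ‖u‖ ^ 2 := by
  simp_rw [Finset.mul_sum]
  rw [integral_finsetSum, EuclideanSpace.real_norm_sq_eq, Finset.mul_sum]
  · refine Finset.sum_congr rfl fun i _ => ?_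
    by_cases h : j = i
    · subst h; simp [hu]
    · have : ∀ β : Fin n → ℝ, β j * (u i ^ 2 * β i) = u i ^ 2 * (β j * β i) := fun β => by ring
      simp_rw [this]
      rw [integral_const_mul, integral_bern_eval_mul_eval h0 h1 h]; ring
  · intro i _
    refine integrable_pi_bern_of_le (C := u i ^ 2) (by fun_prop) fun β hβ => ?_
    rcases hβ i with h | h <;> rcases hβ j with h' | h' <;> simp [h, h', sq_nonneg]

lemma le_integral_bgVec (h0 : 0 ≤ θ) (h1 : θ ≤ 1) {F : (Fin n → ℝ) → ℝ} (hF : Continuous F)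
    (c d : EuclideanSpace ℝ (Fin n)) {C : ℝ}
    (h : ∀ x, |F x| ≤ C * (1 + |pairing c x| ^ 4 + |pairing d x| ^ 4)) {j : Fin n}
    {u : EuclideanSpace ℝ (Fin n)} (hu : u j = 0) (k₀ k₁ k₂ k₃ : ℝ)
    (hle : ∀ β : Fin n → ℝ, (∀ i, β i = 0 ∨ β i = 1) →
      k₀ + k₁ * β j + k₂ * ∑ i, u i ^ 2 * β i + k₃ * (β j * ∑ i, u i ^ 2 * β i) ≤
        ∫ v, F (fun i => β i * v i) ∂(stdGaussian (EuclideanSpace ℝ (Fin n)))) :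
    k₀ + k₁ * θ + k₂ * (θ * ‖u‖ ^ 2) + k₃ * (θ ^ 2 * ‖u‖ ^ 2) ≤ ∫ x, F x ∂(bgVec θ n) := by
  have := isProbabilityMeasure_bern h0 h1
  rw [integral_bgVec hF c d h]
  have hS : ∀ β : Fin n → ℝ, (∀ i, β i = 0 ∨ β i = 1) → |∑ i, u i ^ 2 * β i| ≤ ‖u‖ ^ 2 := by
    intro β hβ
    rw [← norm_mask_sq β hβ, abs_of_nonneg (sq_nonneg _)]
    have := norm_mask_le β hβ u
    gcongr
  have i1 : Integrable (fun β : Fin n → ℝ => k₁ * β j) (Measure.pi fun _ : Fin n => bern θ) :=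
    (integrable_pi_bern_of_le (C := 1) (by fun_prop) fun β hβ => by
      rcases hβ j with h | h <;> simp [h]).const_mul _
  have i2 : Integrable (fun β : Fin n → ℝ => k₂ * ∑ i, u i ^ 2 * β i)
      (Measure.pi fun _ : Fin n => bern θ) :=
    (integrable_pi_bern_of_le (C := ‖u‖ ^ 2) (by fun_prop) hS).const_mul _
  have i3 : Integrable (fun β : Fin n → ℝ => k₃ * (β j * ∑ i, u i ^ 2 * β i))
      (Measure.pi fun _ : Fin n => bern θ) :=
    (integrable_pi_bern_of_le (C := ‖u‖ ^ 2) (by fun_prop) fun β hβ => by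
      rcases hβ j with h | h
      · simp [h]
      · simpa [h] using hS β hβ).const_mul _
  have i01 : Integrable (fun β : Fin n → ℝ => k₀ + k₁ * β j)
      (Measure.pi fun _ : Fin n => bern θ) := (integrable_const _).add i1
  have i012 : Integrable (fun β : Fin n → ℝ => k₀ + k₁ * β j + k₂ * ∑ i, u i ^ 2 * β i)
      (Measure.pi fun _ : Fin n => bern θ) := i01.add i2
  calc _ = ∫ β, (k₀ + k₁ * β j + k₂ * ∑ i, u i ^ 2 * β i + k₃ * (β j * ∑ i, u i ^ 2 * β i))
        ∂(Measure.pi fun _ : Fin n => bern θ) := by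
        rw [integral_add i012 i3, integral_add i01 i2, integral_add (integrable_const _) i1,
          integral_const_mul, integral_const_mul, integral_const_mul, integral_bern_eval h0 h1,
          integral_sum_mul_bern h0 h1, integral_bern_mul_sum h0 h1 hu,
          EuclideanSpace.real_norm_sq_eq]
        simp
    _ ≤ _ := by
        refine integral_mono_ae (i012.add i3) (integrable_integral_of_le hF c d h) ?_
        filter_upwards [ae_pi_bern n θ] with β hβ using hle β hβ

/-- Adding a multiple of a coordinate vector to the acceleration costs at most `|γ| θ`. -/
lemma integral_curv_add_single_ge (h0 : 0 ≤ θ) (h1 : θ ≤ 1) (hμ : 0 < μ)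
    (q a b : EuclideanSpace ℝ (Fin n)) (j : Fin n) (γ : ℝ) :
    ∫ x, curv μ q a b x ∂(bgVec θ n) - |γ| * θ ≤
      ∫ x, curv μ q a (b + γ • EuclideanSpace.single j 1) x ∂(bgVec θ n) := by
  have hi : Integrable (fun x => |pairing (EuclideanSpace.single j 1) x|) (bgVec θ n) :=
    integrable_bgVec_of_le (C := 1) (by fun_prop) (EuclideanSpace.single j 1) 0 fun x => by
      have := abs_le_one_add_pow_four (pairing (EuclideanSpace.single j 1) x)
      simpa [pairing_zero_left] using this
  calc _ ≤ ∫ x, curv μ q a b x ∂(bgVec θ n) -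
        |γ| * ∫ x, |pairing (EuclideanSpace.single j 1) x| ∂(bgVec θ n) := by
        have := integral_abs_pairing_single_le h0 h1 j
        gcongr
    _ = ∫ x, (curv μ q a b x - |γ| * |pairing (EuclideanSpace.single j 1) x|) ∂(bgVec θ n) := by
        rw [integral_sub (integrable_curv hμ q a b) (hi.const_mul _), integral_const_mul]
    _ ≤ _ := by
        refine integral_mono ((integrable_curv hμ q a b).sub (hi.const_mul _))
          (integrable_curv hμ q a _) fun x => ?_
        simp only [curv, pairing_add_left, pairing_smul_left]
        have h2 := abs_hmuDeriv_le μ (pairing q x)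
        have h3 : |hmuDeriv μ (pairing q x) * (γ * pairing (EuclideanSpace.single j 1) x)| ≤
            |γ| * |pairing (EuclideanSpace.single j 1) x| := by
          rw [abs_mul, abs_mul]
          exact mul_le_of_le_one_left (by positivity) h2
        have := neg_abs_le (hmuDeriv μ (pairing q x) *
          (γ * pairing (EuclideanSpace.single j 1) x))
        linarith

end curvature

section expectation

variable {n : ℕ} {θ μ : ℝ}

lemma integrable_inner_sq_stdGaussian (d : EuclideanSpace ℝ (Fin n)) :
    Integrable (fun v => ⟪d, v⟫ ^ 2) (stdGaussian (EuclideanSpace ℝ (Fin n))) :=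
  integrable_stdGaussian_of_le (C := 1) (by fun_prop) d d fun v => by
    have := le_one_add_pow_four ⟪d, v⟫
    rw [abs_of_nonneg (sq_nonneg _)]
    have h : 0 ≤ |⟪d, v⟫| ^ 4 := by positivity
    linarith

lemma integrable_inner_pow_four_stdGaussian (d : EuclideanSpace ℝ (Fin n)) :
    Integrable (fun v => ⟪d, v⟫ ^ 4) (stdGaussian (EuclideanSpace ℝ (Fin n))) :=
  integrable_stdGaussian_of_le (C := 1) (by fun_prop) d d fun v => by
    rw [abs_pow]
    have h : 0 ≤ |⟪d, v⟫| ^ 4 := by positivity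
    linarith

lemma integrable_hmuDeriv2_mul_inner_sq (hμ : 0 < μ) (c d : EuclideanSpace ℝ (Fin n)) :
    Integrable (fun v => hmuDeriv2 μ ⟪c, v⟫ * ⟪d, v⟫ ^ 2)
      (stdGaussian (EuclideanSpace ℝ (Fin n))) :=
  integrable_stdGaussian_of_le (C := μ⁻¹) (by fun_prop) d d fun v => by
    have h1 := abs_hmuDeriv2_le hμ ⟪c, v⟫
    have h2 := le_one_add_pow_four ⟪d, v⟫
    have h : 0 ≤ |⟪d, v⟫| ^ 4 := by positivity
    rw [abs_mul, abs_of_nonneg (sq_nonneg ⟪d, v⟫)]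
    gcongr
    linarith

lemma integrable_hmuDeriv_mul_inner (c d : EuclideanSpace ℝ (Fin n)) :
    Integrable (fun v => hmuDeriv μ ⟪c, v⟫ * ⟪d, v⟫)
      (stdGaussian (EuclideanSpace ℝ (Fin n))) :=
  integrable_stdGaussian_of_le (C := 1) (by fun_prop) d d fun v => by
    have h1 := abs_hmuDeriv_le μ ⟪c, v⟫
    have h2 := abs_le_one_add_pow_four ⟪d, v⟫
    have h : 0 ≤ |⟪d, v⟫| ^ 4 := by positivity
    rw [abs_mul]
    gcongr
    linarith

lemma integral_curv_mask (hμ : 0 < μ) (q a b : EuclideanSpace ℝ (Fin n)) (β : Fin n → ℝ) :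
    ∫ v, curv μ q a b (fun i => β i * v i) ∂(stdGaussian (EuclideanSpace ℝ (Fin n))) =
      ∫ v, hmuDeriv2 μ ⟪mask β q, v⟫ * ⟪mask β a, v⟫ ^ 2
        ∂(stdGaussian (EuclideanSpace ℝ (Fin n))) +
      ∫ v, hmuDeriv μ ⟪mask β q, v⟫ * ⟪mask β b, v⟫
        ∂(stdGaussian (EuclideanSpace ℝ (Fin n))) := by
  simp_rw [curv_mask]
  exact integral_add (integrable_hmuDeriv2_mul_inner_sq hμ _ _)
    (integrable_hmuDeriv_mul_inner _ _)

lemma integral_hmuDeriv2_mul_inner_sq_ge (hμ : 0 < μ) {c d : EuclideanSpace ℝ (Fin n)}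
    (hc : ‖c‖ ^ 2 ≤ μ ^ 2 / 32) :
    29 / 32 * μ⁻¹ * ‖d‖ ^ 2 ≤ ∫ v, hmuDeriv2 μ ⟪c, v⟫ * ⟪d, v⟫ ^ 2
      ∂(stdGaussian (EuclideanSpace ℝ (Fin n))) := by
  rcases eq_or_ne d 0 with rfl | hd
  · simp
  have hd' : 0 < ‖d‖ ^ 2 := by positivity
  have i1 := (integrable_inner_sq_stdGaussian d).const_mul μ⁻¹
  have i2 := (integrable_inner_pow_four_stdGaussian c).const_mul (μ⁻¹ * (16 * ‖d‖ ^ 2 / μ ^ 4))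
  have i3 := (integrable_inner_pow_four_stdGaussian d).const_mul (μ⁻¹ * (1 / (64 * ‖d‖ ^ 2)))
  have i12 : Integrable (fun v => μ⁻¹ * ⟪d, v⟫ ^ 2 -
    (μ⁻¹ * (16 * ‖d‖ ^ 2 / μ ^ 4)) * ⟪c, v⟫ ^ 4) (stdGaussian (EuclideanSpace ℝ (Fin n))) :=
    i1.sub i2
  calc _ ≤ ∫ v, (μ⁻¹ * ⟪d, v⟫ ^ 2 - (μ⁻¹ * (16 * ‖d‖ ^ 2 / μ ^ 4)) * ⟪c, v⟫ ^ 4 -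
        (μ⁻¹ * (1 / (64 * ‖d‖ ^ 2))) * ⟪d, v⟫ ^ 4)
        ∂(stdGaussian (EuclideanSpace ℝ (Fin n))) := by
        rw [integral_sub i12 i3, integral_sub i1 i2, integral_const_mul, integral_const_mul,
          integral_const_mul, integral_inner_sq_stdGaussian, integral_inner_pow_four_stdGaussian,
          integral_inner_pow_four_stdGaussian]
        have h1 : ‖c‖ ^ 4 ≤ (μ ^ 2 / 32) ^ 2 := by
          calc ‖c‖ ^ 4 = (‖c‖ ^ 2) ^ 2 := by ring
            _ ≤ _ := by gcongr
        have h2 : 16 * ‖d‖ ^ 2 / μ ^ 4 * (3 * ‖c‖ ^ 4) ≤ 3 / 64 * ‖d‖ ^ 2 := by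
          calc _ ≤ 16 * ‖d‖ ^ 2 / μ ^ 4 * (3 * (μ ^ 2 / 32) ^ 2) := by gcongr
            _ = _ := by field_simp; ring
        have h3 : 1 / (64 * ‖d‖ ^ 2) * (3 * ‖d‖ ^ 4) = 3 / 64 * ‖d‖ ^ 2 := by
          field_simp
        have h4 : 0 < μ⁻¹ := by positivity
        calc 29 / 32 * μ⁻¹ * ‖d‖ ^ 2 = μ⁻¹ * (‖d‖ ^ 2 - 3 / 64 * ‖d‖ ^ 2 - 3 / 64 * ‖d‖ ^ 2) := by
              ring
          _ ≤ μ⁻¹ * (‖d‖ ^ 2 - 16 * ‖d‖ ^ 2 / μ ^ 4 * (3 * ‖c‖ ^ 4) -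
              1 / (64 * ‖d‖ ^ 2) * (3 * ‖d‖ ^ 4)) := by
              rw [h3]; gcongr
          _ = _ := by ring
    _ ≤ _ := by
        refine integral_mono (i12.sub i3) (integrable_hmuDeriv2_mul_inner_sq hμ c d) fun v => ?_
        simp only
        set x := ⟪c, v⟫
        set y := ⟪d, v⟫
        have h1 := le_hmuDeriv2 hμ x
        have h2 : x ^ 2 * y ^ 2 / μ ^ 2 ≤
            16 * ‖d‖ ^ 2 / μ ^ 4 * x ^ 4 + 1 / (64 * ‖d‖ ^ 2) * y ^ 4 := by
          have : 16 * ‖d‖ ^ 2 / μ ^ 4 * x ^ 4 + 1 / (64 * ‖d‖ ^ 2) * y ^ 4 - x ^ 2 * y ^ 2 / μ ^ 2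
              = (4 * ‖d‖ / μ ^ 2 * x ^ 2 - y ^ 2 / (8 * ‖d‖)) ^ 2 := by
            have : ‖d‖ ≠ 0 := by simpa using hd
            field_simp; ring
          nlinarith [sq_nonneg (4 * ‖d‖ / μ ^ 2 * x ^ 2 - y ^ 2 / (8 * ‖d‖))]
        have h4 : 0 < μ⁻¹ := by positivity
        calc _ = μ⁻¹ * (y ^ 2 - (16 * ‖d‖ ^ 2 / μ ^ 4 * x ^ 4 + 1 / (64 * ‖d‖ ^ 2) * y ^ 4)) := by
              ring
          _ ≤ μ⁻¹ * (y ^ 2 - x ^ 2 * y ^ 2 / μ ^ 2) := by gcongr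
          _ = μ⁻¹ * (1 - (x / μ) ^ 2) * y ^ 2 := by ring
          _ ≤ _ := by gcongr

lemma integral_hmuDeriv_mul_inner_ge (hμ : 0 < μ) {t : ℝ} (ht : μ / 8 ≤ t)
    {d : EuclideanSpace ℝ (Fin n)} (hd : ‖d‖ ≤ 1) :
    63 / 512 * ‖d‖ ^ 2 ≤ ∫ v, hmuDeriv μ ⟪t • d, v⟫ * ⟪d, v⟫
      ∂(stdGaussian (EuclideanSpace ℝ (Fin n))) := by
  have i1 := (integrable_inner_sq_stdGaussian d).const_mul (1 / 8)
  have i2 := (integrable_inner_pow_four_stdGaussian d).const_mul (1 / 1536)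
  calc _ ≤ ∫ v, (1 / 8 * ⟪d, v⟫ ^ 2 - 1 / 1536 * ⟪d, v⟫ ^ 4)
        ∂(stdGaussian (EuclideanSpace ℝ (Fin n))) := by
        rw [integral_sub i1 i2, integral_const_mul, integral_const_mul,
          integral_inner_sq_stdGaussian, integral_inner_pow_four_stdGaussian]
        have : ‖d‖ ^ 2 ≤ 1 := pow_le_one₀ (norm_nonneg _) hd
        nlinarith [sq_nonneg ‖d‖]
    _ ≤ _ := by
        refine integral_mono (i1.sub i2) (integrable_hmuDeriv_mul_inner _ d) fun v => ?_
        simp only [real_inner_smul_left]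
        set y := ⟪d, v⟫
        have h1 := sq_sub_le_tanh_mul (y / 8)
        have h8 : 1 / 8 ≤ t / μ := by
          rw [le_div_iff₀ hμ]; linarith
        have h2 : Real.tanh (y / 8) * y ≤ hmuDeriv μ (t * y) * y := by
          unfold hmuDeriv
          rcases le_total 0 y with hy | hy
          · refine mul_le_mul_of_nonneg_right (monotone_tanh ?_) hy
            rw [mul_div_right_comm]; nlinarith
          · refine mul_le_mul_of_nonpos_right (monotone_tanh ?_) hy
            rw [mul_div_right_comm]; nlinarith
        nlinarith

/-- Strong convexity of the expected objective near the origin. -/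
lemma integral_curv_ge_of_small (h0 : 0 ≤ θ) (h1 : θ ≤ 1) (hμ : 0 < μ) {j : Fin n}
    {w v : EuclideanSpace ℝ (Fin n)} (hv : v j = 0) (hw : ‖w‖ ≤ μ / (4 * √2))
    (s α γ : ℝ) :
    29 / 32 * μ⁻¹ * (θ * (1 - θ) * ‖v‖ ^ 2) - |γ| * θ ≤
      ∫ x, curv μ (w + s • EuclideanSpace.single j 1) (v + α • EuclideanSpace.single j 1)
        (γ • EuclideanSpace.single j 1) x ∂(bgVec θ n) := by
  have key := integral_curv_add_single_ge h0 h1 hμ (w + s • EuclideanSpace.single j 1)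
    (v + α • EuclideanSpace.single j 1) 0 j γ
  rw [zero_add] at key
  refine le_trans ?_ key
  gcongr
  have := le_integral_bgVec h0 h1 (continuous_curv (μ := μ) (w + s • EuclideanSpace.single j 1)
    (v + α • EuclideanSpace.single j 1) 0) _ _ (abs_curv_le_pow_four hμ _ _ _) hv 0 0
    (29 / 32 * μ⁻¹) (-(29 / 32 * μ⁻¹)) ?_
  · refine le_trans (le_of_eq ?_) this; ring
  intro β hβ
  rw [integral_curv_mask hμ, mask_zero]
  simp only [inner_zero_left, mul_zero, integral_zero, add_zero, zero_mul, zero_add]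
  rcases hβ j with hj | hj
  · rw [mask_add, mask_add, mask_smul, mask_smul, mask_single, hj]
    simp only [zero_smul, smul_zero, add_zero]
    refine le_trans (le_of_eq ?_) (integral_hmuDeriv2_mul_inner_sq_ge hμ ?_)
    · rw [norm_mask_sq β hβ]; ring
    · calc ‖mask β w‖ ^ 2 ≤ (μ / (4 * √2)) ^ 2 := by
            have := norm_mask_le β hβ w
            gcongr; linarith
        _ = _ := by rw [div_pow, mul_pow, Real.sq_sqrt (by norm_num)]; ring
  · rw [hj]
    refine le_trans (le_of_eq (by ring)) (integral_nonneg fun v =>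
      mul_nonneg (hmuDeriv2_nonneg hμ _) (sq_nonneg _))

/-- Positive radial slope of the expected objective. -/
lemma integral_curv_ge_of_mid (h0 : 0 ≤ θ) (h1 : θ ≤ 1) (hμ : 0 < μ) {j : Fin n}
    {u : EuclideanSpace ℝ (Fin n)} (hu : u j = 0) (hu1 : ‖u‖ = 1) {t : ℝ} (ht : μ / 8 ≤ t)
    (s γ : ℝ) :
    63 / 512 * (θ * (1 - θ)) - |γ| * θ ≤
      ∫ x, curv μ (t • u + s • EuclideanSpace.single j 1) 0
        (u + γ • EuclideanSpace.single j 1) x ∂(bgVec θ n) := by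
  refine le_trans ?_ (integral_curv_add_single_ge h0 h1 hμ _ _ _ j γ)
  gcongr
  have := le_integral_bgVec h0 h1 (continuous_curv (μ := μ) (t • u + s • EuclideanSpace.single j 1)
    0 u) _ _ (abs_curv_le_pow_four hμ _ _ _) hu 0 0 (63 / 512) (-(63 / 512)) ?_
  · refine le_trans (le_of_eq ?_) this; rw [hu1]; ring
  intro β hβ
  have ht0 : 0 ≤ t := by linarith
  rw [integral_curv_mask hμ, mask_zero]
  simp only [inner_zero_left, ne_eq, OfNat.ofNat_ne_zero, not_false_eq_true, zero_pow, mul_zero,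
    integral_zero, add_zero, zero_mul, zero_add]
  rcases hβ j with hj | hj
  · rw [mask_add, mask_smul, mask_smul, mask_single, hj]
    simp only [zero_smul, smul_zero, add_zero]
    refine le_trans (le_of_eq ?_) (integral_hmuDeriv_mul_inner_ge hμ ht ?_)
    · rw [norm_mask_sq β hβ]; ring
    · exact (norm_mask_le β hβ u).trans hu1.le
  · rw [hj]
    refine le_trans (b := 0) (le_of_eq (by ring)) ?_
    set c := mask β (t • u + s • EuclideanSpace.single j 1) with hc
    rcases eq_or_ne c 0 with h | h
    · simp [h, hmuDeriv]
    rw [integral_hmuDeriv_mul_inner h]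
    refine mul_nonneg (div_nonneg ?_ (sq_nonneg _))
      (integral_nonneg fun v => hmuDeriv_mul_self_nonneg hμ _)
    rw [hc, inner_mask β hβ]
    refine Finset.sum_nonneg fun i _ => ?_
    by_cases hij : i = j
    · subst hij; simp [hu]
    · simp only [PiLp.add_apply, PiLp.smul_apply, smul_eq_mul, PiLp.single_apply, hij,
        if_false, mul_zero, add_zero]
      have : 0 ≤ β i := by rcases hβ i with h | h <;> simp [h]
      calc 0 ≤ t * (u i) ^ 2 * β i := by positivity
        _ = _ := by ring

lemma radial_curvature_le {μ t s S σ A B : ℝ} (hμ : 0 < μ) (hs : 30 * μ ≤ s)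
    (hts : t ^ 2 + s ^ 2 = 1) (hS1 : S ≤ 1) (hS0 : 0 ≤ S) (hσ : σ ^ 2 = t ^ 2 * S + s ^ 2)
    (hσpos : 0 < σ) (hA : A ≤ μ) (hB : 198 / 343 * σ - μ ≤ B) :
    ((t * S - t) / σ ^ 2) ^ 2 * A +
        (S + t ^ 2 / s ^ 2 - ((t * S - t) / σ ^ 2) ^ 2 * σ ^ 2) / σ ^ 2 * B +
        -(s⁻¹ ^ 2) / σ ^ 2 * B ≤ -((1 - S) / 2) := by
  have hs0 : 0 < s := by linarith
  have hσs : s ≤ σ := by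
    refine le_of_sq_le_sq ?_ hσpos.le
    rw [hσ]; nlinarith [mul_nonneg (sq_nonneg t) hS0]
  have hσ1 : σ ≤ 1 := by
    refine le_of_sq_le_sq ?_ zero_le_one
    rw [hσ]; nlinarith [mul_nonneg (sq_nonneg t) (sub_nonneg.2 hS1)]
  have e : ((t * S - t) / σ ^ 2) ^ 2 * A +
      (S + t ^ 2 / s ^ 2 - ((t * S - t) / σ ^ 2) ^ 2 * σ ^ 2) / σ ^ 2 * B +
      -(s⁻¹ ^ 2) / σ ^ 2 * B = (1 - S) / σ ^ 4 * (t ^ 2 * (1 - S) * A - B) := by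
    have e1 : S + t ^ 2 / s ^ 2 - s⁻¹ ^ 2 = -(1 - S) := by
      have : t ^ 2 = 1 - s ^ 2 := by linarith
      rw [this]; field_simp; ring
    have e2 : σ ^ 2 + t ^ 2 * (1 - S) = 1 := by rw [hσ]; linarith
    have e3 : ((t * S - t) / σ ^ 2) ^ 2 * A +
      (S + t ^ 2 / s ^ 2 - ((t * S - t) / σ ^ 2) ^ 2 * σ ^ 2) / σ ^ 2 * B +
      -(s⁻¹ ^ 2) / σ ^ 2 * B = ((t * S - t) / σ ^ 2) ^ 2 * A +
      (S + t ^ 2 / s ^ 2 - s⁻¹ ^ 2 - ((t * S - t) / σ ^ 2) ^ 2 * σ ^ 2) / σ ^ 2 * B := by ring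
    rw [e3, e1]
    have e4 : (1 - S) / σ ^ 4 * (t ^ 2 * (1 - S) * A - B) =
      (1 - S) / σ ^ 4 * (t ^ 2 * (1 - S) * A - (σ ^ 2 + t ^ 2 * (1 - S)) * B) := by
      rw [e2, one_mul]
    rw [e4]
    field_simp
    ring
  rw [e]
  have ht1 : t ^ 2 ≤ 1 := by nlinarith
  have h5 : t ^ 2 * (1 - S) * A ≤ μ := by
    have h6 : 0 ≤ t ^ 2 * (1 - S) := mul_nonneg (sq_nonneg t) (sub_nonneg.2 hS1)
    have h7 : t ^ 2 * (1 - S) ≤ 1 := by nlinarith [sq_nonneg t]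
    calc t ^ 2 * (1 - S) * A ≤ t ^ 2 * (1 - S) * μ := by gcongr
      _ ≤ 1 * μ := by gcongr
      _ = μ := one_mul μ
  have h6 : t ^ 2 * (1 - S) * A - B ≤ -(σ ^ 4 / 2) := by
    have : σ ^ 4 ≤ σ := by
      calc σ ^ 4 ≤ σ ^ 1 := pow_le_pow_of_le_one hσpos.le hσ1 (by norm_num)
        _ = σ := pow_one σ
    linarith
  have h7 : (1 - S) / σ ^ 4 * (t ^ 2 * (1 - S) * A - B) ≤ (1 - S) / σ ^ 4 * (-(σ ^ 4 / 2)) := by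
    have : 0 ≤ 1 - S := sub_nonneg.2 hS1
    gcongr
  have h8 : (1 - S) / σ ^ 4 * (-(σ ^ 4 / 2)) = -((1 - S) / 2) := by field_simp
  linarith

/-- Negative radial curvature of the expected objective away from the origin. -/
lemma integral_curv_le_of_large (h0 : 0 ≤ θ) (h1 : θ ≤ 1) (hμ : 0 < μ) {j : Fin n}
    {u : EuclideanSpace ℝ (Fin n)} (hu : u j = 0) (hu1 : ‖u‖ = 1) {t s : ℝ} (ht : 0 < t)
    (hs : 30 * μ ≤ s) (hts : t ^ 2 + s ^ 2 = 1) :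
    ∫ x, curv μ (t • u + s • EuclideanSpace.single j 1)
        (u + (-(t / s)) • EuclideanSpace.single j 1)
        ((-(s⁻¹ ^ 3)) • EuclideanSpace.single j 1) x ∂(bgVec θ n) ≤
      (1 - θ) * (μ / t ^ 2) - θ * (1 - θ) / 2 := by
  set q := t • u + s • EuclideanSpace.single j 1 with hq
  set a := u + (-(t / s)) • EuclideanSpace.single j 1 with ha
  set b := (-(s⁻¹ ^ 3)) • EuclideanSpace.single j (1 : ℝ) with hb
  have hs0 : 0 < s := by linarith
  have := le_integral_bgVec h0 h1 (continuous_curv (μ := μ) q a b).neg a b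
    (fun x => (abs_neg (curv μ q a b x)).trans_le (abs_curv_le_pow_four hμ _ _ _ x)) hu
    (-(μ / t ^ 2)) (μ / t ^ 2 + 1 / 2) 0 (-(1 / 2)) ?_
  · simp only [Pi.neg_apply] at this
    rw [integral_neg, hu1] at this
    linarith
  intro β hβ
  simp only [Pi.neg_apply]
  rw [integral_neg, integral_curv_mask hμ]
  have hju : ∀ v : EuclideanSpace ℝ (Fin n), ⟪v, EuclideanSpace.single j 1⟫ = v j := fun v => by
    simp [EuclideanSpace.inner_single_right]
  have hmj : (mask β u) j = 0 := by simp [mask, hu]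
  have hnj : ‖(EuclideanSpace.single j 1 : EuclideanSpace ℝ (Fin n))‖ ^ 2 = 1 := by simp
  have hSn := norm_mask_sq β hβ u
  set S := ∑ i, u i ^ 2 * β i with hS
  have hS1 : S ≤ 1 := by
    have := norm_mask_le β hβ u
    rw [← hSn]
    exact pow_le_one₀ (norm_nonneg _) (this.trans hu1.le)
  rcases hβ j with hj | hj
  · rw [hq, ha, hb, mask_add, mask_add, mask_smul, mask_smul, mask_smul, mask_smul, mask_single,
      hj]
    simp only [zero_smul, smul_zero, add_zero, inner_zero_left, mul_zero, integral_zero, zero_mul]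
    have h := integral_hmuDeriv2_mul_self_sq_le hμ (t • mask β u)
    have e : ∫ v, hmuDeriv2 μ ⟪t • mask β u, v⟫ * ⟪t • mask β u, v⟫ ^ 2
        ∂(stdGaussian (EuclideanSpace ℝ (Fin n))) =
        t ^ 2 * ∫ v, hmuDeriv2 μ ⟪t • mask β u, v⟫ * ⟪mask β u, v⟫ ^ 2
        ∂(stdGaussian (EuclideanSpace ℝ (Fin n))) := by
      rw [← integral_const_mul]
      congr 1; ext v
      rw [real_inner_smul_left]; ring
    rw [e] at h
    rw [neg_le_neg_iff, le_div_iff₀ (by positivity)]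
    linarith
  · have hcq : mask β q = t • mask β u + s • EuclideanSpace.single j 1 := by
      rw [hq, mask_add, mask_smul, mask_smul, mask_single, hj, one_smul]
    have hca : mask β a = mask β u + (-(t / s)) • EuclideanSpace.single j 1 := by
      rw [ha, mask_add, mask_smul, mask_single, hj, one_smul]
    have hcb : mask β b = (-(s⁻¹ ^ 3)) • EuclideanSpace.single j 1 := by
      rw [hb, mask_smul, mask_single, hj, one_smul]
    have hσ : ‖mask β q‖ ^ 2 = t ^ 2 * S + s ^ 2 := by
      rw [hcq, norm_add_sq_real, real_inner_smul_left, real_inner_smul_right, hju, hmj, norm_smul,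
        norm_smul, mul_pow, mul_pow, hnj, hSn]
      simp
    have hna : ‖mask β a‖ ^ 2 = S + t ^ 2 / s ^ 2 := by
      rw [hca, norm_add_sq_real, real_inner_smul_right, hju, hmj, norm_smul,
        mul_pow, hnj, hSn]
      simp [div_pow]
    have hqj : (mask β q) j = s := by rw [hcq]; simp [hmj]
    have hqa : ⟪mask β q, mask β a⟫ = t * S - t := by
      rw [hca, inner_add_right, real_inner_smul_right, hju, hqj, hcq, inner_add_left,
        real_inner_smul_left, real_inner_smul_left, real_inner_self_eq_norm_sq, hSn,
        real_inner_comm, hju, hmj]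
      field_simp; ring
    have hqb : ⟪mask β q, mask β b⟫ = - (s⁻¹ ^ 2) := by
      rw [hcb, real_inner_smul_right, hju, hqj]; field_simp
    have hS0 : 0 ≤ S := by rw [← hSn]; positivity
    have hσ2pos : 0 < ‖mask β q‖ ^ 2 := by rw [hσ]; positivity
    have hq0 : mask β q ≠ 0 := by
      intro h; rw [h] at hσ2pos; simp at hσ2pos
    have hA := integral_hmuDeriv2_mul_self_sq_le hμ (mask β q)
    have hB := integral_hmuDeriv_mul_self_ge hμ (mask β q)
    rw [integral_hmuDeriv2_mul_inner_sq hμ hq0, integral_hmuDeriv_mul_inner hq0 (mask β b), hna,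
      hqa, hqb]
    set A := ∫ v, hmuDeriv2 μ ⟪mask β q, v⟫ * ⟪mask β q, v⟫ ^ 2
      ∂(stdGaussian (EuclideanSpace ℝ (Fin n)))
    set B := ∫ v, hmuDeriv μ ⟪mask β q, v⟫ * ⟪mask β q, v⟫
      ∂(stdGaussian (EuclideanSpace ℝ (Fin n)))
    set σ := ‖mask β q‖ with hσdef
    have hσpos : 0 < σ := by
      rw [hσdef]; positivity
    have := radial_curvature_le hμ hs hts hS1 hS0 hσ hσpos hA hB
    rw [hj]
    linarith

end expectation

section bernstein

lemma exp_le_one_add_add_sq_mul_exp_abs (y : ℝ) : exp y ≤ 1 + y + y ^ 2 * exp |y| := by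
  have h1 : exp y - y * exp y ≤ 1 := by
    have := add_one_le_exp (-y)
    have h2 : exp (-y) * exp y = 1 := by rw [← exp_add]; simp
    nlinarith [exp_pos y]
  rcases le_total 0 y with h | h
  · rw [abs_of_nonneg h]
    nlinarith
  · have h2 : 1 ≤ exp |y| := one_le_exp (abs_nonneg y)
    have h3 := add_one_le_exp y
    nlinarith [mul_nonneg (sq_nonneg y) (sub_nonneg.2 h2)]

lemma sq_le_eight_mul_exp_half {r : ℝ} (hr : 0 ≤ r) : r ^ 2 ≤ 8 * exp (r / 2) := by
  have := quadratic_le_exp_of_nonneg (x := r / 2) (by positivity)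
  nlinarith

/-- Empirical average of `F` over a sample. -/
def empAvg {Ω : Type*} (p : ℕ) (F : Ω → ℝ) (x : Fin p → Ω) : ℝ :=
  (p : ℝ)⁻¹ * ∑ k, F (x k)

variable {Ω : Type*} [MeasurableSpace Ω] {ν : Measure Ω} {F : Ω → ℝ} {K : ℝ}

lemma integrable_of_integrable_exp_abs (hF : Measurable F) (hK : 0 < K)
    (hi : Integrable (fun x => exp (|F x| / K)) ν) : Integrable F ν := by
  refine (hi.const_mul K).mono' hF.aestronglyMeasurable (Filter.Eventually.of_forall fun x => ?_)
  have := add_one_le_exp (|F x| / K)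
  rw [Real.norm_eq_abs]
  calc |F x| = K * (|F x| / K) := by field_simp
    _ ≤ _ := by gcongr; linarith

lemma integrable_exp_mul_of_le (hF : Measurable F) (hK : 0 < K)
    (hi : Integrable (fun x => exp (|F x| / K)) ν) {l : ℝ} (hl0 : 0 ≤ l) (hl : l ≤ 1 / (2 * K)) :
    Integrable (fun x => exp (l * F x)) ν := by
  refine hi.mono' (by fun_prop) (Filter.Eventually.of_forall fun x => ?_)
  rw [Real.norm_eq_abs, abs_of_pos (exp_pos _), exp_le_exp, div_eq_inv_mul]
  have h1 : l ≤ K⁻¹ := hl.trans (by rw [one_div]; gcongr; linarith)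
  calc l * F x ≤ l * |F x| := by gcongr; exact le_abs_self _
    _ ≤ _ := by gcongr

variable [IsProbabilityMeasure ν]

lemma integral_exp_mul_sub_le (hF : Measurable F) (hK : 0 < K)
    (hi : Integrable (fun x => exp (|F x| / K)) ν) (h2 : ∫ x, exp (|F x| / K) ∂ν ≤ 4) {l : ℝ}
    (hl0 : 0 ≤ l) (hl : l ≤ 1 / (2 * K)) :
    ∫ x, exp (l * (F x - ∫ y, F y ∂ν)) ∂ν ≤ exp (32 * K ^ 2 * l ^ 2) := by
  have hFi := integrable_of_integrable_exp_abs hF hK hi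
  set m := ∫ y, F y ∂ν
  have hpt : ∀ x, exp (l * F x) ≤ 1 + l * F x + 8 * K ^ 2 * l ^ 2 * exp (|F x| / K) := by
    intro x
    refine (exp_le_one_add_add_sq_mul_exp_abs _).trans ?_
    have h3 : |l * F x| ≤ |F x| / K / 2 := by
      rw [abs_mul, abs_of_nonneg hl0]
      calc l * |F x| ≤ 1 / (2 * K) * |F x| := by gcongr
        _ = _ := by field_simp
    have h4 := sq_le_eight_mul_exp_half (r := |F x| / K) (by positivity)
    have h5 : (l * F x) ^ 2 * exp |l * F x| ≤ 8 * K ^ 2 * l ^ 2 * exp (|F x| / K) := by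
      calc (l * F x) ^ 2 * exp |l * F x| ≤ (l * F x) ^ 2 * exp (|F x| / K / 2) := by gcongr
        _ = l ^ 2 * K ^ 2 * (|F x| / K) ^ 2 * exp (|F x| / K / 2) := by
            rw [div_pow, sq_abs]; field_simp
        _ ≤ l ^ 2 * K ^ 2 * (8 * exp (|F x| / K / 2)) * exp (|F x| / K / 2) := by gcongr
        _ = 8 * K ^ 2 * l ^ 2 * (exp (|F x| / K / 2) * exp (|F x| / K / 2)) := by ring
        _ = _ := by rw [← exp_add, add_halves]
    linarith
  have i1 : Integrable (fun x => 1 + l * F x) ν := (integrable_const _).add (hFi.const_mul _)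
  have h6 : ∫ x, exp (l * F x) ∂ν ≤ 1 + l * m + 32 * K ^ 2 * l ^ 2 := by
    calc _ ≤ ∫ x, (1 + l * F x + 8 * K ^ 2 * l ^ 2 * exp (|F x| / K)) ∂ν :=
          integral_mono (integrable_exp_mul_of_le hF hK hi hl0 hl) (i1.add (hi.const_mul _)) hpt
      _ = 1 + l * m + 8 * K ^ 2 * l ^ 2 * ∫ x, exp (|F x| / K) ∂ν := by
          rw [integral_add i1 (hi.const_mul _), integral_add (integrable_const _)
            (hFi.const_mul _), integral_const_mul, integral_const_mul]
          simp [m]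
      _ ≤ 1 + l * m + 8 * K ^ 2 * l ^ 2 * 4 := by gcongr
      _ = _ := by ring
  calc ∫ x, exp (l * (F x - m)) ∂ν = exp (-(l * m)) * ∫ x, exp (l * F x) ∂ν := by
        rw [← integral_const_mul]
        congr 1; ext x; rw [← exp_add]; ring_nf
    _ ≤ exp (-(l * m)) * exp (l * m + 32 * K ^ 2 * l ^ 2) := by
        gcongr
        refine h6.trans ?_
        have := add_one_le_exp (l * m + 32 * K ^ 2 * l ^ 2)
        linarith
    _ = _ := by rw [← exp_add]; ring_nf

lemma measureReal_empAvg_sub_ge_le (hF : Measurable F) (hK : 0 < K)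
    (hi : Integrable (fun x => exp (|F x| / K)) ν) (h2 : ∫ x, exp (|F x| / K) ∂ν ≤ 4) {τ : ℝ}
    (hτ0 : 0 ≤ τ) (hτ : τ ≤ K) {p : ℕ} (hp : 0 < p) :
    (Measure.pi fun _ : Fin p => ν).real {x | τ ≤ empAvg p F x - ∫ y, F y ∂ν} ≤
      exp (-(p * τ ^ 2 / (128 * K ^ 2))) := by
  set m := ∫ y, F y ∂ν with hm
  set l := τ / (64 * K ^ 2) with hl
  have hl0 : 0 ≤ l := by positivity
  have hl1 : l ≤ 1 / (2 * K) := by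
    rw [hl, div_le_div_iff₀ (by positivity) (by positivity)]
    nlinarith
  have hpp : (0 : ℝ) < p := by exact_mod_cast hp
  have hset : {x : Fin p → Ω | τ ≤ empAvg p F x - m} = {x | p * τ ≤ ∑ k, (F (x k) - m)} := by
    ext x
    simp only [Set.mem_ofPred_eq, empAvg, Finset.sum_sub_distrib, Finset.sum_const,
      Finset.card_univ, Fintype.card_fin, nsmul_eq_mul]
    rw [← mul_le_mul_iff_right₀ hpp (b := τ)]
    have : (p : ℝ) * ((p : ℝ)⁻¹ * ∑ k, F (x k) - m) = ∑ k, F (x k) - p * m := by field_simp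
    rw [this]
  have hprod : ∀ x : Fin p → Ω, exp (l * ∑ k, (F (x k) - m)) = ∏ k, exp (l * (F (x k) - m)) :=
    fun x => by rw [Finset.mul_sum, exp_sum]
  have hI : Integrable (fun x => exp (l * (F x - m))) ν := by
    have := (integrable_exp_mul_of_le hF hK hi hl0 hl1).const_mul (exp (-(l * m)))
    refine this.congr (Filter.Eventually.of_forall fun x => ?_)
    simp only
    rw [← exp_add]; ring_nf
  rw [hset]
  refine (measure_ge_le_exp_mul_mgf (t := l) _ hl0 ?_).trans ?_
  · simp_rw [hprod]
    exact Integrable.fintype_prod (f := fun _ x => exp (l * (F x - m))) fun _ => hI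
  · unfold mgf
    simp_rw [hprod]
    rw [integral_fintype_prod_eq_pow (fun x => exp (l * (F x - m))), Fintype.card_fin]
    calc _ ≤ exp (-l * (p * τ)) * exp (32 * K ^ 2 * l ^ 2) ^ p := by
          gcongr
          exact integral_exp_mul_sub_le hF hK hi h2 hl0 hl1
      _ = _ := by
          rw [← exp_nat_mul, ← exp_add, hl]
          congr 1
          field_simp
          ring

/-- Two-sided Bernstein inequality for empirical averages of a subexponential function. -/
lemma measureReal_abs_empAvg_sub_ge_le (hF : Measurable F) (hK : 0 < K)
    (hi : Integrable (fun x => exp (|F x| / K)) ν) (h2 : ∫ x, exp (|F x| / K) ∂ν ≤ 4) {τ : ℝ}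
    (hτ0 : 0 ≤ τ) (hτ : τ ≤ K) {p : ℕ} (hp : 0 < p) :
    (Measure.pi fun _ : Fin p => ν).real {x | τ ≤ |empAvg p F x - ∫ y, F y ∂ν|} ≤
      2 * exp (-(p * τ ^ 2 / (128 * K ^ 2))) := by
  have h1 := measureReal_empAvg_sub_ge_le hF hK hi h2 hτ0 hτ hp
  have h3 := measureReal_empAvg_sub_ge_le (F := fun x => -F x) hF.neg hK (by simpa using hi)
    (by simpa using h2) hτ0 hτ hp
  calc _ ≤ (Measure.pi fun _ : Fin p => ν).real ({x | τ ≤ empAvg p F x - ∫ y, F y ∂ν} ∪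
        {x | τ ≤ empAvg p (fun y => -F y) x - ∫ y, -F y ∂ν}) := by
        refine measureReal_mono fun x hx => ?_
        simp only [Set.mem_ofPred_eq, Set.mem_union] at hx ⊢
        rcases le_abs.1 hx with h | h
        · exact Or.inl h
        · right
          rw [integral_neg]
          simp only [empAvg, Finset.sum_neg_distrib] at h ⊢
          linarith
    _ ≤ _ := (measureReal_union_le _ _).trans (by linarith)

end bernstein

section nets

/-- A set whose coordinates lie in `[-R, R]` has an internal net of mesh `R / N` and cardinality
at most `(2N+1)^d`. -/
lemma exists_finset_net {α ι : Type*} [Fintype ι] [DecidableEq ι] (T : Set α) (f : α → ι → ℝ)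
    {R : ℝ} (hR : 0 < R) (hf : ∀ x ∈ T, ∀ i, |f x i| ≤ R) {N : ℕ} (hN : 0 < N) :
    ∃ t : Finset α, (∀ y ∈ t, y ∈ T) ∧ t.card ≤ (2 * N + 1) ^ Fintype.card ι ∧
      ∀ x ∈ T, ∃ y ∈ t, ∀ i, |f x i - f y i| ≤ R / N := by
  classical
  have hN' : (0 : ℝ) < N := by exact_mod_cast hN
  let cell : α → ι → ℤ := fun x i => ⌊N * f x i / R⌋
  have hcell : ∀ x ∈ T, cell x ∈ Fintype.piFinset fun _ : ι => Finset.Icc (-(N : ℤ)) N := by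
    intro x hx
    rw [Fintype.mem_piFinset]
    intro i
    have h := abs_le.1 (hf x hx i)
    rw [Finset.mem_Icc]
    constructor
    · rw [Int.le_floor, le_div_iff₀ hR]
      push_cast; nlinarith
    · rw [← Int.floor_natCast (R := ℝ) N]
      refine Int.floor_le_floor ?_
      rw [div_le_iff₀ hR]
      nlinarith
  have hfin : (cell '' T).Finite := by
    refine (Finset.finite_toSet (Fintype.piFinset fun _ : ι => Finset.Icc (-(N : ℤ)) N)).subset ?_
    rintro _ ⟨x, hx, rfl⟩
    exact hcell x hx
  have hrep : ∀ c ∈ cell '' T, ∃ x ∈ T, cell x = c := fun c hc => hc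
  choose rep hrepT hrepc using hrep
  refine ⟨hfin.toFinset.attach.image fun c => rep c.1 (hfin.mem_toFinset.1 c.2), ?_, ?_, ?_⟩
  · intro y hy
    rw [Finset.mem_image] at hy
    obtain ⟨c, hc, rfl⟩ := hy
    exact hrepT _ _
  · refine Finset.card_image_le.trans ?_
    have hsub : hfin.toFinset ⊆ Fintype.piFinset fun _ : ι => Finset.Icc (-(N : ℤ)) N := by
      intro c hc
      obtain ⟨x, hx, rfl⟩ := hfin.mem_toFinset.1 hc
      exact hcell x hx
    rw [Finset.card_attach]
    refine (Finset.card_le_card hsub).trans (le_of_eq ?_)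
    rw [Fintype.card_piFinset]
    simp only [Int.card_Icc, Finset.prod_const, Finset.card_univ]
    congr 1
    omega
  · intro x hx
    have hc : cell x ∈ cell '' T := ⟨x, hx, rfl⟩
    refine ⟨rep (cell x) hc, Finset.mem_image.2
      ⟨⟨_, hfin.mem_toFinset.2 hc⟩, Finset.mem_attach _ _, rfl⟩, fun i => ?_⟩
    have h := congrFun (hrepc _ hc) i
    have h1 := Int.abs_sub_lt_one_of_floor_eq_floor h.symm
    have h2 : N * f x i / R - N * f (rep (cell x) hc) i / R =
        (f x i - f (rep (cell x) hc) i) * (N / R) :=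
      by ring
    rw [h2, abs_mul, abs_of_pos (show 0 < N / R by positivity)] at h1
    have h3 : |f x i - f (rep (cell x) hc) i| =
        |f x i - f (rep (cell x) hc) i| * (N / R) * (R / N) := by
      field_simp
    rw [h3]
    calc _ ≤ 1 * (R / N) := by gcongr
      _ = _ := one_mul _

lemma norm_le_sqrt_mul_of_forall_abs_le {n : ℕ} {x : EuclideanSpace ℝ (Fin n)} {δ : ℝ} (hδ : 0 ≤ δ)
    (h : ∀ i, |x i| ≤ δ) : ‖x‖ ≤ √n * δ := by
  refine le_of_sq_le_sq ?_ (by positivity)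
  rw [EuclideanSpace.real_norm_sq_eq, mul_pow, Real.sq_sqrt (by positivity)]
  calc ∑ i, x i ^ 2 ≤ ∑ _i : Fin n, δ ^ 2 := Finset.sum_le_sum fun i _ => by
        rw [← sq_abs]; gcongr; exact h i
    _ = _ := by simp

lemma abs_apply_le_norm {n : ℕ} (x : EuclideanSpace ℝ (Fin n)) (i : Fin n) : |x i| ≤ ‖x‖ := by
  simpa using PiLp.norm_apply_le x i

end nets

section perturbation

variable {n p : ℕ} {θ μ : ℝ} {x : Fin p → Fin n → ℝ}

lemma empAvg_mono {Ω : Type*} {F G : Ω → ℝ} {x : Fin p → Ω} (h : ∀ k, F (x k) ≤ G (x k)) :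
    empAvg p F x ≤ empAvg p G x := by
  unfold empAvg
  gcongr with k
  exact h k

lemma empAvg_add {Ω : Type*} (F G : Ω → ℝ) (x : Fin p → Ω) :
    empAvg p (fun y => F y + G y) x = empAvg p F x + empAvg p G x := by
  simp [empAvg, Finset.sum_add_distrib, mul_add]

lemma empAvg_sub {Ω : Type*} (F G : Ω → ℝ) (x : Fin p → Ω) :
    empAvg p (fun y => F y - G y) x = empAvg p F x - empAvg p G x := by
  simp [empAvg, Finset.sum_sub_distrib, mul_sub]

lemma empAvg_const_mul {Ω : Type*} (r : ℝ) (F : Ω → ℝ) (x : Fin p → Ω) :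
    empAvg p (fun y => r * F y) x = r * empAvg p F x := by
  simp only [empAvg, ← Finset.mul_sum]; ring

lemma empAvg_const_le {Ω : Type*} {r : ℝ} (hr : 0 ≤ r) (x : Fin p → Ω) :
    empAvg p (fun _ => r) x ≤ r := by
  simp only [empAvg, Finset.sum_const, Finset.card_univ, Fintype.card_fin, nsmul_eq_mul]
  rcases Nat.eq_zero_or_pos p with h | h
  · simpa [h] using hr
  · have : (p : ℝ) ≠ 0 := by positivity
    field_simp; rfl

lemma abs_empAvg_le {Ω : Type*} (F : Ω → ℝ) (x : Fin p → Ω) :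
    |empAvg p F x| ≤ empAvg p (fun y => |F y|) x := by
  unfold empAvg
  rw [abs_mul, abs_of_nonneg (by positivity : (0 : ℝ) ≤ (p : ℝ)⁻¹)]
  gcongr
  exact Finset.abs_sum_le_sum_abs _ _

lemma abs_pairing_le {B : ℝ} (hB : 0 ≤ B) {y : Fin n → ℝ} (hy : ∀ i, |y i| ≤ B)
    (c : EuclideanSpace ℝ (Fin n)) : |pairing c y| ≤ √n * B * ‖c‖ := by
  rw [pairing_eq_inner]
  refine (abs_real_inner_le_norm _ _).trans ?_
  rw [mul_comm]
  gcongr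
  exact norm_le_sqrt_mul_of_forall_abs_le hB hy

lemma empAvg_abs_mul_abs_le
    (h2 : ∀ c : EuclideanSpace ℝ (Fin n), empAvg p (fun y => pairing c y ^ 2) x ≤ 2 * θ * ‖c‖ ^ 2)
    (c d : EuclideanSpace ℝ (Fin n)) :
    empAvg p (fun y => |pairing c y| * |pairing d y|) x ≤ 2 * θ * (‖c‖ * ‖d‖) := by
  rcases eq_or_ne c 0 with rfl | hc
  · simp [pairing_zero_left, empAvg]
  rcases eq_or_ne d 0 with rfl | hd
  · simp [pairing_zero_left, empAvg]
  have hc' : 0 < ‖c‖ := by positivity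
  have hd' : 0 < ‖d‖ := by positivity
  calc _ ≤ empAvg p (fun y => ‖d‖ / (2 * ‖c‖) * pairing c y ^ 2 +
        ‖c‖ / (2 * ‖d‖) * pairing d y ^ 2) x := by
        refine empAvg_mono fun k => ?_
        rw [← sq_abs (pairing c (x k)), ← sq_abs (pairing d (x k))]
        set u := |pairing c (x k)|
        set v := |pairing d (x k)|
        have : ‖d‖ / (2 * ‖c‖) * u ^ 2 + ‖c‖ / (2 * ‖d‖) * v ^ 2 - u * v =
            (‖d‖ * u - ‖c‖ * v) ^ 2 / (2 * ‖c‖ * ‖d‖) := by field_simp; ring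
        have h3 : 0 ≤ (‖d‖ * u - ‖c‖ * v) ^ 2 / (2 * ‖c‖ * ‖d‖) := by positivity
        linarith
    _ = ‖d‖ / (2 * ‖c‖) * empAvg p (fun y => pairing c y ^ 2) x +
        ‖c‖ / (2 * ‖d‖) * empAvg p (fun y => pairing d y ^ 2) x := by
        rw [empAvg_add, empAvg_const_mul, empAvg_const_mul]
    _ ≤ ‖d‖ / (2 * ‖c‖) * (2 * θ * ‖c‖ ^ 2) + ‖c‖ / (2 * ‖d‖) * (2 * θ * ‖d‖ ^ 2) := by
        gcongr
        · exact h2 c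
        · exact h2 d
    _ = _ := by field_simp; ring

lemma empAvg_abs_pairing_le (hθ : θ ≤ 1 / 2)
    (h2 : ∀ c : EuclideanSpace ℝ (Fin n), empAvg p (fun y => pairing c y ^ 2) x ≤ 2 * θ * ‖c‖ ^ 2)
    (c : EuclideanSpace ℝ (Fin n)) :
    empAvg p (fun y => |pairing c y|) x ≤ ‖c‖ := by
  rcases eq_or_ne c 0 with rfl | hc
  · simp [pairing_zero_left, empAvg]
  have hc' : 0 < ‖c‖ := by positivity
  calc _ ≤ empAvg p (fun y => ‖c‖ / 2 + 1 / (2 * ‖c‖) * pairing c y ^ 2) x := by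
        refine empAvg_mono fun k => ?_
        rw [← sq_abs (pairing c (x k))]
        set u := |pairing c (x k)|
        have : ‖c‖ / 2 + 1 / (2 * ‖c‖) * u ^ 2 - u = (u - ‖c‖) ^ 2 / (2 * ‖c‖) := by
          field_simp; ring
        have h3 : 0 ≤ (u - ‖c‖) ^ 2 / (2 * ‖c‖) := by positivity
        linarith
    _ = empAvg p (fun _ => ‖c‖ / 2) x + 1 / (2 * ‖c‖) * empAvg p (fun y => pairing c y ^ 2) x := by
        rw [empAvg_add, empAvg_const_mul]
    _ ≤ ‖c‖ / 2 + 1 / (2 * ‖c‖) * (1 * ‖c‖ ^ 2) := by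
        gcongr
        · exact empAvg_const_le (by positivity) x
        · refine (h2 c).trans ?_
          gcongr; linarith
    _ = _ := by field_simp; ring

/-- Stability of the empirical second-order form under perturbation of its three arguments. -/
lemma abs_empAvg_curv_sub_le (hθ : θ ≤ 1 / 2) (hμ : 0 < μ) {B : ℝ} (hB : 0 ≤ B)
    (h1 : ∀ k i, |x k i| ≤ B)
    (h2 : ∀ c : EuclideanSpace ℝ (Fin n), empAvg p (fun y => pairing c y ^ 2) x ≤ 2 * θ * ‖c‖ ^ 2)
    (q a b q' a' b' : EuclideanSpace ℝ (Fin n)) :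
    |empAvg p (curv μ q a b) x - empAvg p (curv μ q' a' b') x| ≤
      2 * μ⁻¹ ^ 2 * (√n * B * ‖q - q'‖) * (2 * θ * ‖a‖ ^ 2) +
      μ⁻¹ * (2 * θ * (‖a - a'‖ * ‖a + a'‖)) + μ⁻¹ * (2 * θ * (‖q - q'‖ * ‖b‖)) + ‖b - b'‖ := by
  rw [← empAvg_sub]
  refine (abs_empAvg_le _ _).trans ?_
  have hμ' : 0 < μ⁻¹ := by positivity
  calc _ ≤ empAvg p (fun y => 2 * μ⁻¹ ^ 2 * (√n * B * ‖q - q'‖) * pairing a y ^ 2 +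
        μ⁻¹ * (|pairing (a - a') y| * |pairing (a + a') y|) +
        μ⁻¹ * (|pairing (q - q') y| * |pairing b y|) + |pairing (b - b') y|) x := by
        refine empAvg_mono fun k => ?_
        set y := x k with hy
        have hq := abs_pairing_le hB (h1 k) (q - q')
        have e : curv μ q a b y - curv μ q' a' b' y =
            (hmuDeriv2 μ (pairing q y) - hmuDeriv2 μ (pairing q' y)) * pairing a y ^ 2 +
            hmuDeriv2 μ (pairing q' y) * (pairing (a - a') y * pairing (a + a') y) +
            (hmuDeriv μ (pairing q y) - hmuDeriv μ (pairing q' y)) * pairing b y +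
            hmuDeriv μ (pairing q' y) * pairing (b - b') y := by
          simp only [curv, pairing_sub_left, pairing_add_left]; ring
        rw [e]
        have g1 := abs_hmuDeriv2_sub_le hμ (pairing q y) (pairing q' y)
        have g2 := abs_hmuDeriv2_le hμ (pairing q' y)
        have g3 := abs_hmuDeriv_sub_le hμ (pairing q y) (pairing q' y)
        have g4 := abs_hmuDeriv_le μ (pairing q' y)
        rw [← pairing_sub_left] at g1 g3
        refine (abs_add_le _ _).trans (add_le_add ((abs_add_le _ _).trans (add_le_add
          ((abs_add_le _ _).trans (add_le_add ?_ ?_)) ?_)) ?_)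
        · rw [abs_mul, abs_of_nonneg (sq_nonneg (pairing a y))]
          gcongr
          refine g1.trans ?_
          gcongr
        · rw [abs_mul, abs_mul]; gcongr
        · rw [abs_mul, ← mul_assoc]; gcongr
        · rw [abs_mul]; exact mul_le_of_le_one_left (abs_nonneg _) g4
    _ = 2 * μ⁻¹ ^ 2 * (√n * B * ‖q - q'‖) * empAvg p (fun y => pairing a y ^ 2) x +
        μ⁻¹ * empAvg p (fun y => |pairing (a - a') y| * |pairing (a + a') y|) x +
        μ⁻¹ * empAvg p (fun y => |pairing (q - q') y| * |pairing b y|) x +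
        empAvg p (fun y => |pairing (b - b') y|) x := by
        rw [empAvg_add, empAvg_add, empAvg_add, empAvg_const_mul, empAvg_const_mul,
          empAvg_const_mul]
    _ ≤ _ := by
        gcongr
        · exact h2 a
        · exact empAvg_abs_mul_abs_le h2 _ _
        · exact empAvg_abs_mul_abs_le h2 _ _
        · exact empAvg_abs_pairing_le hθ h2 _

end perturbation

section events

variable {n p : ℕ} {θ μ : ℝ}

lemma isProbabilityMeasure_bgVec (h0 : 0 ≤ θ) (h1 : θ ≤ 1) (n : ℕ) :
    IsProbabilityMeasure (bgVec θ n) := by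
  have := isProbabilityMeasure_bg h0 h1
  unfold bgVec; infer_instance

lemma measureReal_exists_finset_le {α Ω : Type*} [MeasurableSpace Ω] {P : Measure Ω}
    (t : Finset α) (E : α → Set Ω) {ε : ℝ} (h : ∀ a ∈ t, P.real (E a) ≤ ε) :
    P.real {x | ∃ a ∈ t, x ∈ E a} ≤ t.card * ε := by
  have : {x | ∃ a ∈ t, x ∈ E a} = ⋃ a ∈ t, E a := by ext x; simp
  rw [this]
  refine (measureReal_biUnion_finset_le _ _).trans ?_
  calc _ ≤ ∑ _a ∈ t, ε := Finset.sum_le_sum h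
    _ = _ := by simp

lemma pairing_single (i : Fin n) (y : Fin n → ℝ) :
    pairing (EuclideanSpace.single i 1) y = y i := by
  simp [pairing, PiLp.single_apply]

lemma measureReal_entry_ge_le (h0 : 0 ≤ θ) (h1 : θ ≤ 1) {B : ℝ} (hB : 0 ≤ B) (i : Fin n) :
    (bgVec θ n).real {y | B ≤ |y i|} ≤ 2 * exp (-(B ^ 2 / 4)) := by
  have hc : ‖(EuclideanSpace.single i 1 : EuclideanSpace ℝ (Fin n))‖ ≤ 1 := by simp
  have h := mul_meas_ge_le_integral_of_nonneg (μ := bgVec θ n)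
    (f := fun y => exp (pairing (EuclideanSpace.single i 1) y ^ 2 / 4))
    (Filter.Eventually.of_forall fun y => (exp_pos _).le) (integrable_exp_pairing_sq h0 h1 hc)
    (exp (B ^ 2 / 4))
  have h2 := h.trans (integral_exp_pairing_sq_le h0 h1 hc)
  have h3 : (bgVec θ n).real {y | B ≤ |y i|} ≤ (bgVec θ n).real
      {y | exp (B ^ 2 / 4) ≤ exp (pairing (EuclideanSpace.single i 1) y ^ 2 / 4)} := by
    refine measureReal_mono fun y hy => ?_
    simp only [Set.mem_ofPred_eq, exp_le_exp, pairing_single] at hy ⊢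
    rw [← sq_abs (y i)]
    gcongr
  rw [Real.exp_neg, ← div_eq_mul_inv, le_div_iff₀ (exp_pos _)]
  calc _ ≤ _ := mul_le_mul_of_nonneg_right h3 (exp_pos _).le
    _ ≤ _ := by rw [mul_comm]; exact h2

lemma measureReal_exists_entry_ge_le (h0 : 0 ≤ θ) (h1 : θ ≤ 1) {B : ℝ} (hB : 0 ≤ B) (n p : ℕ) :
    (Measure.pi fun _ : Fin p => bgVec θ n).real {x | ∃ k i, B ≤ |x k i|} ≤
      p * n * (2 * exp (-(B ^ 2 / 4))) := by
  have := isProbabilityMeasure_bgVec h0 h1 n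
  have hset : {x : Fin p → Fin n → ℝ | ∃ k i, B ≤ |x k i|} =
      {x | ∃ ki ∈ (Finset.univ : Finset (Fin p × Fin n)), x ∈ {x | B ≤ |x ki.1 ki.2|}} := by
    ext x; simp
  rw [hset]
  refine (measureReal_exists_finset_le _ _ (ε := 2 * exp (-(B ^ 2 / 4))) ?_).trans (by simp)
  rintro ⟨k, i⟩ -
  have hm : MeasurableSet {y : Fin n → ℝ | B ≤ |y i|} :=
    measurableSet_le measurable_const (measurable_pi_apply i).abs
  have hp := (measurePreserving_eval (fun _ : Fin p => bgVec θ n) k).measureReal_preimage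
    hm.nullMeasurableSet
  exact hp.le.trans (measureReal_entry_ge_le h0 h1 hB i)

lemma measureReal_exists_pairing_sq_le (h0 : 0 ≤ θ) (h1 : θ ≤ 1) (hp : 0 < p)
    (t : Finset (EuclideanSpace ℝ (Fin n))) (ht : ∀ c ∈ t, ‖c‖ ≤ 1) {η : ℝ} (hη0 : 0 ≤ η)
    (hη : η ≤ 4) :
    (Measure.pi fun _ : Fin p => bgVec θ n).real
      {x | ∃ c ∈ t, η ≤ |empAvg p (fun y => pairing c y ^ 2) x - θ * ‖c‖ ^ 2|} ≤
      t.card * (2 * exp (-(p * η ^ 2 / (128 * 4 ^ 2)))) := by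
  have := isProbabilityMeasure_bgVec h0 h1 n
  refine measureReal_exists_finset_le t
    (fun c => {x | η ≤ |empAvg p (fun y => pairing c y ^ 2) x - θ * ‖c‖ ^ 2|}) fun c hc => ?_
  rw [← integral_pairing_sq h0 h1 c]
  refine measureReal_abs_empAvg_sub_ge_le (by fun_prop) (by norm_num) ?_ ?_ hη0 hη hp
  · simp only [abs_of_nonneg (sq_nonneg (pairing c _))]
    exact integrable_exp_pairing_sq h0 h1 (ht c hc)
  · simp only [abs_of_nonneg (sq_nonneg (pairing c _))]
    exact (integral_exp_pairing_sq_le h0 h1 (ht c hc)).trans (by norm_num)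

lemma exp_abs_curv_le {r : ℝ} (hr : 1 ≤ r) (hμ : 0 < μ) (hμ1 : μ ≤ 1)
    (q a b : EuclideanSpace ℝ (Fin n)) (x : Fin n → ℝ) :
    exp (|curv μ q a b x| / (32 * r ^ 3 / μ)) ≤
      exp (pairing ((2 * r)⁻¹ • a) x ^ 2 / 4) + exp (pairing ((8 * r ^ 3)⁻¹ • b) x ^ 2 / 4) := by
  have h := abs_curv_le hμ q a b x
  set y := pairing ((2 * r)⁻¹ • a) x with hy
  set z := pairing ((8 * r ^ 3)⁻¹ • b) x with hz
  have hr0 : 0 < r := by linarith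
  have ea : pairing a x = 2 * r * y := by rw [hy, pairing_smul_left]; field_simp
  have eb : pairing b x = 8 * r ^ 3 * z := by rw [hz, pairing_smul_left]; field_simp
  have h1 : |curv μ q a b x| / (32 * r ^ 3 / μ) ≤ 1 / 8 + y ^ 2 / 8 + z ^ 2 / 8 := by
    rw [ea, eb, abs_mul, abs_of_pos (show 0 < 8 * r ^ 3 by positivity)] at h
    calc _ ≤ (μ⁻¹ * (2 * r * y) ^ 2 + 8 * r ^ 3 * |z|) / (32 * r ^ 3 / μ) := by gcongr
      _ = y ^ 2 / 8 / r + μ * |z| / 4 := by field_simp; ring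
      _ ≤ y ^ 2 / 8 + 1 * |z| / 4 := by
          refine add_le_add (div_le_self (by positivity) hr) ?_
          gcongr
      _ ≤ _ := by
          rw [← sq_abs z]
          nlinarith [sq_nonneg (|z| - 1)]
  have h2 : exp (1 / 8 : ℝ) ≤ 2 := by
    have h3 : Real.exp (1 / 8) ≤ 1 / (1 - 1 / 8) := by
      have h4 := one_sub_le_exp_neg (1 / 8 : ℝ)
      rw [Real.exp_neg] at h4
      rw [le_div_iff₀ (by norm_num)]
      have := exp_pos (1 / 8 : ℝ)
      calc _ ≤ exp (1 / 8) * (exp (1 / 8))⁻¹ := by gcongr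
        _ = 1 := by field_simp
    exact h3.trans (by norm_num)
  calc _ ≤ exp (1 / 8 + y ^ 2 / 8 + z ^ 2 / 8) := exp_le_exp.2 h1
    _ = exp (1 / 8) * (exp (y ^ 2 / 8) * exp (z ^ 2 / 8)) := by rw [exp_add, exp_add, mul_assoc]
    _ ≤ 2 * (exp (y ^ 2 / 8) * exp (z ^ 2 / 8)) := by gcongr
    _ ≤ exp (y ^ 2 / 8) ^ 2 + exp (z ^ 2 / 8) ^ 2 := by
        nlinarith [sq_nonneg (exp (y ^ 2 / 8) - exp (z ^ 2 / 8))]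
    _ = _ := by
        rw [← exp_nat_mul, ← exp_nat_mul]
        push_cast
        ring_nf

lemma integral_exp_abs_curv_le (h0 : 0 ≤ θ) (h1 : θ ≤ 1) {r : ℝ} (hr : 1 ≤ r) (hμ : 0 < μ)
    (hμ1 : μ ≤ 1) (q : EuclideanSpace ℝ (Fin n)) {a b : EuclideanSpace ℝ (Fin n)}
    (ha : ‖a‖ ≤ 2 * r) (hb : ‖b‖ ≤ 8 * r ^ 3) :
    Integrable (fun x => exp (|curv μ q a b x| / (32 * r ^ 3 / μ))) (bgVec θ n) ∧
      ∫ x, exp (|curv μ q a b x| / (32 * r ^ 3 / μ)) ∂(bgVec θ n) ≤ 4 := by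
  have hr0 : 0 < r := by linarith
  have ha' : ‖(2 * r)⁻¹ • a‖ ≤ 1 := by
    rw [norm_smul, norm_inv, Real.norm_of_nonneg (by positivity), inv_mul_le_iff₀ (by positivity)]
    linarith
  have hb' : ‖(8 * r ^ 3)⁻¹ • b‖ ≤ 1 := by
    rw [norm_smul, norm_inv, Real.norm_of_nonneg (by positivity), inv_mul_le_iff₀ (by positivity)]
    linarith
  have ia := integrable_exp_pairing_sq h0 h1 ha'
  have ib := integrable_exp_pairing_sq h0 h1 hb'
  have hi : Integrable (fun x => exp (|curv μ q a b x| / (32 * r ^ 3 / μ))) (bgVec θ n) := by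
    refine (ia.add ib).mono' (Continuous.aestronglyMeasurable (by fun_prop))
      (Filter.Eventually.of_forall fun x => ?_)
    rw [Real.norm_of_nonneg (exp_pos _).le]
    exact exp_abs_curv_le hr hμ hμ1 q a b x
  refine ⟨hi, ?_⟩
  calc _ ≤ ∫ x, (exp (pairing ((2 * r)⁻¹ • a) x ^ 2 / 4) +
        exp (pairing ((8 * r ^ 3)⁻¹ • b) x ^ 2 / 4)) ∂(bgVec θ n) :=
        integral_mono hi (ia.add ib) fun x => exp_abs_curv_le hr hμ hμ1 q a b x
    _ ≤ 2 + 2 := by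
        rw [integral_add ia ib]
        exact add_le_add (integral_exp_pairing_sq_le h0 h1 ha')
          (integral_exp_pairing_sq_le h0 h1 hb')
    _ = 4 := by norm_num

/-- Admissible triples of base point, velocity and acceleration at scale `r`. -/
def tripleSet (n : ℕ) (r : ℝ) :
    Set (EuclideanSpace ℝ (Fin n) × EuclideanSpace ℝ (Fin n) × EuclideanSpace ℝ (Fin n)) :=
  {z | ‖z.1‖ ≤ 1 ∧ ‖z.2.1‖ ≤ 2 * r ∧ ‖z.2.2‖ ≤ 8 * r ^ 3}

lemma measureReal_exists_curv_le (h0 : 0 ≤ θ) (h1 : θ ≤ 1) {r : ℝ} (hr : 1 ≤ r) (hμ : 0 < μ)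
    (hμ1 : μ ≤ 1) (hp : 0 < p)
    (t : Finset (EuclideanSpace ℝ (Fin n) × EuclideanSpace ℝ (Fin n) × EuclideanSpace ℝ (Fin n)))
    (ht : ∀ z ∈ t, z ∈ tripleSet n r) {η : ℝ} (hη0 : 0 ≤ η) (hη : η ≤ 1) :
    (Measure.pi fun _ : Fin p => bgVec θ n).real
      {x | ∃ z ∈ t, η ≤ |empAvg p (curv μ z.1 z.2.1 z.2.2) x -
        ∫ y, curv μ z.1 z.2.1 z.2.2 y ∂(bgVec θ n)|} ≤
      t.card * (2 * exp (-(p * η ^ 2 / (128 * (32 * r ^ 3 / μ) ^ 2)))) := by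
  have := isProbabilityMeasure_bgVec h0 h1 n
  have hr0 : 0 < r := by linarith
  refine measureReal_exists_finset_le t
    (fun z => {x | η ≤ |empAvg p (curv μ z.1 z.2.1 z.2.2) x -
        ∫ y, curv μ z.1 z.2.1 z.2.2 y ∂(bgVec θ n)|}) fun z hz => ?_
  obtain ⟨i, hle⟩ := integral_exp_abs_curv_le h0 h1 hr hμ hμ1 z.1 (ht z hz).2.1 (ht z hz).2.2
  refine measureReal_abs_empAvg_sub_ge_le (continuous_curv _ _ _).measurable (by positivity) i hle
    hη0 (hη.trans ?_) hp
  rw [le_div_iff₀ hμ]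
  have : 1 ≤ r ^ 3 := one_le_pow₀ hr
  linarith

end events

section uniform

variable {n p : ℕ} {θ μ : ℝ}

/-- Samples with entries bounded by `B` whose empirical covariance is `θ I` up to relative
error `ε`. -/
def regularSample (n p : ℕ) (θ B ε : ℝ) : Set (Fin p → Fin n → ℝ) :=
  {x | (∀ k i, |x k i| ≤ B) ∧ ∀ a : EuclideanSpace ℝ (Fin n),
    |empAvg p (fun y => pairing a y ^ 2) x - θ * ‖a‖ ^ 2| ≤ ε * θ * ‖a‖ ^ 2}

lemma abs_empAvg_pairing_sq_sub_le {x : Fin p → Fin n → ℝ} {B : ℝ} (hB : 0 ≤ B)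
    (h1 : ∀ k i, |x k i| ≤ B) (a c : EuclideanSpace ℝ (Fin n)) :
    |empAvg p (fun y => pairing a y ^ 2) x - empAvg p (fun y => pairing c y ^ 2) x| ≤
      (√n * B) ^ 2 * (‖a - c‖ * ‖a + c‖) := by
  rw [← empAvg_sub]
  refine (abs_empAvg_le _ _).trans ((empAvg_mono fun k => ?_).trans
    (empAvg_const_le (r := (√n * B) ^ 2 * (‖a - c‖ * ‖a + c‖)) (by positivity) x))
  have e : pairing a (x k) ^ 2 - pairing c (x k) ^ 2 =
      pairing (a - c) (x k) * pairing (a + c) (x k) := by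
    rw [pairing_sub_left, pairing_add_left]; ring
  rw [e, abs_mul]
  calc _ ≤ (√n * B * ‖a - c‖) * (√n * B * ‖a + c‖) :=
        mul_le_mul (abs_pairing_le hB (h1 k) _) (abs_pairing_le hB (h1 k) _) (abs_nonneg _)
          (by positivity)
    _ = _ := by ring

lemma empAvg_pairing_sq_of_unit_ball {x : Fin p → Fin n → ℝ} {δ : ℝ}
    (h : ∀ a : EuclideanSpace ℝ (Fin n), ‖a‖ ≤ 1 →
      |empAvg p (fun y => pairing a y ^ 2) x - θ * ‖a‖ ^ 2| ≤ δ) (a : EuclideanSpace ℝ (Fin n)) :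
    |empAvg p (fun y => pairing a y ^ 2) x - θ * ‖a‖ ^ 2| ≤ δ * ‖a‖ ^ 2 := by
  rcases eq_or_ne a 0 with rfl | ha
  · simp [pairing_zero_left, empAvg]
  have ha' : 0 < ‖a‖ := by positivity
  have h1 : ‖‖a‖⁻¹ • a‖ = 1 := by rw [norm_smul, norm_inv, norm_norm, inv_mul_cancel₀ ha'.ne']
  have h2 := h (‖a‖⁻¹ • a) h1.le
  have e : empAvg p (fun y => pairing (‖a‖⁻¹ • a) y ^ 2) x - θ * ‖‖a‖⁻¹ • a‖ ^ 2 =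
      (‖a‖⁻¹) ^ 2 * (empAvg p (fun y => pairing a y ^ 2) x - θ * ‖a‖ ^ 2) := by
    simp only [pairing_smul_left, mul_pow, empAvg_const_mul, norm_smul, norm_inv, norm_norm]
    ring
  rw [e, abs_mul, abs_of_pos (by positivity : 0 < ‖a‖⁻¹ ^ 2), inv_pow,
    inv_mul_le_iff₀ (by positivity)] at h2
  linarith

lemma abs_sub_sq_norm_le (a c : EuclideanSpace ℝ (Fin n)) :
    |‖a‖ ^ 2 - ‖c‖ ^ 2| ≤ ‖a - c‖ * (‖a‖ + ‖c‖) := by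
  have e : ‖a‖ ^ 2 - ‖c‖ ^ 2 = (‖a‖ - ‖c‖) * (‖a‖ + ‖c‖) := by ring
  rw [e, abs_mul, abs_of_nonneg (by positivity : 0 ≤ ‖a‖ + ‖c‖)]
  gcongr
  exact abs_norm_sub_norm_le a c

lemma measureReal_compl_regularSample_le (h0 : 0 < θ) (h1 : θ ≤ 1) (hp : 0 < p) {B ε : ℝ}
    (hB : 0 ≤ B) (hε0 : 0 ≤ ε) (hε : ε ≤ 1)
    (hBp : (√n * B) ^ 2 * (√n * (1 / p) * 2) + θ * (√n * (1 / p) * 2) ≤ ε * θ / 2) :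
    (Measure.pi fun _ : Fin p => bgVec θ n).real (regularSample n p θ B ε)ᶜ ≤
      p * n * (2 * exp (-(B ^ 2 / 4))) +
      (2 * p + 1 : ℝ) ^ n * (2 * exp (-(p * (ε * θ / 2) ^ 2 / (128 * 4 ^ 2)))) := by
  have := isProbabilityMeasure_bgVec h0.le h1 n
  obtain ⟨t, ht, hcard, hnet⟩ := exists_finset_net {a : EuclideanSpace ℝ (Fin n) | ‖a‖ ≤ 1}
    (fun a i => a i) one_pos (fun a ha i => (abs_apply_le_norm a i).trans ha) hp
  have hsub : (regularSample n p θ B ε)ᶜ ⊆ {x | ∃ k i, B ≤ |x k i|} ∪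
      {x | ∃ c ∈ t, ε * θ / 2 ≤ |empAvg p (fun y => pairing c y ^ 2) x - θ * ‖c‖ ^ 2|} := by
    intro x hx
    by_contra hn
    refine hx ?_
    simp only [Set.mem_union, Set.mem_ofPred_eq, not_or, not_exists, not_and, not_le] at hn
    have hb : ∀ k i, |x k i| ≤ B := fun k i => (hn.1 k i).le
    refine ⟨hb, empAvg_pairing_sq_of_unit_ball fun a ha => ?_⟩
    obtain ⟨c, hc, hac⟩ := hnet a ha
    have hc1 : ‖c‖ ≤ 1 := ht c hc
    have hd : ‖a - c‖ ≤ √n * (1 / p) :=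
      norm_le_sqrt_mul_of_forall_abs_le (by positivity) fun i => by simpa using hac i
    have hs : ‖a + c‖ ≤ 2 := (norm_add_le _ _).trans (by linarith [show ‖a‖ ≤ 1 from ha])
    have e1 := abs_empAvg_pairing_sq_sub_le hB hb a c
    have e2 := (hn.2 c hc).le
    have e3 := abs_sub_sq_norm_le a c
    have f1 : (√n * B) ^ 2 * (‖a - c‖ * ‖a + c‖) ≤ (√n * B) ^ 2 * (√n * (1 / p) * 2) := by gcongr
    have f3 : θ * (‖a - c‖ * (‖a‖ + ‖c‖)) ≤ θ * (√n * (1 / p) * 2) := by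
      gcongr
      linarith [show ‖a‖ ≤ 1 from ha]
    have f4 : |θ * ‖a‖ ^ 2 - θ * ‖c‖ ^ 2| ≤ θ * (‖a - c‖ * (‖a‖ + ‖c‖)) := by
      rw [← mul_sub, abs_mul, abs_of_pos h0]; gcongr
    rw [abs_le] at *
    constructor <;> linarith [f4.1, f4.2, e1.1, e1.2, e2.1, e2.2]
  refine (measureReal_mono hsub).trans ((measureReal_union_le _ _).trans ?_)
  refine add_le_add (measureReal_exists_entry_ge_le h0.le h1 hB n p) ?_
  refine (measureReal_exists_pairing_sq_le h0.le h1 hp t ht (by positivity)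
    (by nlinarith)).trans ?_
  gcongr
  exact_mod_cast (by simpa using hcard)

/-- Every triple close to one in `T` has empirical curvature close to an expected curvature
of some triple in `T`. -/
def curvApprox (n p : ℕ) (θ μ δ : ℝ)
    (T : Set (EuclideanSpace ℝ (Fin n) × EuclideanSpace ℝ (Fin n) × EuclideanSpace ℝ (Fin n))) :
    Set (Fin p → Fin n → ℝ) :=
  {x | ∀ z ∈ T, ∀ q' a' b' : EuclideanSpace ℝ (Fin n), ‖q' - z.1‖ ≤ δ * ‖z.1‖ →
    ‖a' - z.2.1‖ ≤ δ * ‖z.2.1‖ → ‖b' - z.2.2‖ ≤ δ * ‖z.2.2‖ →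
    ∃ z' ∈ T, |empAvg p (curv μ q' a' b') x - ∫ y, curv μ z'.1 z'.2.1 z'.2.2 y ∂(bgVec θ n)| ≤
      θ / 100}

lemma curv_perturbation_le {r L δ : ℝ} (hr : 1 ≤ r) (hL : 1 ≤ L) (hδ0 : 0 ≤ δ) (hμ : 0 < μ)
    (hμθ : μ ≤ θ) (hμ1 : μ ≤ 1) (hδ : 100000 * (r ^ 3 * L * δ) ≤ μ ^ 2) :
    2 * μ⁻¹ ^ 2 * (r * (7 * L) * (2 * δ)) * (2 * θ * (2 * r) ^ 2) +
      μ⁻¹ * (2 * θ * (3 * r * δ * (7 * r))) + μ⁻¹ * (2 * θ * (2 * δ * (8 * r ^ 3))) +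
      9 * r ^ 3 * δ ≤ θ / 200 := by
  have hθ : 0 < θ := hμ.trans_le hμθ
  have hr0 : 0 < r := by linarith
  have h1 : r ^ 3 * δ ≤ r ^ 3 * L * δ := by
    have : 0 ≤ r ^ 3 * δ := by positivity
    nlinarith
  have h2 : r ^ 2 * δ ≤ r ^ 3 * δ := by
    gcongr
    norm_num
  set D := r ^ 3 * L * δ with hD
  have hμ2 : μ ^ 2 ≤ μ := by nlinarith
  have i1 : 2 * μ⁻¹ ^ 2 * (r * (7 * L) * (2 * δ)) * (2 * θ * (2 * r) ^ 2) =
      224 * θ * (D / μ ^ 2) := by rw [hD]; field_simp; ring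
  have hDq : D / μ ^ 2 ≤ 1 / 100000 := by rw [div_le_iff₀ (by positivity)]; linarith
  have hDm : μ⁻¹ * D ≤ 1 / 100000 := by
    rw [inv_mul_le_iff₀ hμ]; linarith
  have i2 : μ⁻¹ * (2 * θ * (3 * r * δ * (7 * r))) = 42 * θ * (μ⁻¹ * (r ^ 2 * δ)) := by ring
  have i3 : μ⁻¹ * (2 * θ * (2 * δ * (8 * r ^ 3))) = 32 * θ * (μ⁻¹ * (r ^ 3 * δ)) := by ring
  have k2 : μ⁻¹ * (r ^ 2 * δ) ≤ μ⁻¹ * D := by gcongr; linarith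
  have k3 : μ⁻¹ * (r ^ 3 * δ) ≤ μ⁻¹ * D := by gcongr
  have j1 : 224 * θ * (D / μ ^ 2) ≤ 224 * θ * (1 / 100000) := by gcongr
  have j2 : 42 * θ * (μ⁻¹ * (r ^ 2 * δ)) ≤ 42 * θ * (1 / 100000) := by
    gcongr; linarith
  have j3 : 32 * θ * (μ⁻¹ * (r ^ 3 * δ)) ≤ 32 * θ * (1 / 100000) := by
    gcongr; linarith
  rw [i1, i2, i3]
  linarith

lemma measureReal_regularSample_diff_curvApprox_le (h0 : 0 < θ) (h1 : θ ≤ 1 / 2) (hn : 0 < n)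
    (hμ : 0 < μ) (hμθ : μ ≤ θ) (hp : 0 < p) {L ε δ : ℝ} (hL : 1 ≤ L) (hε : ε ≤ 1)
    (hδ0 : 0 ≤ δ) (hδ1 : δ ≤ 1) (hδ : 100000 * (√n ^ 3 * L * δ) ≤ μ ^ 2)
    (hδp : √n * (8 * √n ^ 3 / p) ≤ δ)
    {T : Set (EuclideanSpace ℝ (Fin n) × EuclideanSpace ℝ (Fin n) × EuclideanSpace ℝ (Fin n))}
    (hT : T ⊆ tripleSet n √n) :
    (Measure.pi fun _ : Fin p => bgVec θ n).real
      (regularSample n p θ (7 * L) ε \ curvApprox n p θ μ δ T) ≤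
      (2 * p + 1 : ℝ) ^ (3 * n) *
        (2 * exp (-(p * (θ / 200) ^ 2 / (128 * (32 * √n ^ 3 / μ) ^ 2)))) := by
  have := isProbabilityMeasure_bgVec h0.le (h1.trans (by norm_num)) n
  have hr : 1 ≤ √(n : ℝ) := by
    rw [Real.one_le_sqrt]; exact_mod_cast hn
  have hr3 : √(n : ℝ) ≤ √(n : ℝ) ^ 3 := le_self_pow₀ hr (by norm_num)
  have hμ1 : μ ≤ 1 := by linarith
  obtain ⟨t, ht, hcard, hnet⟩ := exists_finset_net T
    (fun z => Sum.elim (fun i => z.1 i) (Sum.elim (fun i => z.2.1 i) (fun i => z.2.2 i)) :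
      _ → Fin n ⊕ Fin n ⊕ Fin n → ℝ) (R := 8 * √n ^ 3) (by positivity)
    (fun z hz i => by
      have h := hT hz
      rcases i with i | i | i
      · exact (abs_apply_le_norm _ i).trans (h.1.trans (by linarith))
      · exact (abs_apply_le_norm _ i).trans (h.2.1.trans (by linarith))
      · exact (abs_apply_le_norm _ i).trans h.2.2) hp
  have hsub : regularSample n p θ (7 * L) ε \ curvApprox n p θ μ δ T ⊆
      {x | ∃ z ∈ t, θ / 200 ≤ |empAvg p (curv μ z.1 z.2.1 z.2.2) x -
        ∫ y, curv μ z.1 z.2.1 z.2.2 y ∂(bgVec θ n)|} := by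
    rintro x ⟨⟨hb, hcov⟩, hx⟩
    by_contra hcon
    simp only [Set.mem_ofPred_eq, not_exists, not_and, not_le] at hcon
    refine hx fun z hz q' a' b' hq ha hb' => ?_
    obtain ⟨y, hy, hzy⟩ := hnet z hz
    have hyT := hT (ht y hy)
    have hzT := hT hz
    refine ⟨y, ht y hy, ?_⟩
    have d1 : ‖z.1 - y.1‖ ≤ δ := (norm_le_sqrt_mul_of_forall_abs_le (by positivity)
      fun i => by simpa using hzy (Sum.inl i)).trans hδp
    have d2 : ‖z.2.1 - y.2.1‖ ≤ δ := (norm_le_sqrt_mul_of_forall_abs_le (by positivity)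
      fun i => by simpa using hzy (Sum.inr (Sum.inl i))).trans hδp
    have d3 : ‖z.2.2 - y.2.2‖ ≤ δ := (norm_le_sqrt_mul_of_forall_abs_le (by positivity)
      fun i => by simpa using hzy (Sum.inr (Sum.inr i))).trans hδp
    have hr3' : 1 ≤ √(n : ℝ) ^ 3 := one_le_pow₀ hr
    have e1 : ‖y.1 - q'‖ ≤ 2 * δ := by
      have : ‖y.1 - q'‖ ≤ ‖z.1 - y.1‖ + ‖q' - z.1‖ := by
        rw [norm_sub_rev z.1, norm_sub_rev q']; exact norm_sub_le_norm_sub_add_norm_sub _ _ _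
      have : δ * ‖z.1‖ ≤ δ * 1 := by gcongr; exact hzT.1
      linarith
    have e2 : ‖y.2.1 - a'‖ ≤ 3 * √n * δ := by
      have : ‖y.2.1 - a'‖ ≤ ‖z.2.1 - y.2.1‖ + ‖a' - z.2.1‖ := by
        rw [norm_sub_rev z.2.1, norm_sub_rev a']; exact norm_sub_le_norm_sub_add_norm_sub _ _ _
      have : δ * ‖z.2.1‖ ≤ δ * (2 * √n) := by gcongr; exact hzT.2.1
      nlinarith
    have e3 : ‖y.2.2 - b'‖ ≤ 9 * √n ^ 3 * δ := by
      have : ‖y.2.2 - b'‖ ≤ ‖z.2.2 - y.2.2‖ + ‖b' - z.2.2‖ := by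
        rw [norm_sub_rev z.2.2, norm_sub_rev b']; exact norm_sub_le_norm_sub_add_norm_sub _ _ _
      have : δ * ‖z.2.2‖ ≤ δ * (8 * √n ^ 3) := by gcongr; exact hzT.2.2
      nlinarith
    have e4 : ‖y.2.1 + a'‖ ≤ 7 * √n := by
      have h5 : ‖y.2.1 + a'‖ ≤ ‖y.2.1‖ + ‖y.2.1‖ + ‖y.2.1 - a'‖ := by
        have : y.2.1 + a' = y.2.1 + y.2.1 - (y.2.1 - a') := by abel
        rw [this]
        exact (norm_sub_le _ _).trans (by gcongr; exact norm_add_le _ _)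
      have := hyT.2.1
      nlinarith
    have hpert := abs_empAvg_curv_sub_le h1 hμ (by positivity : 0 ≤ 7 * L) hb
      (fun c => by
        have := (abs_le.1 (hcov c)).2
        have : ε * θ * ‖c‖ ^ 2 ≤ 1 * θ * ‖c‖ ^ 2 := by gcongr
        linarith) y.1 y.2.1 y.2.2 q' a' b'
    have hfin := curv_perturbation_le hr hL hδ0 hμ hμθ hμ1 hδ
    have g : 2 * μ⁻¹ ^ 2 * (√n * (7 * L) * ‖y.1 - q'‖) * (2 * θ * ‖y.2.1‖ ^ 2) +
      μ⁻¹ * (2 * θ * (‖y.2.1 - a'‖ * ‖y.2.1 + a'‖)) +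
      μ⁻¹ * (2 * θ * (‖y.1 - q'‖ * ‖y.2.2‖)) + ‖y.2.2 - b'‖ ≤
      2 * μ⁻¹ ^ 2 * (√n * (7 * L) * (2 * δ)) * (2 * θ * (2 * √n) ^ 2) +
      μ⁻¹ * (2 * θ * (3 * √n * δ * (7 * √n))) + μ⁻¹ * (2 * θ * (2 * δ * (8 * √n ^ 3))) +
      9 * √n ^ 3 * δ := by
      have := hyT.2.1
      have := hyT.2.2
      gcongr
    have hbern := (hcon y hy).le
    rw [abs_le] at *
    constructor <;> linarith [hpert.1, hpert.2, hbern.1, hbern.2]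
  refine (measureReal_mono hsub).trans ?_
  refine (measureReal_exists_curv_le h0.le (h1.trans (by norm_num)) hr hμ hμ1 hp t
    (fun z hz => hT (ht z hz)) (by positivity) (by linarith)).trans ?_
  gcongr
  have hc : Fintype.card (Fin n ⊕ Fin n ⊕ Fin n) = 3 * n := by simp; ring
  rw [hc] at hcard
  exact_mod_cast hcard

end uniform

section preconditioning

lemma norm_apply_le_of_eigenvalues {E : Type*} [NormedAddCommGroup E] [InnerProductSpace ℝ E]
    [FiniteDimensional ℝ E] {D : E →ₗ[ℝ] E} (hD : D.IsSymmetric) {d : ℝ} (hd : 0 ≤ d)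
    (h : ∀ (c : ℝ) (x : E), ‖x‖ = 1 → D x = c • x → |c| ≤ d) (x : E) : ‖D x‖ ≤ d * ‖x‖ := by
  set b := hD.eigenvectorBasis rfl
  have hev : ∀ i, |hD.eigenvalues rfl i| ≤ d := fun i =>
    h _ (b i) (b.norm_eq_one i) (hD.apply_eigenvectorBasis rfl i)
  refine le_of_sq_le_sq ?_ (by positivity)
  rw [← b.repr.norm_map (D x), ← b.repr.norm_map x, mul_pow, EuclideanSpace.real_norm_sq_eq,
    EuclideanSpace.real_norm_sq_eq, Finset.mul_sum]
  refine Finset.sum_le_sum fun i _ => ?_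
  have e : (b.repr (D x)) i = hD.eigenvalues rfl i * b.repr x i := by
    simpa using hD.eigenvectorBasis_apply_self_apply rfl x i
  rw [e, mul_pow, ← sq_abs (hD.eigenvalues rfl i)]
  gcongr
  exact hev i

/-- Perturbation bound for positive square roots. -/
lemma norm_sub_apply_le_of_abs_sub_sq_le {E : Type*} [NormedAddCommGroup E]
    [InnerProductSpace ℝ E] [FiniteDimensional ℝ E] {T D : E →ₗ[ℝ] E} (hT : T.IsSymmetric)
    (hD : D.IsSymmetric) {m η : ℝ} (hm : 0 < m) (hη : 0 ≤ η) (hT0 : ∀ x, 0 ≤ ⟪x, T x⟫)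
    (hD0 : ∀ x, m * ‖x‖ ^ 2 ≤ ⟪x, D x⟫) (h : ∀ x, |‖T x‖ ^ 2 - ‖D x‖ ^ 2| ≤ η * ‖x‖ ^ 2) (x : E) :
    ‖T x - D x‖ ≤ η / m * ‖x‖ := by
  rw [← LinearMap.sub_apply]
  refine norm_apply_le_of_eigenvalues (hT.sub hD) (by positivity) (fun c x hx hc => ?_) x
  rw [LinearMap.sub_apply] at hc
  have e : ‖T x‖ ^ 2 - ‖D x‖ ^ 2 = c * (⟪x, T x⟫ + ⟪x, D x⟫) := by
    have : ‖T x‖ ^ 2 - ‖D x‖ ^ 2 = ⟪T x - D x, T x + D x⟫ := by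
      rw [inner_sub_left, inner_add_right, inner_add_right, real_inner_self_eq_norm_sq,
        real_inner_self_eq_norm_sq, real_inner_comm (T x) (D x)]
      ring
    rw [this, hc, real_inner_smul_left, inner_add_right]
  have h1 := h x
  have h2 := hD0 x
  have h3 := hT0 x
  rw [hx] at h2
  rw [e, abs_mul, hx, abs_of_nonneg (a := ⟪x, T x⟫ + ⟪x, D x⟫) (by nlinarith)] at h1
  rw [le_div_iff₀ hm]
  calc |c| * m ≤ |c| * (⟪x, T x⟫ + ⟪x, D x⟫) := by gcongr; linarith
    _ ≤ _ := by linarith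

variable {n p : ℕ} {θ : ℝ}

lemma norm_toLp_sq (x : Fin n → ℝ) :
    ‖(WithLp.toLp 2 x : EuclideanSpace ℝ (Fin n))‖ ^ 2 = x ⬝ᵥ x := by
  rw [EuclideanSpace.real_norm_sq_eq]
  simp [dotProduct, sq]

lemma inner_toLp (x y : Fin n → ℝ) :
    ⟪(WithLp.toLp 2 x : EuclideanSpace ℝ (Fin n)), WithLp.toLp 2 y⟫ = x ⬝ᵥ y := by
  simp [PiLp.inner_apply, dotProduct, mul_comm]

lemma norm_toLp_mulVec_of_orthogonal {V : Matrix (Fin n) (Fin n) ℝ} (hV : V * Vᵀ = 1)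
    (x : Fin n → ℝ) :
    ‖(WithLp.toLp 2 (V *ᵥ x) : EuclideanSpace ℝ (Fin n))‖ =
      ‖(WithLp.toLp 2 x : EuclideanSpace ℝ (Fin n))‖ := by
  refine (sq_eq_sq₀ (norm_nonneg _) (norm_nonneg _)).1 ?_
  rw [norm_toLp_sq, norm_toLp_sq, dotProduct_mulVec, vecMul_mulVec, ← dotProduct_mulVec,
    mul_eq_one_comm.1 hV, one_mulVec]

lemma empAvg_pairing_sq_eq (X : Matrix (Fin n) (Fin p) ℝ) (c : Fin n → ℝ) :
    empAvg p (fun y => pairing (WithLp.toLp 2 c) y ^ 2) (fun k i => X i k) =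
      (p : ℝ)⁻¹ * ((Xᵀ *ᵥ c) ⬝ᵥ (Xᵀ *ᵥ c)) := by
  simp [empAvg, pairing, dotProduct, mulVec, sq, mul_comm]

/-- Spectral preconditioning of data with nearly isotropic covariance is close to the
orthogonal polar factor. -/
lemma norm_precondition_sub_le {A₀ U V S : Matrix (Fin n) (Fin n) ℝ} {s : Fin n → ℝ}
    {X : Matrix (Fin n) (Fin p) ℝ} {ε a b : ℝ} (hp : 0 < p) (hθ : 0 < θ) (hU : U * Uᵀ = 1)
    (hV : V * Vᵀ = 1) (ha : 0 < a) (hsa : ∀ i, a ≤ s i) (hsb : ∀ i, s i ≤ b)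
    (hA : A₀ = U * diagonal s * Vᵀ) (hS : S.PosDef) (hSS : S * S = A₀ * X * (A₀ * X)ᵀ)
    (hε0 : 0 ≤ ε) (hε : ε ≤ 1 / 2)
    (hcov : ∀ c : EuclideanSpace ℝ (Fin n),
      |empAvg p (fun y => pairing c y ^ 2) (fun k i => X i k) - θ * ‖c‖ ^ 2| ≤ ε * θ * ‖c‖ ^ 2)
    (c : EuclideanSpace ℝ (Fin n)) :
    ‖(WithLp.toLp 2 ((√(p * θ) • (V * Uᵀ * S⁻¹ * A₀))ᵀ *ᵥ c) : EuclideanSpace ℝ (Fin n)) - c‖ ≤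
      2 * ε * (b / a) ^ 2 * ‖c‖ := by
  have hU' : Uᵀ * U = 1 := mul_eq_one_comm.1 hU
  have hV' : Vᵀ * V = 1 := mul_eq_one_comm.1 hV
  have hpθ : 0 < (p : ℝ) * θ := by positivity
  set ρ := √((p : ℝ) * θ) with hρ
  have hρ0 : 0 < ρ := Real.sqrt_pos.2 hpθ
  have hρ2 : ρ ^ 2 = p * θ := Real.sq_sqrt hpθ.le
  have hSt : Sᵀ = S := by simpa [IsHermitian] using hS.isHermitian.eq
  have hSu : IsUnit S.det := hS.isUnit.map detMonoidHom
  set T : Matrix (Fin n) (Fin n) ℝ := ρ⁻¹ • (Uᵀ * S * U) with hT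
  have hTt : Tᵀ = T := by simp [hT, transpose_mul, hSt, mul_assoc]
  have hTsym : (toEuclideanLin T).IsSymmetric :=
    isSymmetric_toEuclideanLin_iff.2 (by simpa [IsHermitian] using hTt)
  have hDsym : (toEuclideanLin (diagonal s)).IsSymmetric :=
    isSymmetric_toEuclideanLin_iff.2 (by simp [IsHermitian])
  have hDn : ∀ x : EuclideanSpace ℝ (Fin n),
      ‖toEuclideanLin (diagonal s) x‖ ^ 2 = ∑ i, s i ^ 2 * x i ^ 2 := fun x => by
    rw [EuclideanSpace.real_norm_sq_eq]
    simp [toLpLin_apply, mulVec_diagonal, mul_pow]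
  have hDlow : ∀ x : EuclideanSpace ℝ (Fin n),
      a ^ 2 * ‖x‖ ^ 2 ≤ ‖toEuclideanLin (diagonal s) x‖ ^ 2 := fun x => by
    rw [hDn, EuclideanSpace.real_norm_sq_eq, Finset.mul_sum]
    gcongr with i
    exact hsa i
  have hDup : ∀ x : EuclideanSpace ℝ (Fin n),
      ‖toEuclideanLin (diagonal s) x‖ ^ 2 ≤ b ^ 2 * ‖x‖ ^ 2 := fun x => by
    rw [hDn, EuclideanSpace.real_norm_sq_eq, Finset.mul_sum]
    gcongr with i
    · exact ha.le.trans (hsa i)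
    · exact hsb i
  have hTn : ∀ x : EuclideanSpace ℝ (Fin n),
      |‖toEuclideanLin T x‖ ^ 2 - ‖toEuclideanLin (diagonal s) x‖ ^ 2| ≤
        ε * ‖toEuclideanLin (diagonal s) x‖ ^ 2 := fun x => by
    have h1 := hcov (WithLp.toLp 2 (V *ᵥ (diagonal s *ᵥ x)))
    rw [empAvg_pairing_sq_eq, norm_toLp_mulVec_of_orthogonal hV] at h1
    have h2 : ‖toEuclideanLin T x‖ ^ 2 = θ⁻¹ * ((p : ℝ)⁻¹ *
        ((Xᵀ *ᵥ (V *ᵥ (diagonal s *ᵥ x))) ⬝ᵥ (Xᵀ *ᵥ (V *ᵥ (diagonal s *ᵥ x))))) := by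
      have hm : Tᵀ * T = (θ⁻¹ * (p : ℝ)⁻¹) •
          ((Xᵀ * V * diagonal s)ᵀ * (Xᵀ * V * diagonal s)) := by
        have hK : Tᵀ * T = (ρ⁻¹ * ρ⁻¹) • (Uᵀ * (S * S) * U) := by
          rw [hTt, hT, smul_mul_smul_comm]
          congr 1
          calc Uᵀ * S * U * (Uᵀ * S * U) = Uᵀ * S * (U * Uᵀ) * S * U := by
                simp only [mul_assoc]
            _ = _ := by rw [hU]; simp only [mul_assoc, mul_one]
        have hA' : Uᵀ * A₀ = diagonal s * Vᵀ := by
          rw [hA, mul_assoc U, ← mul_assoc, hU', one_mul]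
        have hA'' : A₀ᵀ * U = V * diagonal s := by
          have := congrArg transpose hA'
          simpa [transpose_mul] using this
        rw [hK, hSS]
        have hc : ρ⁻¹ * ρ⁻¹ = θ⁻¹ * (p : ℝ)⁻¹ := by
          rw [← mul_inv, ← sq, hρ2, mul_inv, mul_comm]
        rw [hc]
        congr 1
        calc Uᵀ * (A₀ * X * (A₀ * X)ᵀ) * U = (Uᵀ * A₀) * X * (Xᵀ * (A₀ᵀ * U)) := by
              simp only [transpose_mul, Matrix.mul_assoc]
          _ = _ := by
              rw [hA', hA'']
              simp only [transpose_mul, transpose_transpose, diagonal_transpose, Matrix.mul_assoc]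
      rw [toLpLin_apply, norm_toLp_sq, dotProduct_mulVec, vecMul_mulVec, hm, ← dotProduct_mulVec,
        smul_mulVec, dotProduct_smul, mulVec_mulVec, mulVec_mulVec, smul_eq_mul, mul_assoc]
      congr 2
      rw [dotProduct_mulVec (_ *ᵥ x.ofLp), vecMul_mulVec, ← dotProduct_mulVec,
        Matrix.mul_assoc Xᵀ]
    rw [h2]
    have h3 : toEuclideanLin (diagonal s) x = WithLp.toLp 2 (diagonal s *ᵥ x) := rfl
    rw [h3]
    set N := ‖(WithLp.toLp 2 (diagonal s *ᵥ x) : EuclideanSpace ℝ (Fin n))‖ ^ 2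
    set Q := (p : ℝ)⁻¹ *
        ((Xᵀ *ᵥ (V *ᵥ (diagonal s *ᵥ x))) ⬝ᵥ (Xᵀ *ᵥ (V *ᵥ (diagonal s *ᵥ x))))
    have h4 : θ⁻¹ * Q - N = θ⁻¹ * (Q - θ * N) := by field_simp
    rw [h4, abs_mul, abs_of_pos (by positivity : 0 < θ⁻¹), inv_mul_le_iff₀ hθ]
    linarith
  have hTpos : ∀ x : EuclideanSpace ℝ (Fin n), 0 ≤ ⟪x, toEuclideanLin T x⟫ := fun x => by
    have h1 := hS.posSemidef.dotProduct_mulVec_nonneg (U *ᵥ x)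
    have h2 : ⟪x, toEuclideanLin T x⟫ = ρ⁻¹ * (star (U *ᵥ x.ofLp) ⬝ᵥ S *ᵥ (U *ᵥ x.ofLp)) := by
      rw [toLpLin_apply]
      have := inner_toLp x.ofLp (T *ᵥ x.ofLp)
      rw [WithLp.toLp_ofLp] at this
      rw [this, hT, smul_mulVec, dotProduct_smul, smul_eq_mul, star_trivial, ← mulVec_mulVec,
        ← mulVec_mulVec, dotProduct_mulVec, vecMul_transpose]
    rw [h2]
    positivity
  have hDinner : ∀ x : EuclideanSpace ℝ (Fin n),
      a * ‖x‖ ^ 2 ≤ ⟪x, toEuclideanLin (diagonal s) x⟫ := fun x => by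
    have : ⟪x, toEuclideanLin (diagonal s) x⟫ = ∑ i, s i * x i ^ 2 := by
      simp only [PiLp.inner_apply, toLpLin_apply, mulVec_diagonal, RCLike.inner_apply,
        conj_trivial]
      exact Finset.sum_congr rfl fun i _ => by ring
    rw [this, EuclideanSpace.real_norm_sq_eq, Finset.mul_sum]
    gcongr with i
    exact hsa i
  have hDiff := norm_sub_apply_le_of_abs_sub_sq_le hTsym hDsym ha (η := ε * b ^ 2) (by positivity)
    hTpos hDinner fun x => (hTn x).trans (by
      rw [mul_assoc]; gcongr; exact hDup x)
  set z : Fin n → ℝ := ρ • (Uᵀ *ᵥ (S⁻¹ *ᵥ (U *ᵥ (Vᵀ *ᵥ c)))) with hz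
  have hTz : T *ᵥ z = Vᵀ *ᵥ c := by
    rw [hT, hz, smul_mulVec, mulVec_smul, smul_smul, inv_mul_cancel₀ hρ0.ne', one_smul]
    simp only [mulVec_mulVec]
    congr 1
    calc Uᵀ * S * U * (Uᵀ * (S⁻¹ * (U * Vᵀ))) = Uᵀ * S * (U * Uᵀ) * S⁻¹ * (U * Vᵀ) := by
          simp only [mul_assoc]
      _ = Uᵀ * (S * S⁻¹) * (U * Vᵀ) := by rw [hU]; simp only [mul_assoc, mul_one]
      _ = Vᵀ := by rw [mul_nonsing_inv _ hSu, mul_one, ← mul_assoc, hU', one_mul]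
  have hMz : (√(p * θ) • (V * Uᵀ * S⁻¹ * A₀))ᵀ *ᵥ c.ofLp = V *ᵥ (diagonal s *ᵥ z) := by
    rw [← hρ, hz, mulVec_smul, mulVec_smul, transpose_smul, smul_mulVec]
    congr 1
    simp only [mulVec_mulVec]
    congr 1
    have hSi : S⁻¹ᵀ = S⁻¹ := by rw [transpose_nonsing_inv, hSt]
    simp only [hA, transpose_mul, transpose_transpose, hSi, diagonal_transpose, mul_assoc]
  have hVV : V *ᵥ (T *ᵥ z) = c.ofLp := by rw [hTz, mulVec_mulVec, hV, one_mulVec]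
  have hmain : ‖(WithLp.toLp 2 ((√(p * θ) • (V * Uᵀ * S⁻¹ * A₀))ᵀ *ᵥ c) :
      EuclideanSpace ℝ (Fin n)) - c‖ =
      ‖toEuclideanLin T (WithLp.toLp 2 z) - toEuclideanLin (diagonal s) (WithLp.toLp 2 z)‖ := by
    rw [hMz, norm_sub_rev]
    have : c = WithLp.toLp 2 (V *ᵥ (T *ᵥ z)) := by rw [hVV]
    conv_lhs => rw [this]
    rw [← WithLp.toLp_sub, ← mulVec_sub, norm_toLp_mulVec_of_orthogonal hV]
    rfl
  rw [hmain]
  refine (hDiff _).trans ?_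
  have hznorm : a * ‖(WithLp.toLp 2 z : EuclideanSpace ℝ (Fin n))‖ ≤ 2 * ‖c‖ := by
    have h1 := (abs_le.1 (hTn (WithLp.toLp 2 z))).1
    have h2 := hDlow (WithLp.toLp 2 z)
    have h3 : ‖toEuclideanLin T (WithLp.toLp 2 z)‖ = ‖c‖ := by
      have : toEuclideanLin T (WithLp.toLp 2 z) = WithLp.toLp 2 (T *ᵥ z) := rfl
      rw [this, ← norm_toLp_mulVec_of_orthogonal hV, hVV]
    rw [h3] at h1
    refine le_of_sq_le_sq ?_ (by positivity)
    set N := ‖toEuclideanLin (diagonal s) (WithLp.toLp 2 z)‖ ^ 2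
    have : ε * N ≤ 1 / 2 * N := by gcongr
    nlinarith
  calc ε * b ^ 2 / a * ‖(WithLp.toLp 2 z : EuclideanSpace ℝ (Fin n))‖
      = ε * (b / a) ^ 2 * (a * ‖(WithLp.toLp 2 z : EuclideanSpace ℝ (Fin n))‖) := by
        field_simp
    _ ≤ ε * (b / a) ^ 2 * (2 * ‖c‖) := by gcongr
    _ = _ := by ring

end preconditioning

section derivatives

variable {n p : ℕ} {μ : ℝ}

/-- The embedding of `ℝ^{n-1}` into `ℝ^n` with vanishing last coordinate. -/
def padZero (n : ℕ) : EuclideanSpace ℝ (Fin (n - 1)) →ₗ[ℝ] EuclideanSpace ℝ (Fin n) where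
  toFun w := WithLp.toLp 2 fun i => if h : (i : ℕ) < n - 1 then w ⟨i, h⟩ else 0
  map_add' v w := by ext i; by_cases h : (i : ℕ) < n - 1 <;> simp [h]
  map_smul' c w := by ext i; by_cases h : (i : ℕ) < n - 1 <;> simp [h]

lemma padZero_apply (w : EuclideanSpace ℝ (Fin (n - 1))) (i : Fin n) :
    padZero n w i = if h : (i : ℕ) < n - 1 then w ⟨i, h⟩ else 0 := rfl

variable {j : Fin n}

lemma padZero_apply_last (hj : (j : ℕ) = n - 1) (w : EuclideanSpace ℝ (Fin (n - 1))) :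
    padZero n w j = 0 := by simp [padZero_apply, hj]

lemma norm_padZero (w : EuclideanSpace ℝ (Fin (n - 1))) : ‖padZero n w‖ = ‖w‖ := by
  refine (sq_eq_sq₀ (norm_nonneg _) (norm_nonneg _)).1 ?_
  rw [EuclideanSpace.real_norm_sq_eq, EuclideanSpace.real_norm_sq_eq]
  rcases n with _ | m
  · simp
  · have hc : ∀ i : Fin m, padZero (m + 1) w i.castSucc = w i := fun i => by
      rw [padZero_apply, dif_pos (show (i.castSucc : ℕ) < m + 1 - 1 by simp)]
      rfl
    have hl : padZero (m + 1) w (Fin.last m) = 0 := padZero_apply_last (by simp) w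
    rw [Fin.sum_univ_castSucc, hl]
    simp only [hc]
    simp

lemma sum_qmap_mul (hj : (j : ℕ) = n - 1) (w : EuclideanSpace ℝ (Fin (n - 1)))
    (y : Fin n → ℝ) :
    ∑ i, qmap n w i * y i =
      pairing (padZero n w + √(1 - ‖w‖ ^ 2) • EuclideanSpace.single j 1) y := by
  refine Finset.sum_congr rfl fun i _ => ?_
  congr 1
  have hi := i.2
  by_cases h : (i : ℕ) < n - 1
  · have : i ≠ j := fun e => by rw [e] at h; omega
    simp [qmap, padZero_apply, h, this]
  · have : i = j := Fin.ext (by omega)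
    subst this
    simp [qmap, padZero_apply, h]

lemma gfun_eq (hj : (j : ℕ) = n - 1) (Y : Matrix (Fin n) (Fin p) ℝ) :
    gfun n p μ Y = fun w => (p : ℝ)⁻¹ * ∑ k : Fin p,
      hmu μ (pairing (padZero n w) (fun i => Y i k) + √(1 - ‖w‖ ^ 2) * Y j k) := by
  ext w
  unfold gfun
  congr 1
  refine Finset.sum_congr rfl fun k _ => ?_
  rw [sum_qmap_mul hj w fun i => Y i k, pairing_add_left, pairing_smul_left, pairing_single]

lemma contDiff_hmu (μ : ℝ) : ContDiff ℝ 2 (hmu μ) := by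
  unfold hmu
  refine contDiff_const.mul (ContDiff.log ?_ fun z => (cosh_pos _).ne')
  exact Real.contDiff_cosh.comp (contDiff_id.div_const μ)

lemma contDiff_pairing_padZero (y : Fin n → ℝ) :
    ContDiff ℝ 2 fun w : EuclideanSpace ℝ (Fin (n - 1)) => pairing (padZero n w) y := by
  have : (fun w : EuclideanSpace ℝ (Fin (n - 1)) => pairing (padZero n w) y) =
      fun w => ⟪LinearMap.toContinuousLinearMap (padZero n) w, WithLp.toLp 2 y⟫ := by
    ext w; simp [pairing_eq_inner]
  rw [this]
  exact (LinearMap.toContinuousLinearMap (padZero n)).contDiff.inner ℝ contDiff_const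

lemma contDiffAt_gfun (hn : 0 < n) (Y : Matrix (Fin n) (Fin p) ℝ)
    {w : EuclideanSpace ℝ (Fin (n - 1))} (hw : ‖w‖ < 1) : ContDiffAt ℝ 2 (gfun n p μ Y) w := by
  rw [gfun_eq (j := ⟨n - 1, by omega⟩) rfl]
  refine contDiffAt_const.mul (ContDiffAt.sum fun k _ => ?_)
  refine (contDiff_hmu μ).contDiffAt.comp w ?_
  refine (contDiff_pairing_padZero _).contDiffAt.add (ContDiffAt.mul ?_ contDiffAt_const)
  refine ContDiffAt.sqrt (contDiffAt_const.sub (contDiff_norm_sq ℝ).contDiffAt) ?_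
  nlinarith [norm_nonneg w]

lemma hasDerivAt_norm_sq_line (w v : EuclideanSpace ℝ (Fin (n - 1))) :
    HasDerivAt (fun t : ℝ => ‖w + t • v‖ ^ 2) (2 * ⟪w, v⟫) 0 := by
  have e : (fun t : ℝ => ‖w + t • v‖ ^ 2) =
      fun t => ‖w‖ ^ 2 + t * (2 * ⟪w, v⟫) + t ^ 2 * ‖v‖ ^ 2 := by
    ext t
    rw [norm_add_sq_real, real_inner_smul_right, norm_smul, mul_pow, Real.norm_eq_abs, sq_abs]
    ring
  rw [e]
  exact ((((hasDerivAt_id (0 : ℝ)).mul_const _).const_add _).add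
    (((hasDerivAt_id (0 : ℝ)).pow 2).mul_const _)).congr_deriv (by simp)

lemma hasDerivAt_sqrt_line {w : EuclideanSpace ℝ (Fin (n - 1))} (hw : ‖w‖ < 1)
    (v : EuclideanSpace ℝ (Fin (n - 1))) :
    HasDerivAt (fun t : ℝ => √(1 - ‖w + t • v‖ ^ 2)) (-(⟪w, v⟫ / √(1 - ‖w‖ ^ 2))) 0 := by
  have h0 : 1 - ‖w‖ ^ 2 ≠ 0 := by nlinarith [norm_nonneg w]
  have h := ((hasDerivAt_norm_sq_line w v).const_sub 1).sqrt (by simpa using h0)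
  refine h.congr_deriv ?_
  simp only [zero_smul, add_zero]
  rw [neg_div, mul_div_mul_left _ _ two_ne_zero]


lemma hasDerivAt_residual_line {w : EuclideanSpace ℝ (Fin (n - 1))} (hw : ‖w‖ < 1)
    (v : EuclideanSpace ℝ (Fin (n - 1))) (y : Fin n → ℝ) (b : ℝ) :
    HasDerivAt (fun t : ℝ => pairing (padZero n (w + t • v)) y + √(1 - ‖w + t • v‖ ^ 2) * b)
      (pairing (padZero n v) y + -(⟪w, v⟫ / √(1 - ‖w‖ ^ 2)) * b) 0 := by
  have e : (fun t : ℝ => pairing (padZero n (w + t • v)) y) =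
      fun t => pairing (padZero n w) y + t * pairing (padZero n v) y := by
    ext t
    rw [map_add, map_smul, pairing_add_left, pairing_smul_left]
  have h : HasDerivAt (fun t : ℝ => pairing (padZero n (w + t • v)) y)
      (pairing (padZero n v) y) 0 := by
    rw [e]
    exact (((hasDerivAt_id (0 : ℝ)).mul_const _).const_add _).congr_deriv (by simp)
  exact h.add ((hasDerivAt_sqrt_line hw v).mul_const b)

lemma inner_gradient_eq_of_hasDerivAt {E : Type*} [NormedAddCommGroup E] [InnerProductSpace ℝ E]
    [CompleteSpace E] {f : E → ℝ} {w v : E} (hf : DifferentiableAt ℝ f w) {d : ℝ}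
    (h : HasDerivAt (fun t : ℝ => f (w + t • v)) d 0) : ⟪gradient f w, v⟫ = d := by
  have hl : HasDerivAt (fun t : ℝ => w + t • v) v 0 :=
    (((hasDerivAt_id (0 : ℝ)).smul_const v).const_add w).congr_deriv (by simp)
  have hf' : HasFDerivAt f (fderiv ℝ f w) (w + (0 : ℝ) • v) := by
    simpa using hf.hasFDerivAt
  have := (hf'.comp_hasDerivAt (0 : ℝ) hl).unique h
  rw [← this, gradient, InnerProductSpace.toDual_symm_apply]

lemma differentiableAt_gradient {E : Type*} [NormedAddCommGroup E] [InnerProductSpace ℝ E]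
    [CompleteSpace E] {f : E → ℝ} {w : E} (hf : ContDiffAt ℝ 2 f w) :
    DifferentiableAt ℝ (gradient f) w := by
  have h : DifferentiableAt ℝ (fderiv ℝ f) w :=
    (hf.fderiv_right (m := 1) (by norm_num)).differentiableAt (by norm_num)
  exact ((InnerProductSpace.toDual ℝ E).symm.toContinuousLinearEquiv.differentiableAt).comp w h

lemma inner_fderiv_gradient_eq {E : Type*} [NormedAddCommGroup E] [InnerProductSpace ℝ E]
    [CompleteSpace E] {f : E → ℝ} {w v : E} (hf : ContDiffAt ℝ 2 f w) {d : ℝ}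
    (h : HasDerivAt (fun t : ℝ => ⟪gradient f (w + t • v), v⟫) d 0) :
    ⟪fderiv ℝ (gradient f) w v, v⟫ = d := by
  have hl : HasDerivAt (fun t : ℝ => w + t • v) v 0 :=
    (((hasDerivAt_id (0 : ℝ)).smul_const v).const_add w).congr_deriv (by simp)
  have hf' : HasFDerivAt (gradient f) (fderiv ℝ (gradient f) w) (w + (0 : ℝ) • v) := by
    simpa using (differentiableAt_gradient hf).hasFDerivAt
  have h1 := (hf'.comp_hasDerivAt (0 : ℝ) hl).inner ℝ (hasDerivAt_const (0 : ℝ) v)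
  have := h1.unique h
  simpa using this

lemma inner_gradg (hμ : 0 < μ) (hj : (j : ℕ) = n - 1) (Y : Matrix (Fin n) (Fin p) ℝ)
    {w : EuclideanSpace ℝ (Fin (n - 1))} (hw : ‖w‖ < 1) (v : EuclideanSpace ℝ (Fin (n - 1))) :
    ⟪gradg n p μ Y w, v⟫ = empAvg p
      (curv μ (padZero n w + √(1 - ‖w‖ ^ 2) • EuclideanSpace.single j 1) 0
        (padZero n v + (-(⟪w, v⟫ / √(1 - ‖w‖ ^ 2))) • EuclideanSpace.single j 1))
      (fun k i => Y i k) := by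
  have hn : 0 < n := j.pos
  refine inner_gradient_eq_of_hasDerivAt
    ((contDiffAt_gfun hn Y hw).differentiableAt (by norm_num)) ?_
  rw [gfun_eq hj]
  unfold empAvg
  refine HasDerivAt.const_mul _ (HasDerivAt.fun_sum fun k _ => ?_)
  have h1 := hasDerivAt_residual_line hw v (fun i => Y i k) (Y j k)
  have h2 := (hasDerivAt_hmu hμ _).comp (0 : ℝ) h1
  refine h2.congr_deriv ?_
  simp only [zero_smul, add_zero, curv, pairing_zero_left, pairing_add_left, pairing_smul_left,
    pairing_single]
  ring

lemma inner_hessg (hμ : 0 < μ) (hj : (j : ℕ) = n - 1) (Y : Matrix (Fin n) (Fin p) ℝ)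
    {w : EuclideanSpace ℝ (Fin (n - 1))} (hw : ‖w‖ < 1) (v : EuclideanSpace ℝ (Fin (n - 1))) :
    ⟪hessg n p μ Y w v, v⟫ = empAvg p
      (curv μ (padZero n w + √(1 - ‖w‖ ^ 2) • EuclideanSpace.single j 1)
        (padZero n v + (-(⟪w, v⟫ / √(1 - ‖w‖ ^ 2))) • EuclideanSpace.single j 1)
        ((-(‖v‖ ^ 2 / √(1 - ‖w‖ ^ 2) + ⟪w, v⟫ ^ 2 / √(1 - ‖w‖ ^ 2) ^ 3)) •
          EuclideanSpace.single j 1))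
      (fun k i => Y i k) := by
  have hn : 0 < n := j.pos
  refine inner_fderiv_gradient_eq (contDiffAt_gfun hn Y hw) ?_
  have hcont : Continuous fun t : ℝ => ‖w + t • v‖ := by fun_prop
  have hev : ∀ᶠ t in nhds (0 : ℝ), ‖w + t • v‖ < 1 :=
    hcont.continuousAt.eventually_lt continuousAt_const (by simpa using hw)
  have heq : (fun t : ℝ => ⟪gradient (gfun n p μ Y) (w + t • v), v⟫) =ᶠ[nhds 0] fun t =>
      (p : ℝ)⁻¹ * ∑ k, hmuDeriv μ (pairing (padZero n (w + t • v)) (fun i => Y i k) +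
        √(1 - ‖w + t • v‖ ^ 2) * Y j k) * (pairing (padZero n v) (fun i => Y i k) +
          -((⟪w, v⟫ + t * ‖v‖ ^ 2) / √(1 - ‖w + t • v‖ ^ 2)) * Y j k) := by
    filter_upwards [hev] with t ht
    have h := inner_gradg hμ hj Y ht v
    rw [gradg] at h
    rw [h]
    simp only [empAvg, curv, pairing_zero_left, pairing_add_left, pairing_smul_left,
      pairing_single, inner_add_left, real_inner_smul_left, real_inner_self_eq_norm_sq]
    simp
  refine HasDerivAt.congr_of_eventuallyEq ?_ heq
  unfold empAvg
  refine HasDerivAt.const_mul _ (HasDerivAt.fun_sum fun k _ => ?_)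
  have hσ : √(1 - ‖w‖ ^ 2) ≠ 0 := (Real.sqrt_pos.2 (by nlinarith [norm_nonneg w])).ne'
  have h1 := hasDerivAt_residual_line hw v (fun i => Y i k) (Y j k)
  have h2 := (hasDerivAt_hmuDeriv μ _).comp (0 : ℝ) h1
  have h3 : HasDerivAt (fun t : ℝ => ⟪w, v⟫ + t * ‖v‖ ^ 2) (‖v‖ ^ 2) 0 :=
    (((hasDerivAt_id (0 : ℝ)).mul_const _).const_add _).congr_deriv (by simp)
  have h4 := ((h3.fun_div (hasDerivAt_sqrt_line hw v) (by simpa using hσ)).fun_neg.mul_const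
    (Y j k)).const_add (pairing (padZero n v) (fun i => Y i k))
  refine (h2.mul h4).congr_deriv ?_
  simp only [Function.comp, zero_smul, add_zero, zero_mul, curv, pairing_add_left,
    pairing_smul_left, pairing_single]
  field_simp
  ring

lemma pairing_mulVec (M : Matrix (Fin n) (Fin n) ℝ) (c : EuclideanSpace ℝ (Fin n))
    (y : Fin n → ℝ) : pairing c (M *ᵥ y) = pairing (WithLp.toLp 2 (Mᵀ *ᵥ c)) y := by
  have : c.ofLp ⬝ᵥ (M *ᵥ y) = (Mᵀ *ᵥ c.ofLp) ⬝ᵥ y := by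
    rw [dotProduct_mulVec, mulVec_transpose]
  exact this

lemma empAvg_curv_mul (M : Matrix (Fin n) (Fin n) ℝ) (X : Matrix (Fin n) (Fin p) ℝ)
    (q a b : EuclideanSpace ℝ (Fin n)) :
    empAvg p (curv μ q a b) (fun k i => (M * X) i k) =
      empAvg p (curv μ (WithLp.toLp 2 (Mᵀ *ᵥ q)) (WithLp.toLp 2 (Mᵀ *ᵥ a))
        (WithLp.toLp 2 (Mᵀ *ᵥ b))) (fun k i => X i k) := by
  unfold empAvg
  congr 1
  refine Finset.sum_congr rfl fun k _ => ?_
  change curv μ q a b (M *ᵥ fun i => X i k) = _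
  simp only [curv, pairing_mulVec]

end derivatives

section landscape

variable {E : Type*} [NormedAddCommGroup E] [InnerProductSpace ℝ E] [CompleteSpace E]
  {f : E → ℝ}

lemma hasDerivAt_inner_gradient_line {w v : E} {t : ℝ} (hf : ContDiffAt ℝ 2 f (w + t • v)) :
    HasDerivAt (fun t : ℝ => ⟪gradient f (w + t • v), v⟫)
      ⟪fderiv ℝ (gradient f) (w + t • v) v, v⟫ t := by
  have hl : HasDerivAt (fun t : ℝ => w + t • v) v t :=
    (((hasDerivAt_id t).smul_const v).const_add w).congr_deriv (by simp)
  have h1 := ((differentiableAt_gradient hf).hasFDerivAt.comp_hasDerivAt t hl).inner ℝ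
    (hasDerivAt_const t v)
  exact h1.congr_deriv (by simp)

lemma hasDerivAt_line {w v : E} {t : ℝ} (hf : DifferentiableAt ℝ f (w + t • v)) :
    HasDerivAt (fun t : ℝ => f (w + t • v)) ⟪gradient f (w + t • v), v⟫ t := by
  have hl : HasDerivAt (fun t : ℝ => w + t • v) v t :=
    (((hasDerivAt_id t).smul_const v).const_add w).congr_deriv (by simp)
  refine (hf.hasFDerivAt.comp_hasDerivAt t hl).congr_deriv ?_
  rw [gradient, InnerProductSpace.toDual_symm_apply]

lemma IsLocalMin.gradient_eq_zero {w : E} (h : IsLocalMin f w) : gradient f w = 0 := by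
  rw [gradient, h.fderiv_eq_zero, map_zero]

lemma IsLocalMin.inner_fderiv_gradient_nonneg {w : E} (h : IsLocalMin f w)
    (hf : ContDiffAt ℝ 2 f w) (v : E) : 0 ≤ ⟪fderiv ℝ (gradient f) w v, v⟫ := by
  by_contra hneg
  push Not at hneg
  have hl : ContinuousAt (fun t : ℝ => w + t • v) 0 := by fun_prop
  have hl0 : Filter.Tendsto (fun t : ℝ => w + t • v) (nhds 0) (nhds w) := by
    simpa [ContinuousAt] using hl
  set φ : ℝ → ℝ := fun t => f (w + t • v) with hφ
  have hcd : ∀ᶠ t in nhds (0 : ℝ), ContDiffAt ℝ 2 f (w + t • v) :=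
    hl0.eventually (hf.eventually (by simp))
  have hd : deriv φ =ᶠ[nhds 0] fun t => ⟪gradient f (w + t • v), v⟫ := by
    filter_upwards [hcd] with t ht
    exact (hasDerivAt_line (ht.differentiableAt (by norm_num))).deriv
  have hdd : deriv (deriv φ) 0 = ⟪fderiv ℝ (gradient f) w v, v⟫ := by
    rw [hd.deriv_eq]
    have := (hasDerivAt_inner_gradient_line (w := w) (v := v) (t := 0) (by simpa using hf)).deriv
    simpa using this
  have hmin : IsLocalMin φ 0 := by
    have : ∀ᶠ t in nhds (0 : ℝ), f w ≤ f (w + t • v) := hl0.eventually h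
    filter_upwards [this] with t ht
    simpa [hφ] using ht
  have hd0 : deriv φ 0 = 0 := hmin.deriv_eq_zero
  have hc : ContinuousAt φ 0 :=
    (hasDerivAt_line (w := w) (v := v) (t := 0)
      (by simpa using hf.differentiableAt (by norm_num))).continuousAt
  have hmax : IsLocalMax φ 0 := isLocalMax_of_deriv_deriv_neg (by rw [hdd]; exact hneg) hd0 hc
  have hconst : φ =ᶠ[nhds 0] fun _ => φ 0 := by
    filter_upwards [hmin, hmax] with t h1 h2
    exact le_antisymm h2 h1
  have h1 : deriv φ =ᶠ[nhds 0] deriv fun _ => φ 0 := hconst.deriv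
  have h2 := h1.deriv_eq
  simp only [deriv_const', deriv_const] at h2
  linarith

lemma eq_of_gradient_eq_zero_of_hessian_pos {ρ c : ℝ} (hc : 0 < c)
    (hf : ∀ w, ‖w‖ ≤ ρ → ContDiffAt ℝ 2 f w)
    (hH : ∀ w, ‖w‖ ≤ ρ → ∀ v, c * ‖v‖ ^ 2 ≤ ⟪fderiv ℝ (gradient f) w v, v⟫) {x y : E}
    (hx : ‖x‖ ≤ ρ) (hy : ‖y‖ ≤ ρ) (gx : gradient f x = 0) (gy : gradient f y = 0) : x = y := by
  by_contra hne
  have hmem : ∀ t ∈ Set.Icc (0 : ℝ) 1, ‖x + t • (y - x)‖ ≤ ρ := by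
    intro t ht
    have := (convex_closedBall (0 : E) ρ).add_smul_sub_mem (by simpa using hx)
      (by simpa using hy) ht
    simpa using this
  obtain ⟨t, ht, h⟩ := exists_hasDerivAt_eq_slope
    (fun t : ℝ => ⟪gradient f (x + t • (y - x)), y - x⟫)
    (fun t => ⟪fderiv ℝ (gradient f) (x + t • (y - x)) (y - x), y - x⟫) zero_lt_one
    (fun t ht =>
      (hasDerivAt_inner_gradient_line (hf _ (hmem t ht))).continuousAt.continuousWithinAt)
    (fun t ht => hasDerivAt_inner_gradient_line (hf _ (hmem t (Set.Ioo_subset_Icc_self ht))))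
  have hpos := hH _ (hmem t (Set.Ioo_subset_Icc_self ht)) (y - x)
  have hn : 0 < ‖y - x‖ := norm_pos_iff.2 (sub_ne_zero.2 (Ne.symm hne))
  simp only [zero_smul, add_zero, one_smul, add_sub_cancel, gx, gy, inner_zero_left, sub_zero,
    div_one] at h
  rw [h] at hpos
  have : 0 < c * ‖y - x‖ ^ 2 := by positivity
  linarith

/-- A function that is strongly convex near the origin, radially increasing at intermediate
radii and radially concave at large radii has exactly one local minimizer. -/
theorem exists_unique_localMin_of_landscape [FiniteDimensional ℝ E] {r₀ r₁ ρ t₁ R c : ℝ}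
    (hr₁ : 0 < r₁) (h01 : r₀ ≤ r₁) (h1ρ : r₁ ≤ ρ) (h1t : r₁ ≤ t₁) (h1R : r₁ < R) (hR : R < 1)
    (hρ1 : ρ < 1) (hc : 0 < c) (hf : ∀ w, ‖w‖ < 1 → ContDiffAt ℝ 2 f w)
    (hconv : ∀ w, ‖w‖ ≤ ρ → ∀ v, c * ‖v‖ ^ 2 ≤ ⟪fderiv ℝ (gradient f) w v, v⟫)
    (hgrad : ∀ w, r₀ ≤ ‖w‖ → ‖w‖ ≤ t₁ → 0 < ⟪w, gradient f w⟫)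
    (hneg : ∀ w, t₁ ≤ ‖w‖ → ‖w‖ ≤ R → ⟪fderiv ℝ (gradient f) w w, w⟫ < 0) :
    ∃ x, ‖x‖ < R ∧ IsLocalMinOn f {w | ‖w‖ < R} x ∧ ‖x‖ ≤ r₁ ∧
      ∀ y, ‖y‖ < R → IsLocalMinOn f {w | ‖w‖ < R} y → y = x := by
  have hcont : ContinuousOn f (Metric.closedBall 0 r₁) := fun w hw =>
    (hf w (by rw [mem_closedBall_zero_iff] at hw; linarith)).continuousAt.continuousWithinAt
  obtain ⟨x, hx, hmin⟩ := (isCompact_closedBall (0 : E) r₁).exists_isMinOn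
    ⟨0, by simpa using hr₁.le⟩ hcont
  have hx1 : ‖x‖ ≤ r₁ := by simpa using hx
  have hdx : DifferentiableAt ℝ f x := (hf x (by linarith)).differentiableAt (by norm_num)
  have hlt : ‖x‖ < r₁ := by
    refine lt_of_le_of_ne hx1 fun heq => ?_
    have hpos := hgrad x (by linarith) (by linarith)
    have hcone : 0 - x ∈ posTangentConeAt (Metric.closedBall (0 : E) r₁) x :=
      sub_mem_posTangentConeAt_of_segment_subset
        ((convex_closedBall (0 : E) r₁).segment_subset hx (by simpa using hr₁.le))
    have h := hmin.localize.hasFDerivWithinAt_nonneg hdx.hasFDerivAt.hasFDerivWithinAt hcone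
    have e : ⟪gradient f x, x⟫ = fderiv ℝ f x x := by
      rw [gradient, InnerProductSpace.toDual_symm_apply]
    rw [real_inner_comm] at hpos
    rw [zero_sub, map_neg] at h
    linarith
  have hxloc : IsLocalMin f x :=
    hmin.isLocalMin (Metric.closedBall_mem_nhds_of_mem (by simpa using hlt))
  refine ⟨x, by linarith, hxloc.on _, hx1, fun y hy hyloc => ?_⟩
  have hopen : IsOpen {w : E | ‖w‖ < R} := isOpen_lt continuous_norm continuous_const
  have hyl : IsLocalMin f y := hyloc.isLocalMin (hopen.mem_nhds hy)
  have gy := hyl.gradient_eq_zero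
  rcases le_or_gt t₁ ‖y‖ with h1 | h1
  · have := hyl.inner_fderiv_gradient_nonneg (hf y (by linarith)) y
    linarith [hneg y h1 hy.le]
  rcases le_or_gt r₀ ‖y‖ with h2 | h2
  · have := hgrad y h2 h1.le
    rw [gy, inner_zero_right] at this
    exact absurd this (lt_irrefl _)
  exact eq_of_gradient_eq_zero_of_hessian_pos hc (fun w hw => hf w (by linarith)) hconv
    (by linarith) (by linarith) gy hxloc.gradient_eq_zero

end landscape

section deterministic

variable {n p : ℕ} {θ μ δ : ℝ} {j : Fin n}

/-- The velocity at `w` in direction `v` of the hemisphere parametrization. -/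
def chartVelocity (j : Fin n) (w v : EuclideanSpace ℝ (Fin (n - 1))) : EuclideanSpace ℝ (Fin n) :=
  padZero n v + (-(⟪w, v⟫ / √(1 - ‖w‖ ^ 2))) • EuclideanSpace.single j 1

/-- The base point, velocity and acceleration entering the Hessian of the objective. -/
def hessTriple (j : Fin n) (w v : EuclideanSpace ℝ (Fin (n - 1))) :
    EuclideanSpace ℝ (Fin n) × EuclideanSpace ℝ (Fin n) × EuclideanSpace ℝ (Fin n) :=
  (padZero n w + √(1 - ‖w‖ ^ 2) • EuclideanSpace.single j 1, chartVelocity j w v,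
    (-(‖v‖ ^ 2 / √(1 - ‖w‖ ^ 2) + ⟪w, v⟫ ^ 2 / √(1 - ‖w‖ ^ 2) ^ 3)) • EuclideanSpace.single j 1)

/-- The base point and direction entering the gradient of the objective. -/
def gradTriple (j : Fin n) (w v : EuclideanSpace ℝ (Fin (n - 1))) :
    EuclideanSpace ℝ (Fin n) × EuclideanSpace ℝ (Fin n) × EuclideanSpace ℝ (Fin n) :=
  (padZero n w + √(1 - ‖w‖ ^ 2) • EuclideanSpace.single j 1, 0, chartVelocity j w v)

lemma norm_padZero_add_single_sq (hj : (j : ℕ) = n - 1) (v : EuclideanSpace ℝ (Fin (n - 1)))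
    (α : ℝ) :
    ‖padZero n v + α • EuclideanSpace.single j (1 : ℝ)‖ ^ 2 = ‖v‖ ^ 2 + α ^ 2 := by
  rw [norm_add_sq_real, real_inner_smul_right, EuclideanSpace.inner_single_right, norm_smul,
    padZero_apply_last hj, norm_padZero]
  simp

lemma norm_chart (hj : (j : ℕ) = n - 1) {w : EuclideanSpace ℝ (Fin (n - 1))} (hw : ‖w‖ ≤ 1) :
    ‖padZero n w + √(1 - ‖w‖ ^ 2) • EuclideanSpace.single j (1 : ℝ)‖ = 1 := by
  have h := norm_padZero_add_single_sq hj w √(1 - ‖w‖ ^ 2)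
  rw [Real.sq_sqrt (by nlinarith [norm_nonneg w])] at h
  refine (sq_eq_sq₀ (norm_nonneg _) zero_le_one).mp ?_
  linarith

lemma norm_chartVelocity_le (hj : (j : ℕ) = n - 1) {w v : EuclideanSpace ℝ (Fin (n - 1))}
    (hw : ‖w‖ < 1) (hv : ‖v‖ = 1) : ‖chartVelocity j w v‖ ≤ (√(1 - ‖w‖ ^ 2))⁻¹ := by
  have hpos : 0 < 1 - ‖w‖ ^ 2 := by nlinarith [norm_nonneg w]
  have hs := Real.sqrt_pos.mpr hpos
  refine le_of_sq_le_sq ?_ (by positivity)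
  rw [chartVelocity, norm_padZero_add_single_sq hj, hv, neg_sq, div_pow, inv_pow,
    Real.sq_sqrt hpos.le]
  have hc : ⟪w, v⟫ ^ 2 ≤ ‖w‖ ^ 2 := by
    rw [sq_le_sq, abs_of_nonneg (norm_nonneg w)]
    simpa [hv] using abs_real_inner_le_norm w v
  rw [← sub_nonneg]
  have e : (1 - ‖w‖ ^ 2)⁻¹ - (1 ^ 2 + ⟪w, v⟫ ^ 2 / (1 - ‖w‖ ^ 2)) =
      (‖w‖ ^ 2 - ⟪w, v⟫ ^ 2) / (1 - ‖w‖ ^ 2) := by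
    field_simp
    ring
  rw [e]
  exact div_nonneg (by linarith) hpos.le

lemma chart_acceleration_le {w v : EuclideanSpace ℝ (Fin (n - 1))} (hw : ‖w‖ < 1)
    (hv : ‖v‖ = 1) :
    |(-(‖v‖ ^ 2 / √(1 - ‖w‖ ^ 2) + ⟪w, v⟫ ^ 2 / √(1 - ‖w‖ ^ 2) ^ 3))| ≤
      (√(1 - ‖w‖ ^ 2))⁻¹ ^ 3 := by
  have hpos : 0 < 1 - ‖w‖ ^ 2 := by nlinarith [norm_nonneg w]
  have hs := Real.sqrt_pos.mpr hpos
  have hss := Real.sq_sqrt hpos.le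
  set s := √(1 - ‖w‖ ^ 2)
  have hc : ⟪w, v⟫ ^ 2 ≤ ‖w‖ ^ 2 := by
    rw [sq_le_sq, abs_of_nonneg (norm_nonneg w)]
    simpa [hv] using abs_real_inner_le_norm w v
  rw [abs_neg, abs_of_nonneg (by positivity), hv]
  have e : 1 ^ 2 / s + ⟪w, v⟫ ^ 2 / s ^ 3 = (s ^ 2 + ⟪w, v⟫ ^ 2) * s⁻¹ ^ 3 := by
    field_simp
  rw [e]
  have : (0 : ℝ) ≤ s⁻¹ ^ 3 := by positivity
  nlinarith

lemma hessTriple_mem_tripleSet (hj : (j : ℕ) = n - 1) {w v : EuclideanSpace ℝ (Fin (n - 1))}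
    (hw : ‖w‖ < 1) (hv : ‖v‖ = 1) (hs : (√(1 - ‖w‖ ^ 2))⁻¹ ≤ 2 * √n) :
    hessTriple j w v ∈ tripleSet n √n := by
  refine ⟨(norm_chart hj hw.le).le, (norm_chartVelocity_le hj hw hv).trans hs, ?_⟩
  simp only [hessTriple, norm_smul, PiLp.norm_single, norm_one, mul_one,
    Real.norm_eq_abs]
  refine (chart_acceleration_le hw hv).trans ?_
  calc (√(1 - ‖w‖ ^ 2))⁻¹ ^ 3 ≤ (2 * √n) ^ 3 := by gcongr
    _ = 8 * √n ^ 3 := by ring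

lemma gradTriple_mem_tripleSet (hn : 0 < n) (hj : (j : ℕ) = n - 1)
    {w v : EuclideanSpace ℝ (Fin (n - 1))}
    (hw : ‖w‖ < 1) (hv : ‖v‖ = 1) (hs : (√(1 - ‖w‖ ^ 2))⁻¹ ≤ 2 * √n) :
    gradTriple j w v ∈ tripleSet n √n := by
  have hr : 1 ≤ √(n : ℝ) := Real.one_le_sqrt.mpr (by exact_mod_cast hn)
  refine ⟨(norm_chart hj hw.le).le, by simp [gradTriple], ?_⟩
  refine ((norm_chartVelocity_le hj hw hv).trans hs).trans ?_
  nlinarith [pow_le_pow_right₀ hr (show 1 ≤ 3 by norm_num)]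

lemma integral_hessTriple_ge_of_small (h0 : 0 < θ) (h1 : θ ≤ 1 / 2) (hμ : 0 < μ)
    (hμ1 : μ ≤ 1 / 1000) (hj : (j : ℕ) = n - 1) {w v : EuclideanSpace ℝ (Fin (n - 1))}
    (hw : ‖w‖ ≤ μ / (4 * √2)) (hv : ‖v‖ = 1) :
    θ / (5 * μ) ≤ ∫ y, curv μ (hessTriple j w v).1 (hessTriple j w v).2.1
      (hessTriple j w v).2.2 y ∂(bgVec θ n) := by
  have hw1 : ‖w‖ ≤ 1 / 10 := by
    refine hw.trans ((div_le_self hμ.le ?_).trans (by linarith))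
    nlinarith [Real.one_le_sqrt.mpr (show (1 : ℝ) ≤ 2 by norm_num)]
  have hγ := chart_acceleration_le (n := n) (w := w) (v := v) (by linarith) hv
  have hs : 9 / 10 ≤ √(1 - ‖w‖ ^ 2) :=
    Real.le_sqrt_of_sq_le (by nlinarith [norm_nonneg w])
  have hs3 : (√(1 - ‖w‖ ^ 2))⁻¹ ^ 3 ≤ 2 := by
    calc (√(1 - ‖w‖ ^ 2))⁻¹ ^ 3 ≤ ((9 / 10 : ℝ)⁻¹) ^ 3 := by gcongr
      _ ≤ 2 := by norm_num
  have key := integral_curv_ge_of_small h0.le (by linarith) hμ (w := padZero n w)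
    (v := padZero n v) (padZero_apply_last hj v) (by rwa [norm_padZero]) √(1 - ‖w‖ ^ 2)
    (-(⟪w, v⟫ / √(1 - ‖w‖ ^ 2)))
    (-(‖v‖ ^ 2 / √(1 - ‖w‖ ^ 2) + ⟪w, v⟫ ^ 2 / √(1 - ‖w‖ ^ 2) ^ 3))
  refine le_trans ?_ key
  rw [norm_padZero, hv]
  rw [hv] at hγ
  have hγ2 := mul_le_mul_of_nonneg_right (hγ.trans hs3) h0.le
  have hμi : 1000 ≤ μ⁻¹ := by
    rw [le_inv_comm₀ (by norm_num) hμ]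
    linarith
  have e : θ / (5 * μ) = μ⁻¹ * θ / 5 := by field_simp
  rw [e]
  have hθi : 1000 * θ ≤ μ⁻¹ * θ := by gcongr
  have : μ⁻¹ * θ * (1 / 2) ≤ μ⁻¹ * θ * (1 - θ) := by gcongr; linarith
  linarith

lemma unit_smul_norm {E : Type*} [NormedAddCommGroup E] [InnerProductSpace ℝ E] {w : E}
    (hw : 0 < ‖w‖) : ‖‖w‖⁻¹ • w‖ = 1 ∧ w = ‖w‖ • (‖w‖⁻¹ • w) ∧ ⟪w, ‖w‖⁻¹ • w⟫ = ‖w‖ := by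
  refine ⟨?_, ?_, ?_⟩
  · rw [norm_smul, norm_inv, norm_norm, inv_mul_cancel₀ hw.ne']
  · rw [smul_smul, mul_inv_cancel₀ hw.ne', one_smul]
  · rw [real_inner_smul_right, real_inner_self_eq_norm_sq]
    field_simp

lemma one_div_twenty_sqrt_five_bounds :
    1 / 45 ≤ 1 / (20 * √5 : ℝ) ∧ 1 / (20 * √5 : ℝ) ≤ 1 / 44 := by
  have h1 : √5 ≤ 9 / 4 := by
    rw [Real.sqrt_le_left (by norm_num)]
    norm_num
  have h2 : 11 / 5 ≤ √5 := Real.le_sqrt_of_sq_le (by norm_num)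
  exact ⟨one_div_le_one_div_of_le (by positivity) (by linarith),
    one_div_le_one_div_of_le (by positivity) (by linarith)⟩

lemma integral_gradTriple_ge_of_mid (h0 : 0 < θ) (h1 : θ ≤ 1 / 2) (hμ : 0 < μ)
    (hj : (j : ℕ) = n - 1) {w : EuclideanSpace ℝ (Fin (n - 1))} (hw : μ / 8 ≤ ‖w‖)
    (hw' : ‖w‖ ≤ 1 / (20 * √5)) :
    θ / 32 ≤ ∫ y, curv μ (gradTriple j w (‖w‖⁻¹ • w)).1 (gradTriple j w (‖w‖⁻¹ • w)).2.1
      (gradTriple j w (‖w‖⁻¹ • w)).2.2 y ∂(bgVec θ n) := by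
  have hw0 : 0 < ‖w‖ := by linarith
  obtain ⟨hu1, hwu, hin⟩ := unit_smul_norm hw0
  have hw1 := hw'.trans one_div_twenty_sqrt_five_bounds.2
  have key := integral_curv_ge_of_mid h0.le (by linarith) hμ
    (u := padZero n (‖w‖⁻¹ • w)) (padZero_apply_last hj _) (by rwa [norm_padZero]) hw
    √(1 - ‖w‖ ^ 2) (-(‖w‖ / √(1 - ‖w‖ ^ 2)))
  rw [← map_smul, ← hwu] at key
  rw [gradTriple, chartVelocity, hin]
  refine le_trans ?_ key
  have hs : 44 / 45 ≤ √(1 - ‖w‖ ^ 2) :=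
    Real.le_sqrt_of_sq_le (by nlinarith [norm_nonneg w])
  have hγ : |(-(‖w‖ / √(1 - ‖w‖ ^ 2)))| ≤ 3 / 100 := by
    rw [abs_neg, abs_of_nonneg (by positivity), div_le_iff₀ (by linarith)]
    linarith
  have := mul_le_mul_of_nonneg_right hγ h0.le
  nlinarith

lemma sqrt_one_sub_ge {w : EuclideanSpace ℝ (Fin (n - 1))} (hn : 0 < n)
    (hw : ‖w‖ ≤ √((4 * (n : ℝ) - 1) / (4 * n))) :
    ‖w‖ < 1 ∧ (√(1 - ‖w‖ ^ 2))⁻¹ ≤ 2 * √n := by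
  have hn0 : (1 : ℝ) ≤ n := by exact_mod_cast hn
  have hq : 0 ≤ (4 * (n : ℝ) - 1) / (4 * n) := div_nonneg (by linarith) (by linarith)
  have h2 : ‖w‖ ^ 2 ≤ 1 - 1 / (4 * (n : ℝ)) := by
    calc ‖w‖ ^ 2 ≤ √((4 * (n : ℝ) - 1) / (4 * n)) ^ 2 := by gcongr
      _ = 1 - 1 / (4 * (n : ℝ)) := by
        rw [Real.sq_sqrt hq]
        field_simp
  have hd : 0 < 1 / (4 * (n : ℝ)) := by positivity
  refine ⟨by nlinarith [norm_nonneg w], ?_⟩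
  have hr : 0 < √(n : ℝ) := Real.sqrt_pos.mpr (by linarith)
  refine inv_le_of_inv_le₀ (by positivity) (Real.le_sqrt_of_sq_le ?_)
  rw [inv_pow, mul_pow, Real.sq_sqrt (by linarith)]
  have : ((2 : ℝ) ^ 2 * n)⁻¹ = 1 / (4 * n) := by
    rw [one_div]
    norm_num
  linarith

lemma integral_hessTriple_le_of_large (hn : 0 < n) (h0 : 0 < θ) (h1 : θ ≤ 1 / 2) (hμ : 0 < μ)
    (hμθ : μ ≤ θ / (50000 * n)) (hj : (j : ℕ) = n - 1)
    {w : EuclideanSpace ℝ (Fin (n - 1))} (hw : 1 / (20 * √5) ≤ ‖w‖)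
    (hw' : ‖w‖ ≤ √((4 * (n : ℝ) - 1) / (4 * n))) :
    ∫ y, curv μ (hessTriple j w (‖w‖⁻¹ • w)).1 (hessTriple j w (‖w‖⁻¹ • w)).2.1
      (hessTriple j w (‖w‖⁻¹ • w)).2.2 y ∂(bgVec θ n) ≤ -(θ / 5) := by
  have hn0 : (1 : ℝ) ≤ n := by exact_mod_cast hn
  have hr0 : 1 ≤ √(n : ℝ) := Real.one_le_sqrt.mpr hn0
  have hwl := one_div_twenty_sqrt_five_bounds.1.trans hw
  have hw0 : 0 < ‖w‖ := by linarith
  obtain ⟨hu1, hwu, hin⟩ := unit_smul_norm hw0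
  obtain ⟨hlt, hsi⟩ := sqrt_one_sub_ge hn hw'
  have hpos : 0 < 1 - ‖w‖ ^ 2 := by nlinarith
  have hs := Real.sqrt_pos.mpr hpos
  have hss := Real.sq_sqrt hpos.le
  have hμ1 : μ * (50000 * n) ≤ θ := by rwa [le_div_iff₀ (by positivity)] at hμθ
  have hμ2 : 50000 * μ ≤ θ := by nlinarith
  have hs30 : 30 * μ ≤ √(1 - ‖w‖ ^ 2) := by
    rw [inv_le_comm₀ hs (by positivity)] at hsi
    refine le_trans ?_ hsi
    rw [← one_div, le_div_iff₀ (by positivity)]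
    have : √(n : ℝ) ≤ n := by nlinarith [Real.sq_sqrt (show (0 : ℝ) ≤ n by linarith)]
    nlinarith
  have key := integral_curv_le_of_large h0.le (by linarith) hμ
    (u := padZero n (‖w‖⁻¹ • w)) (padZero_apply_last hj _) (by rwa [norm_padZero]) hw0 hs30
    (by rw [hss]; ring)
  rw [← map_smul, ← hwu] at key
  rw [hessTriple, chartVelocity, hin, hu1]
  have e : (1 : ℝ) ^ 2 / √(1 - ‖w‖ ^ 2) + ‖w‖ ^ 2 / √(1 - ‖w‖ ^ 2) ^ 3 =
      (√(1 - ‖w‖ ^ 2))⁻¹ ^ 3 := by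
    rw [eq_sub_iff_add_eq'] at hss
    rw [inv_pow, ← one_div, eq_div_iff (by positivity)]
    field_simp
    linarith
  rw [e]
  refine key.trans ?_
  have hq : μ / ‖w‖ ^ 2 ≤ 2025 * μ := by
    rw [div_le_iff₀ (by positivity)]
    have : 1 / 45 ^ 2 ≤ ‖w‖ ^ 2 := by
      rw [← _root_.one_div_pow]
      gcongr
    nlinarith
  have : 0 ≤ μ / ‖w‖ ^ 2 := by positivity
  nlinarith

end deterministic

section assembly

variable {n p : ℕ} {θ μ δ : ℝ} {j : Fin n}

/-- Hessian triples over unit directions near the origin. -/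
def convexTriples (μ : ℝ) (j : Fin n) :
    Set (EuclideanSpace ℝ (Fin n) × EuclideanSpace ℝ (Fin n) × EuclideanSpace ℝ (Fin n)) :=
  {z | ∃ w v, ‖w‖ ≤ μ / (4 * √2) ∧ ‖v‖ = 1 ∧ z = hessTriple j w v}

/-- Radial gradient triples at intermediate radii. -/
def radialTriples (μ : ℝ) (j : Fin n) :
    Set (EuclideanSpace ℝ (Fin n) × EuclideanSpace ℝ (Fin n) × EuclideanSpace ℝ (Fin n)) :=
  {z | ∃ w, μ / 8 ≤ ‖w‖ ∧ ‖w‖ ≤ 1 / (20 * √5) ∧ z = gradTriple j w (‖w‖⁻¹ • w)}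

/-- Radial Hessian triples far from the origin. -/
def concaveTriples (j : Fin n) :
    Set (EuclideanSpace ℝ (Fin n) × EuclideanSpace ℝ (Fin n) × EuclideanSpace ℝ (Fin n)) :=
  {z | ∃ w, 1 / (20 * √5) ≤ ‖w‖ ∧ ‖w‖ ≤ √((4 * (n : ℝ) - 1) / (4 * n)) ∧
    z = hessTriple j w (‖w‖⁻¹ • w)}

lemma inv_sqrt_one_sub_le_of_norm_le (hn : 0 < n) {w : EuclideanSpace ℝ (Fin (n - 1))}
    (hw : ‖w‖ ≤ 1 / 10) : (√(1 - ‖w‖ ^ 2))⁻¹ ≤ 2 * √n := by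
  have hr : 1 ≤ √(n : ℝ) := Real.one_le_sqrt.mpr (by exact_mod_cast hn)
  have hs : 1 / 2 ≤ √(1 - ‖w‖ ^ 2) :=
    Real.le_sqrt_of_sq_le (by nlinarith [norm_nonneg w])
  calc (√(1 - ‖w‖ ^ 2))⁻¹ ≤ (1 / 2 : ℝ)⁻¹ := by gcongr
    _ ≤ 2 * √n := by norm_num; linarith

lemma div_four_sqrt_two_le (hμ : 0 < μ) : μ / (4 * √2) ≤ μ / 5 := by
  have : 5 / 4 ≤ √2 := Real.le_sqrt_of_sq_le (by norm_num)
  gcongr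
  linarith

lemma div_seven_le (hμ : 0 < μ) : μ / 7 ≤ μ / (4 * √2) := by
  have : √2 ≤ 7 / 4 := by
    rw [Real.sqrt_le_left (by norm_num)]
    norm_num
  gcongr
  linarith

lemma convexTriples_subset (hn : 0 < n) (hμ : 0 < μ) (hμ1 : μ ≤ 1 / 1000)
    (hj : (j : ℕ) = n - 1) : convexTriples μ j ⊆ tripleSet n √n := by
  rintro _ ⟨w, v, hw, hv, rfl⟩
  have := div_four_sqrt_two_le hμ
  exact hessTriple_mem_tripleSet hj (by linarith) hv
    (inv_sqrt_one_sub_le_of_norm_le hn (by linarith))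

lemma radialTriples_subset (hn : 0 < n) (hμ : 0 < μ) (hj : (j : ℕ) = n - 1) :
    radialTriples μ j ⊆ tripleSet n √n := by
  rintro _ ⟨w, hw, hw', rfl⟩
  have := hw'.trans one_div_twenty_sqrt_five_bounds.2
  exact gradTriple_mem_tripleSet hn hj (by linarith) (unit_smul_norm (by linarith)).1
    (inv_sqrt_one_sub_le_of_norm_le hn (by linarith))

lemma concaveTriples_subset (hn : 0 < n) (hj : (j : ℕ) = n - 1) :
    concaveTriples j ⊆ tripleSet n √n := by
  rintro _ ⟨w, hw, hw', rfl⟩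
  have := one_div_twenty_sqrt_five_bounds.1.trans hw
  obtain ⟨h1, h2⟩ := sqrt_one_sub_ge hn hw'
  exact hessTriple_mem_tripleSet hj h1 (unit_smul_norm (by linarith)).1 h2

variable {M : Matrix (Fin n) (Fin n) ℝ} {X : Matrix (Fin n) (Fin p) ℝ}
  {T : Set (EuclideanSpace ℝ (Fin n) × EuclideanSpace ℝ (Fin n) × EuclideanSpace ℝ (Fin n))}

lemma exists_abs_empAvg_curv_sub_le
    (hM : ∀ c : EuclideanSpace ℝ (Fin n), ‖WithLp.toLp 2 (Mᵀ *ᵥ c) - c‖ ≤ δ * ‖c‖)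
    (hX : (fun k i => X i k) ∈ curvApprox n p θ μ δ T)
    {z : EuclideanSpace ℝ (Fin n) × EuclideanSpace ℝ (Fin n) × EuclideanSpace ℝ (Fin n)}
    (hz : z ∈ T) :
    ∃ z' ∈ T, |empAvg p (curv μ z.1 z.2.1 z.2.2) (fun k i => (M * X) i k) -
      ∫ y, curv μ z'.1 z'.2.1 z'.2.2 y ∂(bgVec θ n)| ≤ θ / 100 := by
  rw [empAvg_curv_mul]
  exact hX z hz _ _ _ (hM _) (hM _) (hM _)

lemma inner_hessg_eq (hμ : 0 < μ) (hj : (j : ℕ) = n - 1) (Y : Matrix (Fin n) (Fin p) ℝ)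
    {w : EuclideanSpace ℝ (Fin (n - 1))} (hw : ‖w‖ < 1) (v : EuclideanSpace ℝ (Fin (n - 1))) :
    ⟪hessg n p μ Y w v, v⟫ = empAvg p (curv μ (hessTriple j w v).1 (hessTriple j w v).2.1
      (hessTriple j w v).2.2) (fun k i => Y i k) :=
  inner_hessg hμ hj Y hw v

lemma inner_gradg_eq (hμ : 0 < μ) (hj : (j : ℕ) = n - 1) (Y : Matrix (Fin n) (Fin p) ℝ)
    {w : EuclideanSpace ℝ (Fin (n - 1))} (hw : ‖w‖ < 1) (v : EuclideanSpace ℝ (Fin (n - 1))) :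
    ⟪gradg n p μ Y w, v⟫ = empAvg p (curv μ (gradTriple j w v).1 (gradTriple j w v).2.1
      (gradTriple j w v).2.2) (fun k i => Y i k) :=
  inner_gradg hμ hj Y hw v

lemma inner_smul_map_smul {E : Type*} [NormedAddCommGroup E] [InnerProductSpace ℝ E]
    (H : E →L[ℝ] E) (t : ℝ) (u : E) : ⟪H (t • u), t • u⟫ = t ^ 2 * ⟪H u, u⟫ := by
  rw [map_smul, real_inner_smul_left, real_inner_smul_right]
  ring

lemma hessg_ge (h0 : 0 < θ) (h1 : θ ≤ 1 / 2) (hμ : 0 < μ) (hμ1 : μ ≤ 1 / 1000)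
    (hj : (j : ℕ) = n - 1)
    (hM : ∀ c : EuclideanSpace ℝ (Fin n), ‖WithLp.toLp 2 (Mᵀ *ᵥ c) - c‖ ≤ δ * ‖c‖)
    (hX : (fun k i => X i k) ∈ curvApprox n p θ μ δ (convexTriples μ j))
    {w : EuclideanSpace ℝ (Fin (n - 1))} (hw : ‖w‖ ≤ μ / (4 * √2))
    (v : EuclideanSpace ℝ (Fin (n - 1))) :
    1 / 50 * θ / (2 * μ) * ‖v‖ ^ 2 ≤ ⟪hessg n p μ (M * X) w v, v⟫ := by
  have hw1 : ‖w‖ < 1 := by linarith [div_four_sqrt_two_le hμ]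
  rcases (norm_nonneg v).eq_or_lt with hv | hv
  · rw [eq_comm, norm_eq_zero] at hv
    simp [hv]
  obtain ⟨hu1, hvu, -⟩ := unit_smul_norm hv
  obtain ⟨z', ⟨w', v', hw', hv', rfl⟩, hz⟩ := exists_abs_empAvg_curv_sub_le hM hX
    (z := hessTriple j w (‖v‖⁻¹ • v)) ⟨w, _, hw, hu1, rfl⟩
  rw [← inner_hessg_eq hμ hj _ hw1] at hz
  have hI := integral_hessTriple_ge_of_small h0 h1 hμ hμ1 hj hw' hv'
  have key : 1 / 50 * θ / (2 * μ) ≤ ⟪hessg n p μ (M * X) w (‖v‖⁻¹ • v), ‖v‖⁻¹ • v⟫ := by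
    have h2 := (abs_le.mp hz).1
    have e1 : 1 / 50 * θ / (2 * μ) = μ⁻¹ * θ / 100 := by field_simp; norm_num
    have e2 : θ / (5 * μ) = μ⁻¹ * θ / 5 := by field_simp
    have hμi : 1 ≤ μ⁻¹ := by
      rw [le_inv_comm₀ (by norm_num) hμ]
      linarith
    have : 1 * θ ≤ μ⁻¹ * θ := by gcongr
    rw [e1]
    rw [e2] at hI
    linarith
  calc 1 / 50 * θ / (2 * μ) * ‖v‖ ^ 2
      ≤ ⟪hessg n p μ (M * X) w (‖v‖⁻¹ • v), ‖v‖⁻¹ • v⟫ * ‖v‖ ^ 2 := by gcongr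
    _ = ⟪hessg n p μ (M * X) w (‖v‖ • (‖v‖⁻¹ • v)), ‖v‖ • (‖v‖⁻¹ • v)⟫ := by
        rw [inner_smul_map_smul _ ‖v‖, mul_comm]
    _ = ⟪hessg n p μ (M * X) w v, v⟫ := by rw [← hvu]

lemma gradg_ge (h0 : 0 < θ) (h1 : θ ≤ 1 / 2) (hμ : 0 < μ) (hj : (j : ℕ) = n - 1)
    (hM : ∀ c : EuclideanSpace ℝ (Fin n), ‖WithLp.toLp 2 (Mᵀ *ᵥ c) - c‖ ≤ δ * ‖c‖)
    (hX : (fun k i => X i k) ∈ curvApprox n p θ μ δ (radialTriples μ j))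
    {w : EuclideanSpace ℝ (Fin (n - 1))} (hw : μ / 8 ≤ ‖w‖) (hw' : ‖w‖ ≤ 1 / (20 * √5)) :
    1 / 2 * (1 / 50 * θ) ≤ ⟪w, gradg n p μ (M * X) w⟫ / ‖w‖ := by
  have hw1 : ‖w‖ < 1 := by linarith [one_div_twenty_sqrt_five_bounds.2]
  obtain ⟨z', ⟨w', hl, hu, rfl⟩, hz⟩ := exists_abs_empAvg_curv_sub_le hM hX
    (z := gradTriple j w (‖w‖⁻¹ • w)) ⟨w, hw, hw', rfl⟩
  rw [← inner_gradg_eq hμ hj _ hw1, real_inner_smul_right] at hz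
  have hI := integral_gradTriple_ge_of_mid h0 h1 hμ hj hl hu
  rw [real_inner_comm, div_eq_inv_mul _ ‖w‖]
  linarith [(abs_le.mp hz).1]

lemma hessg_le (hn : 0 < n) (h0 : 0 < θ) (h1 : θ ≤ 1 / 2) (hμ : 0 < μ)
    (hμθ : μ ≤ θ / (50000 * n)) (hj : (j : ℕ) = n - 1)
    (hM : ∀ c : EuclideanSpace ℝ (Fin n), ‖WithLp.toLp 2 (Mᵀ *ᵥ c) - c‖ ≤ δ * ‖c‖)
    (hX : (fun k i => X i k) ∈ curvApprox n p θ μ δ (concaveTriples j))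
    {w : EuclideanSpace ℝ (Fin (n - 1))} (hw : 1 / (20 * √5) ≤ ‖w‖)
    (hw' : ‖w‖ ≤ √((4 * (n : ℝ) - 1) / (4 * n))) :
    ⟪hessg n p μ (M * X) w w, w⟫ / ‖w‖ ^ 2 ≤ -(1 / 2 * (1 / 50 * θ)) := by
  obtain ⟨z', ⟨w', hl, hu, rfl⟩, hz⟩ := exists_abs_empAvg_curv_sub_le hM hX
    (z := hessTriple j w (‖w‖⁻¹ • w)) ⟨w, hw, hw', rfl⟩
  rw [← inner_hessg_eq hμ hj _ (sqrt_one_sub_ge hn hw').1, inner_smul_map_smul, inv_pow] at hz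
  have hI := integral_hessTriple_le_of_large hn h0 h1 hμ hμθ hj hl hu
  rw [div_eq_inv_mul _ (‖w‖ ^ 2)]
  linarith [(abs_le.mp hz).2]

/-- The landscape is benign as soon as the sample approximates the population curvature on the
three families of triples. -/
theorem landscape_of_curvApprox (hn : 0 < n) (h0 : 0 < θ) (h1 : θ ≤ 1 / 2) (hμ : 0 < μ)
    (hμθ : μ ≤ θ / (50000 * n)) (hj : (j : ℕ) = n - 1)
    (hM : ∀ c : EuclideanSpace ℝ (Fin n), ‖WithLp.toLp 2 (Mᵀ *ᵥ c) - c‖ ≤ δ * ‖c‖)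
    (hX₁ : (fun k i => X i k) ∈ curvApprox n p θ μ δ (convexTriples μ j))
    (hX₂ : (fun k i => X i k) ∈ curvApprox n p θ μ δ (radialTriples μ j))
    (hX₃ : (fun k i => X i k) ∈ curvApprox n p θ μ δ (concaveTriples j)) :
    (∀ w : EuclideanSpace ℝ (Fin (n - 1)), ‖w‖ ≤ μ / (4 * √2) →
      ∀ v, 1 / 50 * θ / (2 * μ) * ‖v‖ ^ 2 ≤ ⟪hessg n p μ (M * X) w v, v⟫) ∧
    (∀ w : EuclideanSpace ℝ (Fin (n - 1)), μ / (4 * √2) ≤ ‖w‖ → ‖w‖ ≤ 1 / (20 * √5) →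
      1 / 2 * (1 / 50 * θ) ≤ ⟪w, gradg n p μ (M * X) w⟫ / ‖w‖) ∧
    (∀ w : EuclideanSpace ℝ (Fin (n - 1)), 1 / (20 * √5) ≤ ‖w‖ →
      ‖w‖ ≤ √((4 * (n : ℝ) - 1) / (4 * n)) →
      ⟪hessg n p μ (M * X) w w, w⟫ / ‖w‖ ^ 2 ≤ -(1 / 2 * (1 / 50 * θ))) ∧
    (∃ wstar ∈ GammaSet n, IsLocalMinOn (gfun n p μ (M * X)) (GammaSet n) wstar ∧
      ‖wstar‖ ≤ μ / 7 ∧ ∀ w' ∈ GammaSet n,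
        IsLocalMinOn (gfun n p μ (M * X)) (GammaSet n) w' → w' = wstar) := by
  have hn0 : (1 : ℝ) ≤ n := by exact_mod_cast hn
  have hμ1 : μ ≤ 1 / 1000 := by
    refine hμθ.trans ?_
    rw [div_le_iff₀ (by positivity)]
    linarith
  have hμ5 := div_four_sqrt_two_le hμ
  have hμ7 := div_seven_le hμ
  obtain ⟨ht, ht'⟩ := one_div_twenty_sqrt_five_bounds
  have hR0 : 1 / 2 ≤ √((4 * (n : ℝ) - 1) / (4 * n)) := by
    refine Real.le_sqrt_of_sq_le ?_
    rw [le_div_iff₀ (by positivity)]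
    linarith
  have hR1 : √((4 * (n : ℝ) - 1) / (4 * n)) < 1 := by
    rw [Real.sqrt_lt' one_pos, div_lt_iff₀ (by positivity)]
    linarith
  refine ⟨fun w hw v => hessg_ge h0 h1 hμ hμ1 hj hM hX₁ hw v,
    fun w hw hw' => gradg_ge h0 h1 hμ hj hM hX₂ (by linarith) hw',
    fun w hw hw' => hessg_le hn h0 h1 hμ hμθ hj hM hX₃ hw hw', ?_⟩
  obtain ⟨x, hxR, hx, hx7, huniq⟩ := exists_unique_localMin_of_landscape
    (f := gfun n p μ (M * X)) (r₀ := μ / 8) (r₁ := μ / 7) (ρ := μ / (4 * √2))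
    (t₁ := 1 / (20 * √5)) (R := √((4 * (n : ℝ) - 1) / (4 * n))) (c := 1 / 50 * θ / (2 * μ))
    (by linarith) (by linarith) hμ7 (by linarith) (by linarith) hR1 (by linarith)
    (by positivity) (fun w hw => contDiffAt_gfun hn _ hw)
    (fun w hw v => hessg_ge h0 h1 hμ hμ1 hj hM hX₁ hw v)
    (fun w hw hw' => by
      have hw0 : 0 < ‖w‖ := by linarith
      have h := gradg_ge h0 h1 hμ hj hM hX₂ hw hw'
      rw [le_div_iff₀ hw0] at h
      exact lt_of_lt_of_le (by positivity) h)
    (fun w hw hw' => by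
      have hw0 : 0 < ‖w‖ := by linarith
      have h := hessg_le hn h0 h1 hμ hμθ hj hM hX₃ hw hw'
      rw [div_le_iff₀ (by positivity)] at h
      refine lt_of_le_of_lt h ?_
      have : 0 < 1 / 2 * (1 / 50 * θ) * ‖w‖ ^ 2 := by positivity
      linarith)
  exact ⟨x, hxR, hx, hx7, huniq⟩

end assembly

section samplesize

/-- A self-bounding step: a sample size that dominates a logarithm of the problem parameters also
dominates the logarithm of the sample size. -/
lemma mul_log_pow_le_of_mul_log_pow_le {c K x P : ℝ} (hc : 1 ≤ c) (hK : 1 ≤ K)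
    (hx : Real.exp 1 ≤ x) (hKx : K ≤ x ^ 8)
    (hP : (4096 * c) ^ 4 * K * Real.log x ^ 4 ≤ P) :
    c * K * Real.log P ^ 4 ≤ P ∧ (4096 * c) ^ 4 ≤ P := by
  have hx0 : 0 < x := (Real.exp_pos 1).trans_le hx
  have hΛ : 1 ≤ Real.log x := (Real.le_log_iff_exp_le hx0).mpr hx
  have hc0 : 0 < c := by linarith
  have hcP : (4096 * c) ^ 4 ≤ P := by
    refine le_trans ?_ hP
    have h1 : 1 ≤ K * Real.log x ^ 4 := one_le_mul_of_one_le_of_one_le hK (one_le_pow₀ hΛ)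
    have : 0 ≤ (4096 * c) ^ 4 := by positivity
    nlinarith
  have hP0 : 0 < P := lt_of_lt_of_le (by positivity) hcP
  have hℓ : 0 ≤ Real.log P := by
    refine Real.log_nonneg (le_trans ?_ hcP)
    exact one_le_pow₀ (by linarith)
  refine ⟨?_, hcP⟩
  rcases le_or_gt (Real.log P) (32 * Real.log x) with h | h
  · refine le_trans ?_ hP
    calc c * K * Real.log P ^ 4 ≤ c * K * (32 * Real.log x) ^ 4 := by gcongr
      _ = (32 ^ 4 * c) * K * Real.log x ^ 4 := by ring
      _ ≤ (4096 * c) ^ 4 * K * Real.log x ^ 4 := by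
        gcongr
        nlinarith [pow_le_pow_right₀ hc (show 1 ≤ 4 by norm_num)]
  · set y := Real.exp (Real.log P / 8) with hy
    have hy0 : 0 < y := Real.exp_pos _
    have hy8 : y ^ 8 = P := by
      rw [hy, ← Real.exp_nat_mul]
      push_cast
      rw [mul_div_cancel₀ _ (by norm_num), Real.exp_log hP0]
    have hKy : K ≤ y ^ 2 := by
      have hxy : x ≤ Real.exp (Real.log P / 32) := by
        rw [← Real.log_le_iff_le_exp hx0]
        linarith
      calc K ≤ x ^ 8 := hKx
        _ ≤ Real.exp (Real.log P / 32) ^ 8 := by gcongr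
        _ = y ^ 2 := by
          rw [hy, ← Real.exp_nat_mul, ← Real.exp_nat_mul]
          congr 1
          push_cast
          ring
    have hℓy : Real.log P ≤ 8 * y := by
      linarith [Real.add_one_le_exp (Real.log P / 8)]
    have hcy : 4096 * c ≤ y ^ 2 := by
      refine le_of_pow_le_pow_left₀ (n := 4) (by norm_num) (by positivity) ?_
      rw [← pow_mul, hy8]
      exact hcP
    calc c * K * Real.log P ^ 4 ≤ c * y ^ 2 * (8 * y) ^ 4 := by gcongr
      _ = 4096 * c * y ^ 6 := by ring
      _ ≤ y ^ 2 * y ^ 6 := by gcongr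
      _ = P := by rw [← hy8]; ring

lemma monomial_le {r L κ : ℝ} (hr : 1 ≤ r) (hL : 1 ≤ L) (hκ : 1 ≤ κ) {a b c : ℕ} (ha : a ≤ 8)
    (hb : b ≤ 8) (hc : c ≤ 8) : r ^ a * L ^ b * κ ^ c ≤ r ^ 8 * L ^ 8 * κ ^ 8 := by
  gcongr

lemma pow_mul_exp_neg_le {P Z : ℝ} {k : ℕ} (hP : 3 ≤ P)
    (hZ : (2 * k + 6) * Real.log P ≤ Z) :
    (2 * P + 1) ^ k * (2 * Real.exp (-Z)) ≤ 2 / P ^ 6 := by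
  have hP0 : 0 < P := by linarith
  have he : Real.exp (-Z) ≤ 1 / (P ^ 2) ^ k * (1 / P ^ 6) := by
    calc Real.exp (-Z) ≤ Real.exp (-((2 * k + 6) * Real.log P)) := by gcongr
      _ = 1 / (P ^ 2) ^ k * (1 / P ^ 6) := by
        rw [Real.exp_neg, ← pow_mul, one_div_mul_one_div, ← pow_add, one_div]
        congr 1
        rw [mul_comm, Real.exp_mul, Real.exp_log hP0, ← Real.rpow_natCast]
        push_cast
        rfl
  calc (2 * P + 1) ^ k * (2 * Real.exp (-Z))
      ≤ (P ^ 2) ^ k * (2 * (1 / (P ^ 2) ^ k * (1 / P ^ 6))) := by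
        gcongr
        nlinarith
    _ = 2 / P ^ 6 := by field_simp

end samplesize

section probability

variable {θ μ κ r L P : ℝ}

/-- The perturbation radius tolerated by the concentration argument. -/
def tolerance (μ r L : ℝ) : ℝ := μ ^ 2 / (100000 * (r ^ 3 * L))

lemma tolerance_bounds (hμ : 0 < μ) (hμ1 : μ ≤ 1) (hr : 1 ≤ r) (hL : 1 ≤ L) :
    0 < tolerance μ r L ∧ tolerance μ r L ≤ 1 := by
  have hr0 : 0 < r := by linarith
  have hL0 : 0 < L := by linarith
  refine ⟨by unfold tolerance; positivity, ?_⟩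
  rw [tolerance, div_le_one (by positivity)]
  have h1 : 1 ≤ r ^ 3 * L := one_le_mul_of_one_le_of_one_le (one_le_pow₀ hr) hL
  nlinarith

lemma tolerance_le_of_large (h0 : 0 < θ) (h1 : θ ≤ 1) (hμ : 0 < μ) (hμ1 : μ ≤ 1) (hr : 1 ≤ r)
    (hL : 1 ≤ L) (hκ : 1 ≤ κ) (hP : 0 < P)
    (H : 10 ^ 16 * (r ^ 8 * L ^ 8 * κ ^ 8) ≤ P * μ ^ 4 * θ ^ 2) :
    r * (8 * r ^ 3 / P) ≤ tolerance μ r L := by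
  have hr0 : 0 < r := by linarith
  have hL0 : 0 < L := by linarith
  rw [tolerance, le_div_iff₀ (by positivity)]
  have e : r * (8 * r ^ 3 / P) * (100000 * (r ^ 3 * L)) = 800000 * (r ^ 7 * L ^ 1 * κ ^ 0) / P := by
    field_simp
    ring
  rw [e, div_le_iff₀ hP]
  have hm := monomial_le hr hL hκ (a := 7) (b := 1) (c := 0) (by norm_num) (by norm_num)
    (by norm_num)
  have hm0 : 0 ≤ r ^ 7 * L ^ 1 * κ ^ 0 := by positivity
  have hle : P * μ ^ 4 * θ ^ 2 ≤ P * μ ^ 2 * 1 := by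
    gcongr ?_ * ?_
    · gcongr P * ?_
      exact pow_le_pow_of_le_one hμ.le hμ1 (by norm_num)
    · exact pow_le_one₀ h0.le h1
  linarith

lemma covariance_tolerance_le (h0 : 0 < θ) (h1 : θ ≤ 1) (hμ : 0 < μ) (hμ1 : μ ≤ 1) (hr : 1 ≤ r)
    (hL : 1 ≤ L) (hκ : 1 ≤ κ) (hP : 0 < P)
    (H : 10 ^ 16 * (r ^ 8 * L ^ 8 * κ ^ 8) ≤ P * μ ^ 4 * θ ^ 2) :
    (r * (7 * L)) ^ 2 * (r * (1 / P) * 2) + θ * (r * (1 / P) * 2) ≤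
      tolerance μ r L / (2 * κ ^ 2) * θ / 2 := by
  have hr0 : 0 < r := by linarith
  have hL0 : 0 < L := by linarith
  have hκ0 : 0 < κ := by linarith
  have e1 : tolerance μ r L / (2 * κ ^ 2) * θ / 2 =
      μ ^ 2 * θ / (400000 * (r ^ 3 * L * κ ^ 2)) := by
    rw [tolerance]
    field_simp
    norm_num
  have e2 : ((r * (7 * L)) ^ 2 * (r * (1 / P) * 2) + θ * (r * (1 / P) * 2)) *
      (400000 * (r ^ 3 * L * κ ^ 2)) =
      800000 * (49 * (r ^ 6 * L ^ 3 * κ ^ 2) + θ * (r ^ 4 * L ^ 1 * κ ^ 2)) / P := by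
    field_simp
    ring
  rw [e1, le_div_iff₀ (by positivity), e2, div_le_iff₀ hP]
  have hm := monomial_le hr hL hκ (a := 6) (b := 3) (c := 2) (by norm_num) (by norm_num)
    (by norm_num)
  have hm' := monomial_le hr hL hκ (a := 4) (b := 1) (c := 2) (by norm_num) (by norm_num)
    (by norm_num)
  have hm0 : 0 ≤ r ^ 4 * L ^ 1 * κ ^ 2 := by positivity
  have hθm : θ * (r ^ 4 * L ^ 1 * κ ^ 2) ≤ 1 * (r ^ 4 * L ^ 1 * κ ^ 2) := by gcongr
  have hle : P * μ ^ 4 * θ ^ 2 ≤ P * μ ^ 2 * θ ^ 1 := by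
    gcongr ?_ * ?_
    · gcongr P * ?_
      exact pow_le_pow_of_le_one hμ.le hμ1 (by norm_num)
    · exact pow_le_pow_of_le_one h0.le h1 (by norm_num)
  have hpos : 0 < r ^ 8 * L ^ 8 * κ ^ 8 := by positivity
  linarith

lemma covariance_exponent_ge (h0 : 0 < θ) (hμ : 0 < μ) (hr : 1 ≤ r)
    (hL : 1 ≤ L) (hκ : 1 ≤ κ) (hP : 0 < P)
    (H : 10 ^ 16 * (r ^ 8 * L ^ 8 * κ ^ 8) ≤ P * μ ^ 4 * θ ^ 2) :
    20 * r ^ 2 * L ^ 2 ≤ P * (tolerance μ r L / (2 * κ ^ 2) * θ / 2) ^ 2 / (128 * 4 ^ 2) := by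
  have hr0 : 0 < r := by linarith
  have hL0 : 0 < L := by linarith
  have hκ0 : 0 < κ := by linarith
  have e : P * (tolerance μ r L / (2 * κ ^ 2) * θ / 2) ^ 2 / (128 * 4 ^ 2) =
      P * μ ^ 4 * θ ^ 2 / (32768 * 10 ^ 10 * (r ^ 6 * L ^ 2 * κ ^ 4)) := by
    rw [tolerance]
    field_simp
    norm_num
  have e' : 20 * r ^ 2 * L ^ 2 * (32768 * 10 ^ 10 * (r ^ 6 * L ^ 2 * κ ^ 4)) =
      655360 * 10 ^ 10 * (r ^ 8 * L ^ 4 * κ ^ 4) := by ring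
  rw [e, le_div_iff₀ (by positivity), e']
  have hm := monomial_le hr hL hκ (a := 8) (b := 4) (c := 4) (by norm_num) (by norm_num)
    (by norm_num)
  have hm0 : 0 ≤ r ^ 8 * L ^ 4 * κ ^ 4 := by positivity
  linarith

lemma curvature_exponent_ge (h0 : 0 < θ) (hμ : 0 < μ) (hμ1 : μ ≤ 1) (hr : 1 ≤ r)
    (hL : 1 ≤ L) (hκ : 1 ≤ κ) (hP : 0 < P)
    (H : 10 ^ 16 * (r ^ 8 * L ^ 8 * κ ^ 8) ≤ P * μ ^ 4 * θ ^ 2) :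
    20 * r ^ 2 * L ^ 2 ≤ P * (θ / 200) ^ 2 / (128 * (32 * r ^ 3 / μ) ^ 2) := by
  have hr0 : 0 < r := by linarith
  have e : P * (θ / 200) ^ 2 / (128 * (32 * r ^ 3 / μ) ^ 2) =
      P * μ ^ 2 * θ ^ 2 / (5242880000 * r ^ 6) := by
    field_simp
    norm_num
  have e' : 20 * r ^ 2 * L ^ 2 * (5242880000 * r ^ 6) =
      104857600000 * (r ^ 8 * L ^ 2 * κ ^ 0) := by ring
  rw [e, le_div_iff₀ (by positivity), e']
  have hm := monomial_le hr hL hκ (a := 8) (b := 2) (c := 0) (by norm_num) (by norm_num)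
    (by norm_num)
  have hm0 : 0 ≤ r ^ 8 * L ^ 2 * κ ^ 0 := by positivity
  have hle : P * μ ^ 4 * θ ^ 2 ≤ P * μ ^ 2 * θ ^ 2 := by
    gcongr ?_ * _
    gcongr P * ?_
    exact pow_le_pow_of_le_one hμ.le hμ1 (by norm_num)
  linarith

lemma sq_le_of_large (h0 : 0 < θ) (h1 : θ ≤ 1) (hμ : 0 < μ) (hμ1 : μ ≤ 1) (hr : 1 ≤ r)
    (hL : 1 ≤ L) (hκ : 1 ≤ κ) (hP : 0 < P)
    (H : 10 ^ 16 * (r ^ 8 * L ^ 8 * κ ^ 8) ≤ P * μ ^ 4 * θ ^ 2) :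
    r ^ 2 ≤ P := by
  have hm := monomial_le hr hL hκ (a := 2) (b := 0) (c := 0) (by norm_num) (by norm_num)
    (by norm_num)
  have hle : P * μ ^ 4 * θ ^ 2 ≤ P * 1 * 1 := by
    gcongr ?_ * ?_
    · gcongr P * ?_
      exact pow_le_one₀ hμ.le hμ1
    · exact pow_le_one₀ h0.le h1
  have hm0 : 0 ≤ r ^ 2 := by positivity
  linarith

variable {n p : ℕ}

/-- The sample is regular and approximates the population curvature with overwhelming
probability. -/
theorem measureReal_compl_inter_curvApprox_le (h0 : 0 < θ) (h1 : θ ≤ 1 / 2) (hn : 0 < n)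
    (hμ : 0 < μ) (hμθ : μ ≤ θ) (hκ : 1 ≤ κ) (hp : 3 ≤ p) (hL1 : 1 ≤ Real.log p)
    (H : 10 ^ 16 * (√n ^ 8 * √(Real.log p) ^ 8 * κ ^ 8) ≤ p * μ ^ 4 * θ ^ 2)
    {T₁ T₂ T₃ :
      Set (EuclideanSpace ℝ (Fin n) × EuclideanSpace ℝ (Fin n) × EuclideanSpace ℝ (Fin n))}
    (hT₁ : T₁ ⊆ tripleSet n √n) (hT₂ : T₂ ⊆ tripleSet n √n) (hT₃ : T₃ ⊆ tripleSet n √n) :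
    (Measure.pi fun _ : Fin p => bgVec θ n).real
      (regularSample n p θ (7 * √(Real.log p))
          (tolerance μ √n √(Real.log p) / (2 * κ ^ 2)) ∩
        (curvApprox n p θ μ (tolerance μ √n √(Real.log p)) T₁ ∩
          (curvApprox n p θ μ (tolerance μ √n √(Real.log p)) T₂ ∩
            curvApprox n p θ μ (tolerance μ √n √(Real.log p)) T₃)))ᶜ ≤ 10 / (p : ℝ) ^ 6 := by
  have hn1 : (1 : ℝ) ≤ n := by exact_mod_cast hn
  have hp3 : (3 : ℝ) ≤ p := by exact_mod_cast hp
  have hP : (0 : ℝ) < p := by linarith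
  have hp0 : 0 < p := by omega
  have hr : 1 ≤ √(n : ℝ) := Real.one_le_sqrt.mpr hn1
  have hL : 1 ≤ √(Real.log p) := Real.one_le_sqrt.mpr hL1
  have hμ1 : μ ≤ 1 := by linarith
  have h1' : θ ≤ 1 := by linarith
  have hr2 : √(n : ℝ) ^ 2 = n := Real.sq_sqrt (by linarith)
  have hL2 : √(Real.log p) ^ 2 = Real.log p := Real.sq_sqrt (by linarith)
  obtain ⟨hδ0, hδ1⟩ := tolerance_bounds hμ hμ1 hr hL
  have hδ : 100000 * (√n ^ 3 * √(Real.log p) * tolerance μ √n √(Real.log p)) ≤ μ ^ 2 := by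
    rw [tolerance]
    refine le_of_eq ?_
    field_simp
  have hδp := tolerance_le_of_large h0 h1' hμ hμ1 hr hL hκ hP H
  have hcov := covariance_tolerance_le h0 h1' hμ hμ1 hr hL hκ hP H
  have hexp₁ := covariance_exponent_ge h0 hμ hr hL hκ hP H
  have hexp₂ := curvature_exponent_ge h0 hμ hμ1 hr hL hκ hP H
  have hnp := sq_le_of_large h0 h1' hμ hμ1 hr hL hκ hP H
  rw [hr2] at hnp
  rw [hr2, hL2] at hexp₁ hexp₂
  set L := √(Real.log p) with hLdef
  set δ := tolerance μ √n L with hδdef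
  set ε := δ / (2 * κ ^ 2) with hε
  have hε0 : 0 ≤ ε := by positivity
  have hε1 : ε ≤ 1 := by
    rw [hε, div_le_one (by positivity)]
    nlinarith
  have := isProbabilityMeasure_bgVec h0.le h1' n
  set ν := Measure.pi fun _ : Fin p => bgVec θ n
  have hnℓ : ∀ c : ℝ, c ≤ 20 * n → c * Real.log p ≤ 20 * n * Real.log p :=
    fun c hc => mul_le_mul_of_nonneg_right hc (by linarith)
  have bound₀ : ν.real (regularSample n p θ (7 * L) ε)ᶜ ≤ 4 / (p : ℝ) ^ 6 := by
    refine (measureReal_compl_regularSample_le h0 h1' hp0 (by positivity) hε0 hε1 hcov).trans ?_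
    have hA : (p : ℝ) * n * (2 * Real.exp (-((7 * L) ^ 2 / 4))) ≤ 2 / (p : ℝ) ^ 6 := by
      refine le_trans ?_ (pow_mul_exp_neg_le (k := 2) hp3 (Z := (7 * L) ^ 2 / 4) ?_)
      · gcongr
        nlinarith
      · rw [mul_pow, hL2]
        push_cast
        linarith
    have hB : (2 * (p : ℝ) + 1) ^ n *
        (2 * Real.exp (-(p * (ε * θ / 2) ^ 2 / (128 * 4 ^ 2)))) ≤ 2 / (p : ℝ) ^ 6 :=
      pow_mul_exp_neg_le hp3 ((hnℓ _ (by linarith)).trans hexp₁)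
    calc _ ≤ 2 / (p : ℝ) ^ 6 + 2 / (p : ℝ) ^ 6 := add_le_add hA hB
      _ = 4 / (p : ℝ) ^ 6 := by ring
  have bound : ∀ {T}, T ⊆ tripleSet n √n →
      ν.real (regularSample n p θ (7 * L) ε \ curvApprox n p θ μ δ T) ≤ 2 / (p : ℝ) ^ 6 := by
    intro T hT
    refine (measureReal_regularSample_diff_curvApprox_le h0 h1 hn hμ hμθ hp0 hL hε1 hδ0.le hδ1 hδ
      hδp hT).trans (pow_mul_exp_neg_le hp3 ((hnℓ _ ?_).trans hexp₂))
    push_cast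
    linarith
  have hsub : ∀ R A B D : Set (Fin p → Fin n → ℝ),
      (R ∩ (A ∩ (B ∩ D)))ᶜ ⊆ Rᶜ ∪ (R \ A ∪ (R \ B ∪ R \ D)) := by
    intro R A B D x hx
    by_cases hR : x ∈ R
    · by_cases hA : x ∈ A
      · by_cases hB : x ∈ B
        · exact Or.inr (Or.inr (Or.inr ⟨hR, fun hD => hx ⟨hR, hA, hB, hD⟩⟩))
        · exact Or.inr (Or.inr (Or.inl ⟨hR, hB⟩))
      · exact Or.inr (Or.inl ⟨hR, hA⟩)
    · exact Or.inl hR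
  refine (measureReal_mono (hsub _ _ _ _)).trans ?_
  refine (measureReal_union_le _ _).trans ?_
  refine (add_le_add bound₀ ((measureReal_union_le _ _).trans (add_le_add (bound hT₁)
    ((measureReal_union_le _ _).trans (add_le_add (bound hT₂) (bound hT₃)))))).trans ?_
  refine le_of_eq ?_
  ring

end probability

section transfer

lemma kappa_bounds {n : ℕ} (hn : 0 < n) {s : Fin n → ℝ} (hs : ∀ i, 0 < s i) :
    0 < ⨅ i, s i ∧ (∀ i, ⨅ i, s i ≤ s i) ∧ (∀ i, s i ≤ ⨆ i, s i) ∧ 1 ≤ kappa s := by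
  have : Nonempty (Fin n) := ⟨⟨0, hn⟩⟩
  have hl : ∀ i, ⨅ i, s i ≤ s i := ciInf_le (Set.finite_range s).bddBelow
  have hu : ∀ i, s i ≤ ⨆ i, s i := le_ciSup (Set.finite_range s).bddAbove
  have h0 : 0 < ⨅ i, s i := by
    obtain ⟨i, hi⟩ := exists_eq_ciInf_of_finite (f := s)
    rw [← hi]
    exact hs i
  refine ⟨h0, hl, hu, ?_⟩
  rw [kappa, one_le_div h0]
  exact (hl ⟨0, hn⟩).trans (hu ⟨0, hn⟩)

lemma sample_size_bound {N κ μ θ P : ℝ} (hN : 1 ≤ N) (hκ : 1 ≤ κ) (hμ : 0 < μ) (hμ1 : μ ≤ 1 / 10)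
    (h0 : 0 < θ) (h1 : θ ≤ 1)
    (hP : (4096 * 10 ^ 16) ^ 4 / θ ^ 2 * max (N ^ 4 / μ ^ 4) (N ^ 5 / μ ^ 2) * κ ^ 8 *
      Real.log (κ * N / (μ * θ)) ^ 4 ≤ P) :
    10 ^ 16 * (N ^ 4 * Real.log P ^ 4 * κ ^ 8) ≤ P * μ ^ 4 * θ ^ 2 ∧ 10 ≤ P := by
  have hN0 : 0 < N := by linarith
  have hκ0 : 0 < κ := by linarith
  have hμθ : μ * θ ≤ 1 / 10 := by nlinarith
  have hx : Real.exp 1 ≤ κ * N / (μ * θ) := by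
    rw [le_div_iff₀ (by positivity)]
    have : Real.exp 1 * (μ * θ) ≤ 3 * (1 / 10) := by
      gcongr
      linarith [Real.exp_one_lt_d9]
    nlinarith
  have hμp : ∀ k, μ ^ k ≤ 1 := fun k => pow_le_one₀ hμ.le (by linarith)
  have hθp : ∀ k, θ ^ k ≤ 1 := fun k => pow_le_one₀ h0.le h1
  have hK : 1 ≤ N ^ 4 * κ ^ 8 / (μ ^ 4 * θ ^ 2) := by
    rw [one_le_div (by positivity)]
    exact (mul_le_one₀ (hμp 4) (by positivity) (hθp 2)).trans
      (one_le_mul_of_one_le_of_one_le (one_le_pow₀ hN) (one_le_pow₀ hκ))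
  have hKx : N ^ 4 * κ ^ 8 / (μ ^ 4 * θ ^ 2) ≤ (κ * N / (μ * θ)) ^ 8 := by
    rw [div_pow, mul_pow, mul_pow, mul_comm (κ ^ 8)]
    gcongr ?_ * _ / (?_ * ?_)
    · exact pow_le_pow_right₀ hN (by norm_num)
    · exact pow_le_pow_of_le_one hμ.le (by linarith) (by norm_num)
    · exact pow_le_pow_of_le_one h0.le h1 (by norm_num)
  obtain ⟨h2, h3⟩ := mul_log_pow_le_of_mul_log_pow_le (c := 10 ^ 16) (P := P) (by norm_num) hK hx
    hKx (le_trans (by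
      calc (4096 * 10 ^ 16) ^ 4 * (N ^ 4 * κ ^ 8 / (μ ^ 4 * θ ^ 2)) *
            Real.log (κ * N / (μ * θ)) ^ 4
          = (4096 * 10 ^ 16) ^ 4 / θ ^ 2 * (N ^ 4 / μ ^ 4) * κ ^ 8 *
            Real.log (κ * N / (μ * θ)) ^ 4 := by field_simp
        _ ≤ _ := by
          gcongr
          exact le_max_left _ _) hP)
  refine ⟨?_, le_trans (by norm_num) h3⟩
  have e : 10 ^ 16 * (N ^ 4 * κ ^ 8 / (μ ^ 4 * θ ^ 2)) * Real.log P ^ 4 =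
      10 ^ 16 * (N ^ 4 * Real.log P ^ 4 * κ ^ 8) / (μ ^ 4 * θ ^ 2) := by field_simp
  rw [e, div_le_iff₀ (by positivity)] at h2
  rwa [mul_assoc P]

lemma ofReal_le_bgMatrix_of_preimage_subset {n p : ℕ} {θ c : ℝ} (h0 : 0 ≤ θ) (h1 : θ ≤ 1)
    (hc : 0 ≤ c) {G : Set (Fin p → Fin n → ℝ)}
    (hG : (Measure.pi fun _ : Fin p => bgVec θ n).real Gᶜ ≤ c) {A : Set (Fin n → Fin p → ℝ)}
    (hA : ∀ X : Fin n → Fin p → ℝ, (fun k i => X i k) ∈ G → X ∈ A) :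
    ENNReal.ofReal (1 - c) ≤ bgMatrix θ n p A := by
  have := isProbabilityMeasure_bgVec h0 h1 n
  have hf : Measurable fun (X : Fin n → Fin p → ℝ) k i => X i k := by fun_prop
  have huniv : bgMatrix θ n p Set.univ = 1 := by
    rw [← Set.preimage_univ (f := fun (X : Fin n → Fin p → ℝ) k i => X i k),
      ← Measure.map_apply hf MeasurableSet.univ, bgMatrix_map_transpose, measure_univ]
  have hbad : bgMatrix θ n p Aᶜ ≤ ENNReal.ofReal c := by
    calc bgMatrix θ n p Aᶜ
        ≤ bgMatrix θ n p ((fun (X : Fin n → Fin p → ℝ) k i => X i k) ⁻¹' Gᶜ) :=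
          measure_mono fun X hX hXG => hX (hA X hXG)
      _ ≤ (bgMatrix θ n p).map (fun X k i => X i k) Gᶜ := Measure.le_map_apply hf.aemeasurable _
      _ = ENNReal.ofReal ((Measure.pi fun _ : Fin p => bgVec θ n).real Gᶜ) := by
          rw [bgMatrix_map_transpose, ofReal_measureReal]
      _ ≤ ENNReal.ofReal c := ENNReal.ofReal_le_ofReal hG
  rw [ENNReal.ofReal_sub _ hc, ENNReal.ofReal_one, tsub_le_iff_right, ← huniv]
  refine (measure_mono (Set.union_compl_self A).ge).trans ((measure_union_le _ _).trans ?_)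
  gcongr

end transfer

/-- Theorem: high-dimensional landscape, complete dictionary. -/
theorem statement2 :
    ∃ cstar C ca cb : ℝ, 0 < cstar ∧ 0 < C ∧ 0 < ca ∧ 0 < cb ∧
      ∀ (n p : ℕ) (θ μ : ℝ) (A₀ U V : Matrix (Fin n) (Fin n) ℝ) (s : Fin n → ℝ),
        IsUnit A₀ → U * Uᵀ = 1 → V * Vᵀ = 1 → (∀ i, 0 < s i) →
        A₀ = U * Matrix.diagonal s * Vᵀ →
        θ ∈ Set.Ioo (0 : ℝ) (1 / 2) → 0 < μ →
        μ < ca * min (θ / n) ((n : ℝ) ^ (-(5 : ℝ) / 4)) →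
        C / (cstar ^ 2 * θ ^ 2) * max ((n : ℝ) ^ 4 / μ ^ 4) ((n : ℝ) ^ 5 / μ ^ 2) *
            kappa s ^ 8 * Real.log (kappa s * (n : ℝ) / (μ * θ)) ^ 4 ≤ (p : ℝ) →
        ENNReal.ofReal (1 - cb / (p : ℝ) ^ 6) ≤
          bgMatrix θ n p
            {X | ∀ S : Matrix (Fin n) (Fin n) ℝ, S.PosDef →
                 S * S = A₀ * Matrix.of X * (A₀ * Matrix.of X)ᵀ →
                 -- the preconditioned, rotated data matrix `V Uᵀ Ȳ`
                 -- with `Ȳ = √(pθ) (YYᵀ)^{-1/2} Y`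
                 (∀ w : EuclideanSpace ℝ (Fin (n - 1)), ‖w‖ ≤ μ / (4 * Real.sqrt 2) →
                    ∀ v : EuclideanSpace ℝ (Fin (n - 1)),
                      cstar * θ / (2 * μ) * ‖v‖ ^ 2 ≤
                        ⟪hessg n p μ
                          (Real.sqrt ((p : ℝ) * θ) •
                            (V * Uᵀ * S⁻¹ * (A₀ * Matrix.of X))) w v, v⟫) ∧
                 (∀ w : EuclideanSpace ℝ (Fin (n - 1)),
                    μ / (4 * Real.sqrt 2) ≤ ‖w‖ → ‖w‖ ≤ 1 / (20 * Real.sqrt 5) →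
                      1 / 2 * (cstar * θ) ≤
                        ⟪w, gradg n p μ
                          (Real.sqrt ((p : ℝ) * θ) •
                            (V * Uᵀ * S⁻¹ * (A₀ * Matrix.of X))) w⟫ / ‖w‖) ∧
                 (∀ w : EuclideanSpace ℝ (Fin (n - 1)),
                    1 / (20 * Real.sqrt 5) ≤ ‖w‖ →
                    ‖w‖ ≤ Real.sqrt ((4 * (n : ℝ) - 1) / (4 * n)) →
                      ⟪hessg n p μ
                          (Real.sqrt ((p : ℝ) * θ) •
                            (V * Uᵀ * S⁻¹ * (A₀ * Matrix.of X))) w w, w⟫ / ‖w‖ ^ 2 ≤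
                        -(1 / 2 * (cstar * θ))) ∧
                 (∃ wstar : EuclideanSpace ℝ (Fin (n - 1)),
                    wstar ∈ GammaSet n ∧
                    IsLocalMinOn
                      (gfun n p μ
                        (Real.sqrt ((p : ℝ) * θ) • (V * Uᵀ * S⁻¹ * (A₀ * Matrix.of X))))
                      (GammaSet n) wstar ∧
                    ‖wstar‖ ≤ μ / 7 ∧
                    ∀ w' ∈ GammaSet n,
                      IsLocalMinOn
                        (gfun n p μ
                          (Real.sqrt ((p : ℝ) * θ) • (V * Uᵀ * S⁻¹ * (A₀ * Matrix.of X))))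
                        (GammaSet n) w' → w' = wstar)} := by
  refine ⟨1 / 50, (1 / 50) ^ 2 * (4096 * 10 ^ 16) ^ 4, 1 / 50000, 10, by norm_num, by norm_num,
    by norm_num, by norm_num, ?_⟩
  intro n p θ μ A₀ U V s _ hU hV hs hA hθ hμ hμs hp
  obtain ⟨h0, h1⟩ := hθ
  rcases Nat.eq_zero_or_pos n with rfl | hn
  · have : μ < 0 := by
      refine hμs.trans_le ((mul_le_mul_of_nonneg_left (min_le_left _ _) (by norm_num)).trans ?_)
      simp
    exact absurd hμ this.not_gt
  have hN : (1 : ℝ) ≤ n := by exact_mod_cast hn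
  have hμθ : μ ≤ θ / (50000 * n) := by
    calc μ ≤ 1 / 50000 * (θ / n) :=
          hμs.le.trans (mul_le_mul_of_nonneg_left (min_le_left _ _) (by norm_num))
      _ = θ / (50000 * n) := by field_simp
  have hμθ' : 50000 * μ ≤ θ := by
    rw [le_div_iff₀ (by positivity)] at hμθ
    nlinarith
  obtain ⟨ha, hsa, hsb, hκ⟩ := kappa_bounds hn hs
  obtain ⟨H, hp10⟩ := sample_size_bound (N := n) (κ := kappa s) (μ := μ) (θ := θ) (P := p) hN hκ
    hμ (by linarith) h0 (by linarith) (le_trans (le_of_eq (by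
      congr 3
      field_simp)) hp)
  have hp3 : 3 ≤ p := by
    have : (3 : ℝ) ≤ p := by linarith
    exact_mod_cast this
  have hlog : 1 ≤ Real.log p := by
    rw [Real.le_log_iff_exp_le (by linarith)]
    linarith [Real.exp_one_lt_d9]
  have hr8 : √(n : ℝ) ^ 8 = (n : ℝ) ^ 4 := by
    rw [show 8 = 2 * 4 from rfl, pow_mul, Real.sq_sqrt (by linarith)]
  have hL8 : √(Real.log p) ^ 8 = Real.log p ^ 4 := by
    rw [show 8 = 2 * 4 from rfl, pow_mul, Real.sq_sqrt (by linarith)]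
  rw [← hr8, ← hL8] at H
  have hj : ((⟨n - 1, by omega⟩ : Fin n) : ℕ) = n - 1 := rfl
  obtain ⟨hδ0, hδ1⟩ := tolerance_bounds hμ (by linarith) (Real.one_le_sqrt.mpr hN)
    (Real.one_le_sqrt.mpr hlog)
  refine ofReal_le_bgMatrix_of_preimage_subset h0.le (by linarith) (by positivity)
    (measureReal_compl_inter_curvApprox_le h0 h1.le hn hμ (by linarith) hκ hp3 hlog H
      (convexTriples_subset hn hμ (by linarith) hj) (radialTriples_subset hn hμ hj)
      (concaveTriples_subset hn hj)) ?_
  rintro X ⟨⟨-, hcov⟩, hX₁, hX₂, hX₃⟩ S hS hSS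
  have hdata : √((p : ℝ) * θ) • (V * Uᵀ * S⁻¹ * (A₀ * Matrix.of X)) =
      (√((p : ℝ) * θ) • (V * Uᵀ * S⁻¹ * A₀)) * Matrix.of X := by
    rw [Matrix.smul_mul, Matrix.mul_assoc (V * Uᵀ * S⁻¹)]
  rw [hdata]
  refine landscape_of_curvApprox hn h0 h1.le hμ hμθ hj (fun c => ?_) hX₁ hX₂ hX₃
  have hκ2 : 0 < kappa s ^ 2 := by positivity
  refine (norm_precondition_sub_le (by omega) h0 hU hV ha hsa hsb hA hS hSS (by positivity) ?_
    hcov c).trans (le_of_eq ?_)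
  · rw [div_le_div_iff₀ (by positivity) (by norm_num)]
    nlinarith
  · rw [← kappa]
    field_simp

end
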